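/- arXiv:1003.3971 — 6 statements merged into one kernel-verified Lean document; each statement's English description precedes it below -/
import Mathlib

section
/- Let k be a field of characteristic 0, n ≥ 1, a₁,…,aₙ ∈ kˣ, and let φ = ⟨⟨a₁,…,aₙ⟩⟩ be the n-fold Pfister form on k^(2ⁿ); assume φ is anisotropic, i.e. φ(x) = 0 implies x = 0. Let b, c ∈ kˣ. Then the quadratic forms ψ₁ = φ ⊥ ⟨−b⟩φ ⊥ ⟨−c⟩, given by (x, y, z) ↦ φ(x) − b·φ(y) − c·z² on k^(2ⁿ) × k^(2ⁿ) × k, and ψ₂ = φ ⊥ ⟨−c⟩φ ⊥ ⟨−b⟩, given by (x, y, z) ↦ φ(x) − c·φ(y) − b·z², are birationally equivalent. -/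
open MvPolynomial

/-- Two polynomials (thought of as hypersurface equations over `k`) are
birationally equivalent if the fraction fields of the corresponding quotient
rings are isomorphic as `k`-algebras. -/
def BirationallyEquivalent (k : Type*) [Field k] {ι ι' : Type*}
    (Ψ : MvPolynomial ι k) (Ψ' : MvPolynomial ι' k) : Prop :=
  Nonempty (FractionRing (MvPolynomial ι k ⧸ Ideal.span {Ψ}) ≃ₐ[k]
    FractionRing (MvPolynomial ι' k ⧸ Ideal.span {Ψ'}))

/-- Localizing at non-zero-divisors does not change the total ring of fractions. -/
theorem exists_fractionRing_algEquiv_of_isLocalization (k : Type*) {A B : Type*} [CommRing k]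
    [CommRing A] [CommRing B] [Algebra k A] [Algebra k B] [Algebra A B] [IsScalarTower k A B]
    (M : Submonoid A) [IsLocalization M B] (hM : M ≤ nonZeroDivisors A) :
    ∃ e : FractionRing A ≃ₐ[k] FractionRing B,
      ∀ x, e (algebraMap A _ x) = algebraMap B _ (algebraMap A B x) := by
  have hu : ∀ y : M, IsUnit (algebraMap A (FractionRing A) y) := fun y =>
    IsLocalization.map_units (FractionRing A) (⟨y, hM y.2⟩ : nonZeroDivisors A)
  let : Algebra B (FractionRing A) := (IsLocalization.lift (M := M) hu).toAlgebra
  have : IsScalarTower A B (FractionRing A) :=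
    .of_algebraMap_eq fun x => (IsLocalization.lift_eq hu x).symm
  have : IsFractionRing B (FractionRing A) :=
    IsFractionRing.isFractionRing_of_isLocalization M B (FractionRing A) hM
  have : IsScalarTower k B (FractionRing A) := .of_algebraMap_eq fun x => by
    rw [IsScalarTower.algebraMap_apply k A B, ← IsScalarTower.algebraMap_apply A B,
      ← IsScalarTower.algebraMap_apply k A]
  refine ⟨((FractionRing.algEquiv B (FractionRing A)).symm.restrictScalars k), fun x => ?_⟩
  rw [IsScalarTower.algebraMap_apply A B (FractionRing A)]
  exact (FractionRing.algEquiv B (FractionRing A)).symm.commutes _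

/-- The polynomial `∑ dᵢ Xᵢ² - r`. -/
noncomputable def diagonalQuadric {V R : Type*} [Fintype V] [CommRing R] (d : V → R) (r : R) :
    MvPolynomial V R :=
  ∑ i, C (d i) * X i ^ 2 - C r

theorem map_diagonalQuadric {V R S : Type*} [Fintype V] [CommRing R] [CommRing S]
    (f : R →+* S) (d : V → R) (r : R) :
    map f (diagonalQuadric d r) = diagonalQuadric (fun i => f (d i)) (f r) := by
  simp [diagonalQuadric]

theorem coeff_diagonalQuadric {V R : Type*} [Fintype V] [CommRing R]
    (d : V → R) (r : R) (i : V) :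
    coeff (Finsupp.single i 2) (diagonalQuadric d r) = d i := by
  classical
  have h0 : (0 : V →₀ ℕ) ≠ Finsupp.single i 2 := fun h => by
    simpa using DFunLike.congr_fun h i
  simp only [diagonalQuadric, coeff_sub, coeff_sum, coeff_C_mul, coeff_C, h0, if_false, sub_zero,
    coeff_X_pow]
  rw [Finset.sum_eq_single i]
  · simp
  · intro j _ hj
    rw [if_neg, mul_zero]
    intro h
    exact hj (Finsupp.single_left_injective two_ne_zero h)
  · simp

theorem diagonalQuadric_dvd_of_dvd_C_mul {V R : Type*} [Fintype V] [CommRing R] [IsDomain R]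
    [UniqueFactorizationMonoid R] {d : V → R} {r p : R} {i : V} (hd : IsUnit (d i)) (hp : p ≠ 0)
    {f : MvPolynomial V R} (h : diagonalQuadric d r ∣ C p * f) : diagonalQuadric d r ∣ f := by
  refine IsRelPrime.dvd_of_dvd_mul_left (y := C p) ?_ h
  intro q hq hqp
  obtain ⟨b, -, rfl⟩ := (dvd_C_iff_exists hp).1 hqp
  have := (C_dvd_iff_dvd_coeff _ _).1 hq (Finsupp.single i 2)
  rw [coeff_diagonalQuadric] at this
  exact (isUnit_of_dvd_unit this hd).map C

/-- The total ring of fractions of a quadric over `R` may be computed over `Frac R`. -/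
theorem nonempty_fractionRing_quadric_algEquiv (k : Type*) {V R : Type*} [Field k] [Fintype V]
    [CommRing R] [IsDomain R] [UniqueFactorizationMonoid R] [Algebra k R]
    {d : V → R} (r : R) {i : V} (hd : IsUnit (d i)) :
    Nonempty (FractionRing (MvPolynomial V R ⧸ Ideal.span {diagonalQuadric d r}) ≃ₐ[k]
      FractionRing (MvPolynomial V (FractionRing R) ⧸ Ideal.span {diagonalQuadric
        (fun i => algebraMap R (FractionRing R) (d i)) (algebraMap R (FractionRing R) r)})) := by
  let : Algebra (MvPolynomial V R) (MvPolynomial V (FractionRing R)) := algebraMvPolynomial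
  set I := Ideal.span {diagonalQuadric d r}
  have hI : I.map (algebraMap (MvPolynomial V R) (MvPolynomial V (FractionRing R))) =
      Ideal.span {diagonalQuadric (fun i => algebraMap R (FractionRing R) (d i))
        (algebraMap R (FractionRing R) r)} := by
    rw [Ideal.map_span, Set.image_singleton, ← map_diagonalQuadric]
    rfl
  rw [← hI]
  have : IsScalarTower k (MvPolynomial V R) (MvPolynomial V (FractionRing R)) :=
    .of_algebraMap_eq fun x => by
      simp only [MvPolynomial.algebraMap_def, MvPolynomial.algebraMap_apply, map_C]
      rw [← IsScalarTower.algebraMap_apply]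
  have : IsScalarTower k (MvPolynomial V R ⧸ I)
      (MvPolynomial V (FractionRing R) ⧸
        I.map (algebraMap (MvPolynomial V R) (MvPolynomial V (FractionRing R)))) :=
    IsScalarTower.of_algebraMap_eq (R := k) (S := MvPolynomial V R ⧸ I) fun x => by
      change Ideal.Quotient.mk _ (algebraMap k (MvPolynomial V (FractionRing R)) x) =
        Ideal.Quotient.mk _ (algebraMap (MvPolynomial V R) (MvPolynomial V (FractionRing R))
          (algebraMap k (MvPolynomial V R) x))
      rw [← IsScalarTower.algebraMap_apply]
  obtain ⟨e, -⟩ := exists_fractionRing_algEquiv_of_isLocalization k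
    (A := MvPolynomial V R ⧸ I)
    (B := MvPolynomial V (FractionRing R) ⧸
        I.map (algebraMap (MvPolynomial V R) (MvPolynomial V (FractionRing R))))
    (Algebra.algebraMapSubmonoid (MvPolynomial V R ⧸ I)
      ((nonZeroDivisors R).map (C (σ := V)))) (by
    rintro _ ⟨_, ⟨p, hp, rfl⟩, rfl⟩
    refine mem_nonZeroDivisors_iff_right.2 fun x hx => ?_
    obtain ⟨f, rfl⟩ := Ideal.Quotient.mk_surjective x
    change Ideal.Quotient.mk I f * Ideal.Quotient.mk I (C p) = 0 at hx
    rw [← map_mul, Ideal.Quotient.eq_zero_iff_mem, Ideal.mem_span_singleton, mul_comm] at hx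
    rw [Ideal.Quotient.eq_zero_iff_mem, Ideal.mem_span_singleton]
    exact diagonalQuadric_dvd_of_dvd_C_mul hd (nonZeroDivisors.ne_zero hp) hx)
  exact ⟨e⟩

open Matrix in
/-- Every value of the diagonal form `d` is the multiplier of a (possibly degenerate) similarity. -/
def IsMultiplicativeForm {V F : Type*} [Fintype V] [DecidableEq V] [Field F] (d : V → F) : Prop :=
  ∀ u : V → F, ∃ M : Matrix V V F,
    Mᵀ * diagonal d * M = (∑ i, d i * u i ^ 2) • diagonal d

open Matrix in
theorem IsMultiplicativeForm.sum {V F : Type*} [Fintype V] [DecidableEq V] [Field F] {d : V → F}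
    (h : IsMultiplicativeForm d) (hd : ∀ i, d i ≠ 0) (a : F) :
    IsMultiplicativeForm (Sum.elim d fun i => -a * d i) := by
  have hD : diagonal d * diagonal (fun i => (d i)⁻¹) = 1 := by
    rw [diagonal_mul_diagonal, ← diagonal_one]; congr; ext i; exact mul_inv_cancel₀ (hd i)
  have hD' : diagonal (fun i => (d i)⁻¹) * diagonal d = 1 := mul_eq_one_comm.1 hD
  have hDt : (diagonal d)ᵀ = diagonal d := diagonal_transpose d
  have hEt : (diagonal fun i => (d i)⁻¹)ᵀ = diagonal fun i => (d i)⁻¹ := diagonal_transpose _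
  have key : diagonal (Sum.elim d fun i => -a * d i) =
      fromBlocks (diagonal d) 0 0 (-a • diagonal d) := by
    rw [← diagonal_smul, fromBlocks_diagonal]
    rfl
  set D := diagonal d
  set E := diagonal fun i => (d i)⁻¹
  have h' : ∀ u : V → F, ∃ M : Matrix V V F,
      Mᵀ * D * M = (∑ i, d i * u i ^ 2) • D ∧ M * E * Mᵀ = (∑ i, d i * u i ^ 2) • E := by
    intro u
    by_cases hp : ∑ i, d i * u i ^ 2 = 0
    · exact ⟨0, by simp [hp]⟩
    · obtain ⟨M, hM⟩ := h u
      refine ⟨M, hM, ?_⟩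
      generalize ∑ i, d i * u i ^ 2 = p at hp hM
      have h1 : (p⁻¹ • (E * Mᵀ * D)) * M = 1 := by
        rw [Matrix.smul_mul, Matrix.mul_assoc E, Matrix.mul_assoc E, hM, Matrix.mul_smul, hD',
          smul_smul, inv_mul_cancel₀ hp, one_smul]
      have h2 := mul_eq_one_comm.1 h1
      calc M * E * Mᵀ = p • ((M * (p⁻¹ • (E * Mᵀ * D))) * E) := by
            simp only [Matrix.mul_smul, Matrix.smul_mul, smul_smul, mul_inv_cancel₀ hp, one_smul,
              Matrix.mul_assoc, hD, Matrix.mul_one]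
        _ = p • E := by rw [h2, Matrix.one_mul]
  intro u
  obtain ⟨M, hM, hM'⟩ := h' fun i => u (Sum.inl i)
  obtain ⟨N, hN, -⟩ := h' fun i => u (Sum.inr i)
  simp only [Fintype.sum_sum_type, Sum.elim_inl, Sum.elim_inr, key, mul_assoc, ← Finset.mul_sum]
  generalize ∑ i, d i * u (Sum.inl i) ^ 2 = p at *
  generalize ∑ i, d i * u (Sum.inr i) ^ 2 = q at *
  by_cases hq : q = 0
  · refine ⟨fromBlocks M 0 0 M, ?_⟩
    rw [fromBlocks_transpose, fromBlocks_multiply, fromBlocks_multiply, fromBlocks_smul]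
    simp [← Matrix.mul_assoc, hM, hq, smul_comm p]
  · refine ⟨fromBlocks M (a • N) N (q⁻¹ • (N * E * Mᵀ * D * N)), ?_⟩
    have h12 : Nᵀ * D * (q⁻¹ • (N * E * Mᵀ * D * N)) = Mᵀ * D * N := by
      calc _ = q⁻¹ • ((Nᵀ * D * N) * E * Mᵀ * D * N) := by
            simp only [Matrix.mul_smul, Matrix.mul_assoc]
        _ = (D * E) * Mᵀ * D * N := by
            rw [hN]; simp only [Matrix.smul_mul, smul_smul, inv_mul_cancel₀ hq, one_smul]
        _ = _ := by rw [hD, Matrix.one_mul]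
    have h21 : (q⁻¹ • (N * E * Mᵀ * D * N))ᵀ * D * N = Nᵀ * D * M := by
      have := congrArg transpose h12
      simpa only [transpose_mul, hDt, transpose_transpose, Matrix.mul_assoc] using this
    have h22 : (q⁻¹ • (N * E * Mᵀ * D * N))ᵀ * D * (q⁻¹ • (N * E * Mᵀ * D * N)) = p • D := by
      calc _ = q⁻¹ • (((q⁻¹ • (N * E * Mᵀ * D * N))ᵀ * D * N) * E * Mᵀ * D * N) := by
            simp only [Matrix.mul_smul, Matrix.mul_assoc]
        _ = q⁻¹ • (Nᵀ * D * (M * E * Mᵀ) * D * N) := by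
            rw [h21]; simp only [Matrix.mul_assoc]
        _ = (q⁻¹ * p) • (Nᵀ * (D * E) * D * N) := by
            rw [hM']; simp only [Matrix.mul_smul, Matrix.smul_mul, smul_smul, Matrix.mul_assoc]
        _ = _ := by
            rw [hD, Matrix.mul_one, hN, smul_smul]; congr 1; field_simp
    rw [fromBlocks_transpose, fromBlocks_multiply, fromBlocks_multiply, fromBlocks_smul]
    simp only [Matrix.zero_mul, add_zero, zero_add, transpose_smul a,
      Matrix.mul_smul _ (-a), Matrix.mul_smul _ a, Matrix.smul_mul a, Matrix.smul_mul (-a),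
      smul_zero]
    congr 1
    · rw [← Matrix.mul_assoc, ← Matrix.mul_assoc, hM, hN]; module
    · rw [← Matrix.mul_assoc, ← Matrix.mul_assoc, h12]; module
    · rw [← Matrix.mul_assoc, ← Matrix.mul_assoc, h21]; module
    · rw [← Matrix.mul_assoc, ← Matrix.mul_assoc, h22, hN]; module

open Matrix in
theorem IsMultiplicativeForm.comp_equiv {V W F : Type*} [Fintype V] [DecidableEq V] [Fintype W]
    [DecidableEq W] [Field F] {d : V → F} (h : IsMultiplicativeForm d) (e : W ≃ V) :
    IsMultiplicativeForm (d ∘ e) := by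
  intro u
  obtain ⟨M, hM⟩ := h (u ∘ e.symm)
  refine ⟨M.submatrix e e, ?_⟩
  have hd : diagonal (d ∘ e) = (diagonal d).submatrix e e := (submatrix_diagonal_equiv d e).symm
  rw [hd, transpose_submatrix, submatrix_mul_equiv, submatrix_mul_equiv, hM,
    ← e.sum_comp]
  simp only [Function.comp_apply, Equiv.symm_apply_apply]
  rfl

/-- Pfister's theorem: Pfister forms are multiplicative. -/
theorem isMultiplicativeForm_pfister {F : Type*} [Field F] (n : ℕ) (a : Fin n → F)
    (ha : ∀ i, a i ≠ 0) :
    IsMultiplicativeForm fun ε : Fin n → Bool => ∏ i, if ε i then -a i else 1 := by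
  induction n with
  | zero =>
    intro u
    refine ⟨Matrix.diagonal u, ?_⟩
    rw [← Matrix.diagonal_smul]
    ext i j
    simp [Subsingleton.elim i j, Subsingleton.elim j default, sq]
    exact congrArg (fun v => u v * u v) (Subsingleton.elim _ _)
  | succ n ih =>
    let e : (Fin (n + 1) → Bool) ≃ (Fin n → Bool) ⊕ (Fin n → Bool) :=
      (Fin.consEquiv fun _ => Bool).symm.trans (Equiv.boolProdEquivSum _)
    have := ((ih (fun i => a i.succ) fun i => ha _).sum (fun ε => Finset.prod_ne_zero_iff.2
      fun i _ => by split_ifs <;> simp [ha]) (a 0)).comp_equiv e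
    convert this using 1
    ext ε
    rw [Fin.prod_univ_succ]
    cases h : ε 0 <;> simp [e, Fin.consEquiv, Equiv.boolProdEquivSum, h, Fin.tail] <;>
      first | rfl | exact Or.inl rfl

open Matrix in
theorem sum_mul_mulVec_sq {V R : Type*} [Fintype V] [DecidableEq V] [CommRing R] {d : V → R}
    {L : Matrix V V R} {c : R} (hL : Lᵀ * diagonal d * L = c • diagonal d) (x : V → R) :
    ∑ i, d i * (L *ᵥ x) i ^ 2 = c * ∑ i, d i * x i ^ 2 := by
  have h : ∀ y : V → R, ∑ i, d i * y i ^ 2 = y ⬝ᵥ (diagonal d *ᵥ y) := fun y => by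
    simp only [dotProduct, mulVec_diagonal]
    exact Finset.sum_congr rfl fun i _ => by ring
  rw [h, h, ← smul_eq_mul, ← dotProduct_smul, ← smul_mulVec, ← hL,
    ← mulVec_mulVec, ← mulVec_mulVec, dotProduct_mulVec _ Lᵀ, vecMul_transpose]

open Matrix in
/-- The linear substitution given by an invertible matrix. -/
noncomputable def linearSubstEquiv {V F : Type*} [Fintype V] [DecidableEq V] [CommRing F]
    (L L' : Matrix V V F) (h : L * L' = 1) : MvPolynomial V F ≃ₐ[F] MvPolynomial V F :=
  have key : ∀ A B : Matrix V V F, A * B = 1 →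
      (aeval fun i => ∑ j, C (B i j) * X j : MvPolynomial V F →ₐ[F] MvPolynomial V F).comp
        (aeval fun i => ∑ j, C (A i j) * X j) = AlgHom.id F _ := fun A B hAB => by
    ext1 i
    simp only [AlgHom.comp_apply, aeval_X, map_sum, map_mul, AlgHom.id_apply, algHom_C,
      MvPolynomial.algebraMap_eq, Finset.mul_sum]
    rw [Finset.sum_comm]
    simp only [← mul_assoc, ← map_mul, ← Finset.sum_mul, ← map_sum]
    simp only [← Matrix.mul_apply, hAB, Matrix.one_apply]
    simp
  AlgEquiv.ofAlgHom (aeval fun i => ∑ j, C (L i j) * X j) (aeval fun i => ∑ j, C (L' i j) * X j)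
    (key _ _ (mul_eq_one_comm.1 h)) (key _ _ h)

open Matrix in
theorem exists_algEquiv_diagonalQuadric {V F : Type*} [Fintype V] [DecidableEq V] [Field F]
    {d : V → F} (hd : ∀ i, d i ≠ 0) {L : Matrix V V F} {c : F} (hc : c ≠ 0)
    (hL : Lᵀ * diagonal d * L = c • diagonal d) (r : F) :
    ∃ e : MvPolynomial V F ≃ₐ[F] MvPolynomial V F,
      e (diagonalQuadric d (c * r)) = C c * diagonalQuadric d r := by
  have hinv : L * (c⁻¹ • (diagonal (fun i => (d i)⁻¹) * Lᵀ * diagonal d)) = 1 := by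
    rw [mul_eq_one_comm, Matrix.smul_mul, Matrix.mul_assoc, Matrix.mul_assoc, ← Matrix.mul_assoc Lᵀ,
      hL, Matrix.mul_smul, smul_smul, inv_mul_cancel₀ hc, one_smul, diagonal_mul_diagonal, ← diagonal_one]
    congr
    ext i
    exact inv_mul_cancel₀ (hd i)
  refine ⟨linearSubstEquiv L _ hinv, ?_⟩
  let ι : F →+* MvPolynomial V F := C
  have hL' : (L.map ι)ᵀ * diagonal (fun i => ι (d i)) * L.map ι =
      ι c • diagonal (fun i => ι (d i)) := by
    have := congrArg (fun M => M.map ι) hL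
    simpa [Matrix.map_mul, transpose_map, diagonal_map, Matrix.map_smul'] using this
  have hX : ∀ i, linearSubstEquiv L _ hinv (X i) = (L.map ι *ᵥ X) i := fun i => aeval_X _ i
  have hC : ∀ x, linearSubstEquiv L _ hinv (C x) = C x := fun x =>
    (linearSubstEquiv L _ hinv).commutes x
  simp only [diagonalQuadric, map_sub, map_sum, map_mul (linearSubstEquiv L _ hinv), map_pow, hX,
    hC, mul_sub, map_mul C]
  exact congrArg (· - C c * C r) (sum_mul_mulVec_sq hL' X)

/-- The birational involution `(y, z) ↦ (z² y / q(y), z)` of affine space. -/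
theorem exists_inversion_algEquiv {k V : Type*} [Field k] [Fintype V] (d : V → k)
    {q : MvPolynomial (V ⊕ Unit) k} (hq : q = ∑ i, C (d i) * X (Sum.inl i) ^ 2) (hq0 : q ≠ 0) :
    ∃ σ : FractionRing (MvPolynomial (V ⊕ Unit) k) ≃ₐ[k]
        FractionRing (MvPolynomial (V ⊕ Unit) k),
      (∀ i, σ (algebraMap (MvPolynomial (V ⊕ Unit) k) _ (X (Sum.inl i))) =
        algebraMap (MvPolynomial (V ⊕ Unit) k) _ (X (Sum.inr ())) ^ 2 *
          algebraMap (MvPolynomial (V ⊕ Unit) k) _ (X (Sum.inl i)) / algebraMap _ _ q) ∧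
      σ (algebraMap (MvPolynomial (V ⊕ Unit) k) _ (X (Sum.inr ()))) =
        algebraMap (MvPolynomial (V ⊕ Unit) k) _ (X (Sum.inr ())) := by
  let R := MvPolynomial (V ⊕ Unit) k
  let z : R := X (Sum.inr ())
  let s : R := z * q
  have hs : s ≠ 0 := mul_ne_zero (X_ne_zero _) hq0
  let S := Localization.Away s
  let ι := algebraMap R S
  let w : S := IsLocalization.Away.invSelf s
  have hw : ι z * ι q * w = 1 := by
    rw [← map_mul]; exact IsLocalization.Away.mul_invSelf s
  let f₀ : R →ₐ[k] S := aeval (R := k)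
    (Sum.elim (fun i : V => ι z ^ 3 * w * ι (X (Sum.inl i))) fun _ : Unit => ι z)
  have hfX : ∀ i, f₀ (X (Sum.inl i)) = ι z ^ 3 * w * ι (X (Sum.inl i)) := fun i => aeval_X _ _
  have hfz : f₀ z = ι z := aeval_X _ _
  have hfq : f₀ q = (ι z ^ 3 * w) ^ 2 * ι q := by
    rw [hq]
    simp only [map_sum, map_mul, map_pow, Finset.mul_sum]
    refine Finset.sum_congr rfl fun i _ => ?_
    have hC : f₀ (C (d i)) = ι (C (d i)) :=
      (f₀.commutes (d i)).trans (IsScalarTower.algebraMap_apply k R S (d i))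
    rw [hfX, hC]
    ring
  have hfs : f₀ s = ι z ^ 6 * w := by
    simp only [s, map_mul, hfz, hfq]
    linear_combination ι z ^ 6 * w * hw
  have hu : IsUnit (f₀ s) := by
    rw [hfs]
    exact ((IsUnit.of_mul_eq_one (ι q * w) (by rw [← hw]; ring)).pow 6).mul
      (IsUnit.of_mul_eq_one (ι z * ι q) (by rw [← hw]; ring))
  let f : S →ₐ[k] S := IsLocalization.Away.liftAlgHom (f := f₀) s hu
  have hf : ∀ x, f (ι x) = f₀ x := fun x => IsLocalization.Away.lift_eq s hu x
  have hfw : ι z ^ 6 * w * f w = 1 := by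
    rw [← hfs, ← hf, ← map_mul, ← map_one f]
    exact congrArg f (IsLocalization.Away.mul_invSelf s)
  have hff : f.comp f = AlgHom.id k S := by
    apply IsLocalization.algHom_ext (Submonoid.powers s)
    apply MvPolynomial.algHom_ext
    rintro (i | ⟨⟩)
    · change f (f (ι (X (Sum.inl i)))) = ι _
      simp only [hf, hfX, map_mul, map_pow, hfz]
      linear_combination ι (X (Sum.inl i)) * hfw
    · change f (f (ι z)) = ι z
      rw [hf, hfz, hf, hfz]
  obtain ⟨e, he⟩ := exists_fractionRing_algEquiv_of_isLocalization k (B := S)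
    (Submonoid.powers s) (powers_le_nonZeroDivisors_of_noZeroDivisors hs)
  let τ : FractionRing S ≃ₐ[k] FractionRing S :=
    IsFractionRing.algEquivOfAlgEquiv (AlgEquiv.ofAlgHom f f hff hff)
  have hτ : ∀ x, e.symm (τ (e (algebraMap R _ x))) = e.symm (algebraMap S _ (f₀ x)) := fun x => by
    rw [he, IsFractionRing.algEquivOfAlgEquiv_algebraMap]
    exact congrArg _ (congrArg _ (hf x))
  refine ⟨(e.trans τ).trans e.symm, fun i => ?_, ?_⟩
  · have hq' : algebraMap R (FractionRing R) q ≠ 0 := by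
      simpa using hq0
    change e.symm (τ (e (algebraMap R _ _))) = _
    have he' : ∀ x, algebraMap R (FractionRing R) x = e.symm (algebraMap S _ (ι x)) := fun x => by
      rw [← he, AlgEquiv.symm_apply_apply]
    have key : ι z ^ 3 * w * ι (X (Sum.inl i)) * ι q = ι z ^ 2 * ι (X (Sum.inl i)) := by
      linear_combination ι z ^ 2 * ι (X (Sum.inl i)) * hw
    have := congrArg (fun t => e.symm (algebraMap S (FractionRing S) t)) key
    rw [hτ, eq_div_iff hq', he', he', he', hfX]
    simpa only [map_mul, map_pow] using this
  · exact (hτ z).trans (by rw [hfz, ← he, AlgEquiv.symm_apply_apply])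

theorem nonempty_fractionRing_quotient_algEquiv {k A B : Type*} [CommRing k] [CommRing A]
    [CommRing B] [Algebra k A] [Algebra k B] (f : A ≃ₐ[k] B) {p : A} {u p' : B} (hu : IsUnit u)
    (hf : f p = u * p') :
    Nonempty (FractionRing (A ⧸ Ideal.span {p}) ≃ₐ[k] FractionRing (B ⧸ Ideal.span {p'})) :=
  ⟨IsFractionRing.algEquivOfAlgEquiv (Ideal.quotientEquivAlg (Ideal.span {p}) (Ideal.span {p'}) f (by
    rw [Ideal.map_span, Set.image_singleton]
    exact (Ideal.span_singleton_mul_left_unit hu p').symm.trans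
      (congrArg (fun t => Ideal.span {t}) hf.symm)))⟩

/-- A similarity with multiplier `c` identifies the quadrics `d = r'` and `d = r`
when `r'` is carried to `c * r` by an automorphism of the base field fixing `d`. -/
theorem nonempty_fractionRing_diagonalQuadric_algEquiv {k V F : Type*} [Field k] [Fintype V]
    [DecidableEq V] [Field F] [Algebra k F] (σ : F ≃ₐ[k] F) {d : V → k} (hd : ∀ i, d i ≠ 0)
    {L : Matrix V V F} {c : F} (hc : c ≠ 0)
    (hL : L.transpose * Matrix.diagonal (fun i => algebraMap k F (d i)) * L =
      c • Matrix.diagonal fun i => algebraMap k F (d i)) {r r' : F} (hr : σ r' = c * r) :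
    Nonempty (FractionRing (MvPolynomial V F ⧸
        Ideal.span {diagonalQuadric (fun i => algebraMap k F (d i)) r'}) ≃ₐ[k]
      FractionRing (MvPolynomial V F ⧸
        Ideal.span {diagonalQuadric (fun i => algebraMap k F (d i)) r})) := by
  obtain ⟨e, he⟩ := exists_algEquiv_diagonalQuadric (fun i => by simpa using hd i) hc hL r
  refine nonempty_fractionRing_quotient_algEquiv
    ((mapAlgEquiv V σ).trans (e.restrictScalars k)) ((Ne.isUnit hc).map C) ?_
  rw [← he, ← hr]
  refine congrArg e ((map_diagonalQuadric (σ : F →+* F) _ _).trans ?_)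
  congr 1
  ext i
  exact σ.commutes (d i)

/-- Interchanging `b` and `c` over a field with an inversion `(y, z) ↦ (z² y / q, z)`, where `q`
is the value of `d` at `y`. -/
theorem nonempty_fractionRing_diagonalQuadric_interchange {k V F : Type*} [Field k] [Fintype V]
    [DecidableEq V] [Field F] [Algebra k F] {d : V → k} (hd : ∀ i, d i ≠ 0)
    (hm : IsMultiplicativeForm fun i => algebraMap k F (d i)) (σ : F ≃ₐ[k] F) {y : V → F} {z q : F}
    (hq : q = ∑ i, algebraMap k F (d i) * y i ^ 2) (hq0 : q ≠ 0) (hz0 : z ≠ 0)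
    (hσy : ∀ i, σ (y i) = z ^ 2 * y i / q) (hσz : σ z = z) (b c : k) :
    Nonempty (FractionRing (MvPolynomial V F ⧸ Ideal.span {diagonalQuadric
        (fun i => algebraMap k F (d i)) (algebraMap k F b * q + algebraMap k F c * z ^ 2)}) ≃ₐ[k]
      FractionRing (MvPolynomial V F ⧸ Ideal.span {diagonalQuadric
        (fun i => algebraMap k F (d i)) (algebraMap k F c * q + algebraMap k F b * z ^ 2)})) := by
  obtain ⟨M, hM⟩ := hm y
  rw [← hq] at hM
  have hσq : σ q = z ^ 4 / q := by
    have : σ q = (z ^ 2 / q) ^ 2 * q := by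
      conv_lhs => rw [hq]
      conv_rhs => rw [hq, Finset.mul_sum, ← hq]
      simp only [map_sum, map_mul, map_pow, hσy, AlgEquiv.commutes]
      exact Finset.sum_congr rfl fun i _ => by ring
    rw [this]
    field_simp
  refine nonempty_fractionRing_diagonalQuadric_algEquiv σ hd (L := (z / q) • M) (c := z ^ 2 / q)
    (div_ne_zero (pow_ne_zero 2 hz0) hq0) ?_ ?_
  · rw [Matrix.transpose_smul, Matrix.smul_mul, Matrix.smul_mul, Matrix.mul_smul, hM,
      smul_smul, smul_smul]
    congr 1
    field_simp
  · simp only [map_add, map_mul, map_pow, AlgEquiv.commutes, hσq, hσz]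
    field_simp
    ring

/-- The function field of `d ⊥ ⟨-b⟩d ⊥ ⟨-c⟩` as that of an affine quadric over `k(y, z)`. -/
theorem nonempty_fractionRing_quadric_algEquiv_rationalFunctions {k V : Type*} [Field k]
    [Fintype V] {d : V → k} {i : V} (hd : d i ≠ 0) (b c : k) :
    Nonempty (FractionRing (MvPolynomial (V ⊕ V ⊕ Unit) k ⧸
        Ideal.span {(∑ i, C (d i) * X (Sum.inl i) ^ 2)
          - C b * (∑ i, C (d i) * X (Sum.inr (Sum.inl i)) ^ 2)
          - C c * X (Sum.inr (Sum.inr ())) ^ 2}) ≃ₐ[k]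
      FractionRing (MvPolynomial V (FractionRing (MvPolynomial (V ⊕ Unit) k)) ⧸
        Ideal.span {diagonalQuadric
          (fun i => algebraMap k (FractionRing (MvPolynomial (V ⊕ Unit) k)) (d i))
          (algebraMap (MvPolynomial (V ⊕ Unit) k) _
            (C b * ∑ i, C (d i) * X (Sum.inl i) ^ 2 + C c * X (Sum.inr ()) ^ 2))})) := by
  obtain ⟨e₁⟩ := nonempty_fractionRing_quotient_algEquiv (sumAlgEquiv k V (V ⊕ Unit))
    (p := (∑ i, C (d i) * X (Sum.inl i) ^ 2)
          - C b * (∑ i, C (d i) * X (Sum.inr (Sum.inl i)) ^ 2)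
          - C c * X (Sum.inr (Sum.inr ())) ^ 2)
    (p' := diagonalQuadric (fun i => C (d i))
      (C b * ∑ i, C (d i) * X (Sum.inl i) ^ 2 + C c * X (Sum.inr ()) ^ 2)) isUnit_one (by
    have hC : ∀ x, sumAlgEquiv k V (V ⊕ Unit) (C x) = C (C x) :=
      fun x => (sumAlgEquiv k V (V ⊕ Unit)).commutes x
    have hl : ∀ x, sumAlgEquiv k V (V ⊕ Unit) (X (Sum.inl x)) = X x := fun x => by simp
    have hr : ∀ x, sumAlgEquiv k V (V ⊕ Unit) (X (Sum.inr x)) = C (X x) := fun x => by simp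
    rw [one_mul]
    simp only [diagonalQuadric, map_sub, map_add, map_mul, map_sum, map_pow, hC, hl, hr]
    ring)
  obtain ⟨e₂⟩ := nonempty_fractionRing_quadric_algEquiv k
    (d := fun i => (C (d i) : MvPolynomial (V ⊕ Unit) k))
    (C b * ∑ i, C (d i) * X (Sum.inl i) ^ 2 + C c * X (Sum.inr ()) ^ 2) (i := i)
    ((Ne.isUnit hd).map C)
  have hd' : (fun i => algebraMap (MvPolynomial (V ⊕ Unit) k)
      (FractionRing (MvPolynomial (V ⊕ Unit) k)) (C (d i))) = fun i => algebraMap k _ (d i) :=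
    funext fun i => (IsScalarTower.algebraMap_apply k (MvPolynomial (V ⊕ Unit) k) _ (d i)).symm
  rw [hd'] at e₂
  exact ⟨e₁.trans e₂⟩

/-- Interchanging `b` and `c` in `d ⊥ ⟨-b⟩d ⊥ ⟨-c⟩` when the generic value of `d` is the
multiplier of a similarity. -/
theorem birationallyEquivalent_interchange {k V : Type*} [Field k] [Fintype V] [DecidableEq V]
    [Nonempty V] {d : V → k} (hd : ∀ i, d i ≠ 0)
    (hm : IsMultiplicativeForm fun i =>
      algebraMap k (FractionRing (MvPolynomial (V ⊕ Unit) k)) (d i)) (b c : k) :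
    BirationallyEquivalent k
      ((∑ i, C (d i) * X (Sum.inl i) ^ 2)
          - C b * (∑ i, C (d i) * X (Sum.inr (Sum.inl i)) ^ 2)
          - C c * X (Sum.inr (Sum.inr ())) ^ 2 : MvPolynomial (V ⊕ V ⊕ Unit) k)
      ((∑ i, C (d i) * X (Sum.inl i) ^ 2)
          - C c * (∑ i, C (d i) * X (Sum.inr (Sum.inl i)) ^ 2)
          - C b * X (Sum.inr (Sum.inr ())) ^ 2 : MvPolynomial (V ⊕ V ⊕ Unit) k) := by
  let ι := algebraMap (MvPolynomial (V ⊕ Unit) k) (FractionRing (MvPolynomial (V ⊕ Unit) k))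
  obtain ⟨i₀⟩ := ‹Nonempty V›
  obtain ⟨e₁⟩ := nonempty_fractionRing_quadric_algEquiv_rationalFunctions (hd i₀) b c
  obtain ⟨e₂⟩ := nonempty_fractionRing_quadric_algEquiv_rationalFunctions (hd i₀) c b
  obtain ⟨q, hq⟩ : ∃ q : MvPolynomial (V ⊕ Unit) k, q = ∑ i, C (d i) * X (Sum.inl i) ^ 2 := ⟨_, rfl⟩
  have hq0 : q ≠ 0 := fun h => hd i₀ (by
    have := congrArg (eval (Sum.elim (Pi.single i₀ 1) 0)) (hq.symm.trans h)
    simpa [Pi.single_apply] using this)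
  have hιC : ∀ x, ι (C x) = algebraMap k _ x := fun x =>
    (IsScalarTower.algebraMap_apply k (MvPolynomial (V ⊕ Unit) k) _ x).symm
  obtain ⟨σ, hσy, hσz⟩ := exists_inversion_algEquiv d hq hq0
  obtain ⟨e⟩ := nonempty_fractionRing_diagonalQuadric_interchange hd hm σ
    (y := fun i => ι (X (Sum.inl i))) (z := ι (X (Sum.inr ()))) (q := ι q)
    (by simp only [hq, map_sum, map_mul, map_pow, hιC])
    (by simpa [ι] using hq0) (by simp [ι]) hσy hσz b c
  have hr : ∀ b c, algebraMap k _ b * ι q + algebraMap k _ c * ι (X (Sum.inr ())) ^ 2 =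
      ι (C b * ∑ i, C (d i) * X (Sum.inl i) ^ 2 + C c * X (Sum.inr ()) ^ 2) := fun b c => by
    rw [← hq, ← hιC, ← hιC, ← map_pow, ← map_mul, ← map_mul, ← map_add]
  rw [hr, hr] at e
  exact ⟨(e₁.trans e).trans e₂.symm⟩

/-- Let `k` be a field of characteristic 0, `n ≥ 1`,
`a₁,…,aₙ ∈ kˣ`, and let `φ = ⟪a₁,…,aₙ⟫` be the `n`-fold Pfister form on
`k^(2ⁿ)`; assume `φ` is anisotropic.  Let `b, c ∈ kˣ`.  Then the forms
`ψ₁ = φ ⊥ ⟨−b⟩φ ⊥ ⟨−c⟩ : (x,y,z) ↦ φ(x) − b·φ(y) − c·z²` and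
`ψ₂ = φ ⊥ ⟨−c⟩φ ⊥ ⟨−b⟩ : (x,y,z) ↦ φ(x) − c·φ(y) − b·z²` are birationally
equivalent. -/
theorem pfister_interchange_birational
    (k : Type*) [Field k] [CharZero k] (n : ℕ) (hn : 1 ≤ n)
    (a : Fin n → k) (ha : ∀ i, a i ≠ 0)
    (d : (Fin n → Bool) → k) (hd : ∀ ε, d ε = ∏ i : Fin n, if ε i then -a i else 1)
    (haniso : ∀ x : (Fin n → Bool) → k, ∑ ε : Fin n → Bool, d ε * x ε ^ 2 = 0 → x = 0)
    (b c : k) (hb : b ≠ 0) (hc : c ≠ 0)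
    (Ψ₁ Ψ₂ : MvPolynomial ((Fin n → Bool) ⊕ (Fin n → Bool) ⊕ Unit) k)
    (hΨ₁ : Ψ₁ = (∑ ε : Fin n → Bool, MvPolynomial.C (d ε) * X (Sum.inl ε) ^ 2)
        - MvPolynomial.C b *
            (∑ ε : Fin n → Bool, MvPolynomial.C (d ε) * X (Sum.inr (Sum.inl ε)) ^ 2)
        - MvPolynomial.C c * X (Sum.inr (Sum.inr ())) ^ 2)
    (hΨ₂ : Ψ₂ = (∑ ε : Fin n → Bool, MvPolynomial.C (d ε) * X (Sum.inl ε) ^ 2)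
        - MvPolynomial.C c *
            (∑ ε : Fin n → Bool, MvPolynomial.C (d ε) * X (Sum.inr (Sum.inl ε)) ^ 2)
        - MvPolynomial.C b * X (Sum.inr (Sum.inr ())) ^ 2) :
    BirationallyEquivalent k Ψ₁ Ψ₂ := by
  subst hΨ₁ hΨ₂
  refine birationallyEquivalent_interchange (fun ε => ?_) ?_ b c
  · rw [hd]
    exact Finset.prod_ne_zero_iff.2 fun i _ => by split_ifs <;> simp [ha]
  · convert isMultiplicativeForm_pfister n (fun i => algebraMap k (FractionRing
      (MvPolynomial ((Fin n → Bool) ⊕ Unit) k)) (a i)) (fun i => by simpa using ha i) using 2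
      with ε
    rw [hd, map_prod]
    exact Finset.prod_congr rfl fun i _ => by split_ifs <;> simp
end

section
/- Let k be a field of characteristic 0, n ≥ 1, a₁,…,aₙ ∈ kˣ, and let φ = ⟨⟨a₁,…,aₙ⟩⟩ be the n-fold Pfister form on k^(2ⁿ); assume φ is anisotropic. Let b ∈ kˣ and let x₀ ∈ k^(2ⁿ) be a vector with φ(x₀) ≠ 0. Then the quadratic forms ψ₁ = φ ⊥ ⟨−b⟩, given by (x, z) ↦ φ(x) − b·z² on k^(2ⁿ) × k, and ψ₂ = φ ⊥ ⟨−b·φ(x₀)⟩, given by (x, z) ↦ φ(x) − b·φ(x₀)·z², are birationally equivalent. -/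
open MvPolynomial

/-- A quadratic form is round if each of its nonzero values is the multiplier of some linear
self-similarity. -/
def QuadraticMap.IsRound {k E : Type*} [Field k] [AddCommGroup E] [Module k E]
    (Q : QuadraticForm k E) : Prop :=
  ∀ u, Q u ≠ 0 → ∃ U : E ≃ₗ[k] E, ∀ x, Q (U x) = Q u * Q x

/-- A linear map which scales an anisotropic form by a nonzero factor is invertible. -/
theorem QuadraticMap.Anisotropic.exists_linearEquiv {k E : Type*} [Field k] [AddCommGroup E]
    [Module k E] [FiniteDimensional k E] {Q : QuadraticForm k E} (hQ : Q.Anisotropic)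
    (f : E →ₗ[k] E) {c : k} (hc : c ≠ 0) (hf : ∀ x, Q (f x) = c * Q x) :
    ∃ U : E ≃ₗ[k] E, ∀ x, Q (U x) = c * Q x := by
  have hinj : Function.Injective f := by
    rw [injective_iff_map_eq_zero]
    intro x hx
    have h := hf x
    rw [hx, QuadraticMap.map_zero] at h
    exact hQ x ((mul_eq_zero.mp h.symm).resolve_left hc)
  exact ⟨LinearEquiv.ofInjectiveEndo f hinj, hf⟩

/-- If `Q` is round and `R = Q ⊥ -a Q` is anisotropic, then `R` is round. -/
theorem QuadraticMap.IsRound.double {k E F : Type*} [Field k] [AddCommGroup E]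
    [Module k E] [AddCommGroup F] [Module k F] [FiniteDimensional k F]
    {Q : QuadraticForm k E} (hQ : Q.IsRound) (a : k) {R : QuadraticForm k F}
    (e : F ≃ₗ[k] E × E) (he : ∀ z, R z = Q (e z).1 - a * Q (e z).2) (hR : R.Anisotropic) :
    R.IsRound := by
  have hani : Q.Anisotropic := by
    intro x hx
    have h := hR (e.symm (x, 0)) (by rw [he]; simp [hx])
    simpa using congrArg e h
  have he' : ∀ x y, R (e.symm (x, y)) = Q x - a * Q y := fun x y ↦ by simp [he]
  intro w hw
  obtain ⟨u, v, rfl⟩ : ∃ u v, w = e.symm (u, v) := ⟨(e w).1, (e w).2, by simp⟩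
  suffices h : ∃ f : E × E →ₗ[k] E × E, ∀ x y,
      Q (f (x, y)).1 - a * Q (f (x, y)).2 = (Q u - a * Q v) * (Q x - a * Q y) by
    obtain ⟨f, hf⟩ := h
    refine hR.exists_linearEquiv (e.symm.toLinearMap ∘ₗ f ∘ₗ e.toLinearMap) hw fun z ↦ ?_
    have h := hf (e z).1 (e z).2
    simpa [he] using h
  by_cases hv : Q v = 0
  · have hu : Q u ≠ 0 := by
      intro hu
      exact hw (by rw [he', hu, hv]; simp)
    obtain ⟨U, hU⟩ := hQ u hu
    refine ⟨U.toLinearMap.prodMap U.toLinearMap, fun x y ↦ ?_⟩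
    simp only [LinearMap.prodMap_apply, LinearEquiv.coe_coe, hU, hv]
    ring
  obtain ⟨V, hV⟩ := hQ v hv
  by_cases hu : Q u = 0
  · refine ⟨LinearMap.prod (a • V.toLinearMap ∘ₗ LinearMap.snd k E E)
      (V.toLinearMap ∘ₗ LinearMap.fst k E E), fun x y ↦ ?_⟩
    simp only [LinearMap.prod_apply, Function.prod, LinearMap.smul_apply, LinearMap.comp_apply,
      LinearMap.fst_apply, LinearMap.snd_apply, LinearEquiv.coe_coe, QuadraticMap.map_smul, hV,
      hu, smul_eq_mul]
    ring
  obtain ⟨U, hU⟩ := hQ u hu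
  have polar_scale : ∀ (T : E ≃ₗ[k] E) (c : k), (∀ x, Q (T x) = c * Q x) →
      ∀ x y, QuadraticMap.polar Q (T x) (T y) = c * QuadraticMap.polar Q x y := by
    intro T c hT x y
    simp only [QuadraticMap.polar, ← _root_.map_add, hT]
    ring
  have hUs : ∀ y, Q u * Q (U.symm y) = Q y := fun y ↦ by rw [← hU]; simp
  refine ⟨LinearMap.prod
    (U.toLinearMap ∘ₗ LinearMap.fst k E E + a • V.toLinearMap ∘ₗ LinearMap.snd k E E)
    (V.toLinearMap ∘ₗ LinearMap.fst k E E + (Q u / Q v) •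
      V.toLinearMap ∘ₗ U.symm.toLinearMap ∘ₗ V.toLinearMap ∘ₗ LinearMap.snd k E E),
    fun x y ↦ ?_⟩
  simp only [LinearMap.prod_apply, Function.prod, LinearMap.smul_apply, LinearMap.comp_apply,
    LinearMap.add_apply, LinearMap.fst_apply, LinearMap.snd_apply, LinearEquiv.coe_coe]
  have h1 := polar_scale V _ hV x (U.symm (V y))
  have h2 := polar_scale U _ hU x (U.symm (V y))
  have h3 := hUs (V y)
  rw [LinearEquiv.apply_symm_apply] at h2
  rw [QuadraticMap.map_add Q (U x), QuadraticMap.map_add Q (V x)]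
  simp only [QuadraticMap.map_smul, QuadraticMap.polar_smul_right, smul_eq_mul, h1, h2, hU, hV]
  rw [hV] at h3
  field_simp
  linear_combination (-a * Q u) * h3

/-- Anisotropic Pfister forms are round. -/
theorem isRound_weightedSumSquares_pfister {k : Type*} [Field k] (n : ℕ) (a : Fin n → k)
    (hani : (QuadraticMap.weightedSumSquares k
      fun ε : Fin n → Bool ↦ ∏ i, if ε i then -a i else 1).Anisotropic) :
    (QuadraticMap.weightedSumSquares k
      fun ε : Fin n → Bool ↦ ∏ i, if ε i then -a i else 1).IsRound := by
  induction n with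
  | zero =>
    intro u hu
    refine hani.exists_linearEquiv (u finZeroElim • LinearMap.id) hu fun x ↦ ?_
    simp only [QuadraticMap.weightedSumSquares_apply, Fintype.sum_subsingleton _ finZeroElim,
      Finset.univ_eq_empty, Finset.prod_empty, LinearMap.smul_apply, LinearMap.id_apply, Pi.smul_apply,
      smul_eq_mul, one_mul]
    ring
  | succ n ih =>
    let e : ((Fin (n + 1) → Bool) → k) ≃ₗ[k] ((Fin n → Bool) → k) × ((Fin n → Bool) → k) :=
      { toFun := fun x ↦ (fun ε ↦ x (Fin.cons false ε), fun ε ↦ x (Fin.cons true ε))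
        invFun := fun p ε ↦ if ε 0 then p.2 (Fin.tail ε) else p.1 (Fin.tail ε)
        map_add' := fun _ _ ↦ rfl
        map_smul' := fun _ _ ↦ rfl
        left_inv := fun x ↦ by
          funext ε
          rcases h : ε 0 <;> simp [h] <;> rw [← h, Fin.cons_self_tail]
        right_inv := fun p ↦ by simp }
    have he : ∀ z, QuadraticMap.weightedSumSquares k
        (fun ε : Fin (n + 1) → Bool ↦ ∏ i, if ε i then -a i else 1) z =
        QuadraticMap.weightedSumSquares k
          (fun ε : Fin n → Bool ↦ ∏ i, if ε i then -a i.succ else 1) (e z).1 -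
        a 0 * QuadraticMap.weightedSumSquares k
          (fun ε : Fin n → Bool ↦ ∏ i, if ε i then -a i.succ else 1) (e z).2 := by
      intro z
      simp only [QuadraticMap.weightedSumSquares_apply]
      rw [← (Fin.consEquiv fun _ : Fin (n + 1) ↦ Bool).sum_comp, Fintype.sum_prod_type,
        Fintype.sum_bool, add_comm, sub_eq_add_neg, Finset.mul_sum, ← Finset.sum_neg_distrib]
      congr 1 <;> refine Finset.sum_congr rfl fun ε _ ↦ ?_ <;>
        simp [e, Fin.consEquiv, Fin.prod_univ_succ, mul_assoc]
    refine QuadraticMap.IsRound.double (ih (fun i ↦ a i.succ) ?_) (a 0) e he hani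
    intro x hx
    have h := hani (e.symm (x, 0)) (by
      rw [he, LinearEquiv.apply_symm_apply, hx, QuadraticMap.map_zero]
      simp)
    simpa using congrArg e h

/-- Polynomials that agree up to a nonzero scalar and a linear change of coordinates are
birationally equivalent. -/
theorem birationallyEquivalent_of_linearEquiv {k σ : Type*} [Field k] [Infinite k] [Fintype σ]
    {Ψ Ψ' : MvPolynomial σ k} (L : (σ → k) ≃ₗ[k] (σ → k)) {c : k} (hc : c ≠ 0)
    (hL : ∀ y, eval (L y) Ψ' = c * eval y Ψ) : BirationallyEquivalent k Ψ Ψ' := by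
  classical
  let θ (M : (σ → k) →ₗ[k] (σ → k)) : MvPolynomial σ k →ₐ[k] MvPolynomial σ k :=
    aeval fun i ↦ ∑ j, C (M (fun l ↦ if j = l then 1 else 0) i) * X j
  have hθ : ∀ M p y, eval y (θ M p) = eval (M y) p := by
    intro M p y
    have hM : M y = fun i ↦ ∑ j, M (fun l ↦ if j = l then 1 else 0) i * y j := by
      funext i
      conv_lhs => rw [LinearMap.pi_apply_eq_sum_univ M y]
      simp [mul_comm]
    induction p using MvPolynomial.induction_on with
    | C r => simp [θ]
    | add p q hp hq => simp [hp, hq]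
    | mul_X p i hp =>
      rw [map_mul, map_mul, hp, map_mul, eval_X, hM]
      simp [θ]
  let A : MvPolynomial σ k ≃ₐ[k] MvPolynomial σ k :=
    AlgEquiv.ofAlgHom (θ L.symm) (θ L)
      (AlgHom.ext fun p ↦ MvPolynomial.funext fun y ↦ by simp [hθ])
      (AlgHom.ext fun p ↦ MvPolynomial.funext fun y ↦ by simp [hθ])
  have hA : C c * A Ψ = Ψ' := MvPolynomial.funext fun y ↦ by
    have h := hL (L.symm y)
    rw [LinearEquiv.apply_symm_apply] at h
    simp [A, hθ, h]
  have hI : Ideal.span {Ψ'} = (Ideal.span {Ψ}).map A := by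
    rw [Ideal.map_span, Set.image_singleton, ← hA]
    exact Ideal.span_singleton_mul_left_unit (hc.isUnit.map C) _
  let B := Ideal.quotientEquivAlg _ _ A hI
  exact ⟨IsFractionRing.algEquivOfAlgEquiv B⟩

/-- Let `k` be a field of characteristic 0, `n ≥ 1`,
`a₁,…,aₙ ∈ kˣ`, and let `φ = ⟪a₁,…,aₙ⟫` be the `n`-fold Pfister form on
`k^(2ⁿ)`; assume `φ` is anisotropic.  Let `b ∈ kˣ` and `x₀ ∈ k^(2ⁿ)` with
`φ(x₀) ≠ 0`.  Then the forms `ψ₁ = φ ⊥ ⟨−b⟩ : (x,z) ↦ φ(x) − b·z²` and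
`ψ₂ = φ ⊥ ⟨−b·φ(x₀)⟩ : (x,z) ↦ φ(x) − b·φ(x₀)·z²` are birationally
equivalent. -/
theorem pfister_scaling_birational
    (k : Type*) [Field k] [CharZero k] (n : ℕ) (hn : 1 ≤ n)
    (a : Fin n → k) (ha : ∀ i, a i ≠ 0)
    (d : (Fin n → Bool) → k) (hd : ∀ ε, d ε = ∏ i : Fin n, if ε i then -a i else 1)
    (haniso : ∀ x : (Fin n → Bool) → k, ∑ ε : Fin n → Bool, d ε * x ε ^ 2 = 0 → x = 0)
    (b : k) (hb : b ≠ 0)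
    (x₀ : (Fin n → Bool) → k) (hx₀ : ∑ ε : Fin n → Bool, d ε * x₀ ε ^ 2 ≠ 0)
    (Ψ₁ Ψ₂ : MvPolynomial ((Fin n → Bool) ⊕ Unit) k)
    (hΨ₁ : Ψ₁ = (∑ ε : Fin n → Bool, MvPolynomial.C (d ε) * X (Sum.inl ε) ^ 2)
        - MvPolynomial.C b * X (Sum.inr ()) ^ 2)
    (hΨ₂ : Ψ₂ = (∑ ε : Fin n → Bool, MvPolynomial.C (d ε) * X (Sum.inl ε) ^ 2)
        - MvPolynomial.C (b * ∑ ε : Fin n → Bool, d ε * x₀ ε ^ 2) * X (Sum.inr ()) ^ 2) :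
    BirationallyEquivalent k Ψ₁ Ψ₂ := by
  have hfun : d = fun ε ↦ ∏ i : Fin n, if ε i then -a i else 1 := _root_.funext hd
  set Q : QuadraticForm k ((Fin n → Bool) → k) := QuadraticMap.weightedSumSquares k d with hQ
  have hQa : ∀ x, Q x = ∑ ε : Fin n → Bool, d ε * x ε ^ 2 := fun x ↦ by
    simp [hQ, QuadraticMap.weightedSumSquares_apply, sq]
  have hani : Q.Anisotropic := fun x hx ↦ haniso x ((hQa x).symm.trans hx)
  have hround : Q.IsRound := by
    rw [hQ, hfun] at hani ⊢
    exact isRound_weightedSumSquares_pfister n a hani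
  rw [← hQa] at hx₀ hΨ₂
  obtain ⟨U, hU⟩ := hround x₀ hx₀
  let s := LinearEquiv.sumArrowLequivProdArrow (Fin n → Bool) Unit k k
  refine birationallyEquivalent_of_linearEquiv
    (s ≪≫ₗ (U.prodCongr (LinearEquiv.refl k (Unit → k))) ≪≫ₗ s.symm) hx₀ fun y ↦ ?_
  have h := hU fun ε ↦ y (Sum.inl ε)
  rw [hQa, hQa (fun ε ↦ y (Sum.inl ε))] at h
  subst hΨ₁ hΨ₂
  simp only [map_sub, map_sum, map_mul, map_pow, eval_C, eval_X]
  change ∑ ε, d ε * U (fun ε ↦ y (Sum.inl ε)) ε ^ 2 - b * Q x₀ * y (Sum.inr ()) ^ 2 = _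
  rw [h]
  ring
end

section
/- Let k be a field of characteristic 0, n ≥ 2, and a₁,…,aₙ, b₁,…,bₙ ∈ kˣ. Suppose the n-fold Pfister forms φ = ⟨⟨a₁,…,aₙ⟩⟩ and φ' = ⟨⟨b₁,…,bₙ⟩⟩ are equivalent, i.e. isometric as quadratic forms over k. Then the associated subforms ψ = ⟨⟨a₁,…,a_{n−1}⟩⟩ ⊥ ⟨−aₙ⟩ and ψ' = ⟨⟨b₁,…,b_{n−1}⟩⟩ ⊥ ⟨−bₙ⟩, which are quadratic forms in 2^{n−1} + 1 variables given by (x, z) ↦ ⟨⟨a₁,…,a_{n−1}⟩⟩(x) − aₙ·z² and (x, z) ↦ ⟨⟨b₁,…,b_{n−1}⟩⟩(x) − bₙ·z² respectively, are birationally equivalent. -/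
open MvPolynomial

namespace DiagonalForm

open Finset Matrix

section Families

variable {F : Type*}

lemma exists_family (m : Multiset F) : ∃ (n : ℕ) (d : Fin n → F), univ.val.map d = m := by
  induction m using Quotient.inductionOn with
  | h l => exact ⟨l.length, l.get, by simp [Fin.univ_val_map]⟩

lemma exists_equiv_of_map_univ_eq {ι ι' : Type*} [Fintype ι] [Fintype ι'] {d : ι → F}
    {d' : ι' → F} (h : univ.val.map d = univ.val.map d') : ∃ e : ι ≃ ι', d' ∘ e = d := by
  classical
  have key : ∀ v, Nonempty ({i // d i = v} ≃ {i // d' i = v}) := fun v => by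
    rw [← Fintype.card_eq, Fintype.card_subtype, Fintype.card_subtype]
    have h2 := congrArg (Multiset.count v) h
    rw [Multiset.count_map, Multiset.count_map] at h2
    simpa only [Finset.card_def, Finset.filter_val, eq_comm (a := v)] using h2
  let E : ι ≃ ι' := (Equiv.sigmaFiberEquiv d).symm.trans
    ((Equiv.sigmaCongrRight fun v => (key v).some).trans (Equiv.sigmaFiberEquiv d'))
  exact ⟨E, funext fun i => ((key (d i)).some ⟨i, rfl⟩).2⟩

lemma map_univ_sumElim {ι ι' : Type*} [Fintype ι] [Fintype ι'] (d : ι → F) (d' : ι' → F) :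
    univ.val.map (Sum.elim d d') = univ.val.map d + univ.val.map d' := by
  rw [← Finset.univ_disjSum_univ, Finset.val_disjSum, Multiset.disjSum, Multiset.map_add,
    Multiset.map_map, Multiset.map_map]
  rfl

lemma map_univ_optionElim {ι : Type*} [Fintype ι] (c : F) (d : ι → F) :
    univ.val.map (fun i : Option ι => i.elim c d) = c ::ₘ univ.val.map d := by
  have h : (univ : Finset (Option ι)) = Finset.insertNone univ := by ext; simp
  rw [h, Finset.insertNone]
  simp [Multiset.map_map, Function.comp_def]

end Families

section Pfister

variable {F : Type*} [CommRing F]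

/-- The multiset of diagonal entries of the Pfister form with the given slots. -/
def pfister (s : Multiset F) : Multiset F :=
  s.powerset.map fun t => (t.map Neg.neg).prod

lemma pfister_zero : pfister (0 : Multiset F) = {1} := by
  simp [pfister]

lemma pfister_cons (a : F) (s : Multiset F) :
    pfister (a ::ₘ s) = pfister s + (pfister s).map (-a * ·) := by
  simp only [pfister, Multiset.powerset_cons, Multiset.map_map, Multiset.map_add]
  congr 1
  exact Multiset.map_congr rfl fun t _ => by simp [-Multiset.prod_map_neg]

lemma pfister_map {L : Type*} [CommRing L] (f : F →+* L) (s : Multiset F) :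
    pfister (s.map f) = (pfister s).map f := by
  induction s using Multiset.induction_on with
  | empty => simp [pfister_zero]
  | cons a s ih => simp [pfister_cons, ih, Multiset.map_map]

lemma one_mem_pfister (s : Multiset F) : (1 : F) ∈ pfister s :=
  Multiset.mem_map.mpr ⟨0, by simp, by simp⟩

lemma pfister_add_eq (s t : Multiset F) : ∃ m, pfister (s + t) = pfister s + m := by
  induction t using Multiset.induction_on with
  | empty => exact ⟨0, by simp⟩
  | cons a t ih =>
    obtain ⟨m, hm⟩ := ih
    exact ⟨m + (pfister (s + t)).map (-a * ·), by
      rw [Multiset.add_cons, pfister_cons, hm, add_assoc]⟩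

lemma card_pfister (s : Multiset F) : (pfister s).card = 2 ^ s.card := by
  simp [pfister]

lemma zero_notMem_pfister [IsDomain F] {s : Multiset F} (hs : (0 : F) ∉ s) :
    (0 : F) ∉ pfister s := by
  induction s using Multiset.induction_on with
  | empty => simp [pfister_zero]
  | cons a s ih =>
    simp only [Multiset.mem_cons, not_or] at hs
    simp [pfister_cons, ih hs.2, Ne.symm hs.1]

end Pfister

section Values

variable {F : Type*} [CommRing F]

/-- The value `v` is represented by the diagonal form with entries `m`. -/
def Represents (m : Multiset F) (v : F) : Prop :=
  ∃ (n : ℕ) (d x : Fin n → F), univ.val.map d = m ∧ ∑ i, d i * x i ^ 2 = v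

lemma represents_of_family {ι : Type*} [Fintype ι] (d x : ι → F) :
    Represents (univ.val.map d) (∑ i, d i * x i ^ 2) := by
  obtain ⟨n, d', hd'⟩ := exists_family (univ.val.map d)
  obtain ⟨e, he⟩ := exists_equiv_of_map_univ_eq hd'
  refine ⟨n, d', x ∘ e, hd', ?_⟩
  rw [← e.sum_comp, ← he]
  rfl

lemma Represents.exists_vector {m : Multiset F} {v : F} (h : Represents m v) {ι : Type*}
    [Fintype ι] {d : ι → F} (hd : univ.val.map d = m) : ∃ x : ι → F, ∑ i, d i * x i ^ 2 = v := by
  obtain ⟨n, d', x, rfl, rfl⟩ := h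
  obtain ⟨e, he⟩ := exists_equiv_of_map_univ_eq hd
  refine ⟨x ∘ e, ?_⟩
  rw [← e.sum_comp, ← he]
  rfl

lemma represents_zero {v : F} (h : Represents 0 v) : v = 0 := by
  obtain ⟨x, rfl⟩ := h.exists_vector (d := (Empty.elim : Empty → F)) (by simp)
  simp

lemma represents_add {m m' : Multiset F} {v : F} :
    Represents (m + m') v ↔ ∃ w w', Represents m w ∧ Represents m' w' ∧ w + w' = v := by
  obtain ⟨n, d, rfl⟩ := exists_family m
  obtain ⟨n', d', rfl⟩ := exists_family m'
  constructor
  · intro h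
    obtain ⟨x, rfl⟩ := h.exists_vector (map_univ_sumElim d d')
    exact ⟨_, _, represents_of_family d (x ∘ Sum.inl), represents_of_family d' (x ∘ Sum.inr),
      by simp⟩
  · rintro ⟨w, w', h, h', rfl⟩
    obtain ⟨x, rfl⟩ := h.exists_vector rfl
    obtain ⟨x', rfl⟩ := h'.exists_vector rfl
    rw [← map_univ_sumElim]
    convert represents_of_family (Sum.elim d d') (Sum.elim x x')
    simp

lemma represents_map_mul {m : Multiset F} {c v : F} :
    Represents (m.map (c * ·)) v ↔ ∃ w, Represents m w ∧ c * w = v := by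
  obtain ⟨n, d, rfl⟩ := exists_family m
  rw [Multiset.map_map]
  constructor
  · intro h
    obtain ⟨x, rfl⟩ := h.exists_vector rfl
    exact ⟨_, represents_of_family d x, by simp [mul_sum, mul_assoc]⟩
  · rintro ⟨w, h, rfl⟩
    obtain ⟨x, rfl⟩ := h.exists_vector rfl
    convert represents_of_family ((c * ·) ∘ d) x
    simp [mul_sum, mul_assoc]

lemma represents_zero_right (m : Multiset F) : Represents m 0 := by
  obtain ⟨n, d, rfl⟩ := exists_family m
  simpa using represents_of_family d 0

lemma represents_of_mem_mul_sq {m : Multiset F} {c : F} (hc : c ∈ m) (x : F) :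
    Represents m (c * x ^ 2) := by
  obtain ⟨m, rfl⟩ := Multiset.exists_cons_of_mem hc
  rw [← Multiset.singleton_add, represents_add]
  refine ⟨c * x ^ 2, 0, ?_, represents_zero_right m, add_zero _⟩
  simpa using represents_of_family (fun _ : Unit => c) (fun _ => x)

lemma Represents.add_right {m : Multiset F} {v : F} (h : Represents m v) (m' : Multiset F) :
    Represents (m + m') v :=
  represents_add.mpr ⟨v, 0, h, represents_zero_right m', add_zero v⟩

end Values

section Subform

variable {F : Type*} [Field F]

/-- There is a linear map pulling back the diagonal form `m'` to the diagonal form `m`. -/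
def Subform (m m' : Multiset F) : Prop :=
  ∃ (n n' : ℕ) (d : Fin n → F) (d' : Fin n' → F) (g : Matrix (Fin n') (Fin n) F),
    univ.val.map d = m ∧ univ.val.map d' = m' ∧ gᵀ * diagonal d' * g = diagonal d

lemma exists_matrix_reindex {ι ι' κ κ' : Type*} [Fintype ι'] [Fintype κ'] [DecidableEq ι]
    [DecidableEq ι'] [DecidableEq κ] [DecidableEq κ'] {d : ι → F} {d' : ι' → F}
    {g : Matrix ι' ι F} (hg : gᵀ * diagonal d' * g = diagonal d) (e : κ ≃ ι) (e' : κ' ≃ ι') :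
    (g.submatrix e' e)ᵀ * diagonal (d' ∘ e') * g.submatrix e' e = diagonal (d ∘ e) := by
  rw [← Matrix.submatrix_diagonal_equiv, ← Matrix.submatrix_diagonal_equiv, ← hg,
    Matrix.transpose_submatrix, Matrix.submatrix_mul_equiv, Matrix.submatrix_mul_equiv]

lemma subform_of_matrix {ι ι' : Type*} [Fintype ι] [Fintype ι'] [DecidableEq ι] [DecidableEq ι']
    {d : ι → F} {d' : ι' → F} {g : Matrix ι' ι F} (hg : gᵀ * diagonal d' * g = diagonal d) :
    Subform (univ.val.map d) (univ.val.map d') := by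
  obtain ⟨n, c, hc⟩ := exists_family (univ.val.map d)
  obtain ⟨n', c', hc'⟩ := exists_family (univ.val.map d')
  obtain ⟨e, rfl⟩ := exists_equiv_of_map_univ_eq hc
  obtain ⟨e', rfl⟩ := exists_equiv_of_map_univ_eq hc'
  exact ⟨n, n', _, _, _, hc, hc', exists_matrix_reindex hg e e'⟩

lemma Subform.exists_matrix {m m' : Multiset F} (h : Subform m m') {ι ι' : Type*} [Fintype ι]
    [Fintype ι'] [DecidableEq ι] [DecidableEq ι'] {d : ι → F} {d' : ι' → F}
    (hd : univ.val.map d = m) (hd' : univ.val.map d' = m') :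
    ∃ g : Matrix ι' ι F, gᵀ * diagonal d' * g = diagonal d := by
  obtain ⟨n, n', c, c', g, rfl, rfl, hg⟩ := h
  obtain ⟨e, rfl⟩ := exists_equiv_of_map_univ_eq hd
  obtain ⟨e', rfl⟩ := exists_equiv_of_map_univ_eq hd'
  exact ⟨_, exists_matrix_reindex hg e e'⟩

lemma Subform.refl (m : Multiset F) : Subform m m := by
  obtain ⟨n, d, rfl⟩ := exists_family m
  exact subform_of_matrix (g := 1) (by simp)

lemma Subform.trans {m m' m'' : Multiset F} (h : Subform m m') (h' : Subform m' m'') :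
    Subform m m'' := by
  obtain ⟨n, d, rfl⟩ := exists_family m
  obtain ⟨n', d', rfl⟩ := exists_family m'
  obtain ⟨n'', d'', rfl⟩ := exists_family m''
  obtain ⟨g, hg⟩ := h.exists_matrix rfl rfl
  obtain ⟨g', hg'⟩ := h'.exists_matrix rfl rfl
  refine subform_of_matrix (g := g' * g) ?_
  rw [← hg, ← hg', transpose_mul]
  simp only [Matrix.mul_assoc]

lemma Subform.add {m m' n n' : Multiset F} (h : Subform m m') (h' : Subform n n') :
    Subform (m + n) (m' + n') := by
  obtain ⟨_, d, rfl⟩ := exists_family m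
  obtain ⟨_, d', rfl⟩ := exists_family m'
  obtain ⟨_, c, rfl⟩ := exists_family n
  obtain ⟨_, c', rfl⟩ := exists_family n'
  obtain ⟨g, hg⟩ := h.exists_matrix rfl rfl
  obtain ⟨g', hg'⟩ := h'.exists_matrix rfl rfl
  rw [← map_univ_sumElim, ← map_univ_sumElim]
  refine subform_of_matrix (g := fromBlocks g 0 0 g') ?_
  rw [← fromBlocks_diagonal, ← fromBlocks_diagonal, fromBlocks_transpose, fromBlocks_multiply,
    fromBlocks_multiply]
  simp [hg, hg']

lemma Subform.map_mul {m m' : Multiset F} (h : Subform m m') (c : F) :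
    Subform (m.map (c * ·)) (m'.map (c * ·)) := by
  obtain ⟨n, d, rfl⟩ := exists_family m
  obtain ⟨n', d', rfl⟩ := exists_family m'
  obtain ⟨g, hg⟩ := h.exists_matrix rfl rfl
  rw [Multiset.map_map, Multiset.map_map]
  refine subform_of_matrix (g := g) ?_
  change gᵀ * diagonal (c • d') * g = diagonal (c • d)
  rw [diagonal_smul, diagonal_smul, ← hg]
  simp

lemma sum_mul_sq_eq_dotProduct {ι : Type*} [Fintype ι] [DecidableEq ι] (d x : ι → F) :
    ∑ i, d i * x i ^ 2 = x ⬝ᵥ (diagonal d *ᵥ x) := by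
  simp only [dotProduct, mulVec_diagonal]
  exact sum_congr rfl fun i _ => by ring

lemma sum_mulVec_sq {ι ι' : Type*} [Fintype ι] [Fintype ι'] [DecidableEq ι] [DecidableEq ι']
    {d : ι → F} {d' : ι' → F} {g : Matrix ι' ι F} (hg : gᵀ * diagonal d' * g = diagonal d)
    (x : ι → F) : ∑ i, d' i * (g *ᵥ x) i ^ 2 = ∑ i, d i * x i ^ 2 := by
  rw [sum_mul_sq_eq_dotProduct, sum_mul_sq_eq_dotProduct, ← hg, dotProduct_comm,
    dotProduct_mulVec, ← mulVec_transpose, dotProduct_comm, mulVec_mulVec, mulVec_mulVec]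

lemma Represents.mono {m m' : Multiset F} {v : F} (hv : Represents m v) (h : Subform m m') :
    Represents m' v := by
  obtain ⟨n, d, rfl⟩ := exists_family m
  obtain ⟨n', d', rfl⟩ := exists_family m'
  obtain ⟨g, hg⟩ := h.exists_matrix rfl rfl
  obtain ⟨x, rfl⟩ := hv.exists_vector rfl
  rw [← sum_mulVec_sq hg]
  exact represents_of_family _ _

end Subform

section Cancellation

variable {F : Type*} [Field F]

lemma transpose_mul_diagonal_mul_eq_iff {ι ι' : Type*} [Fintype ι'] [DecidableEq ι]
    [DecidableEq ι'] {d : ι → F} {d' : ι' → F} {g : Matrix ι' ι F} :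
    gᵀ * diagonal d' * g = diagonal d ↔
      ∀ p q, ∑ i, d' i * g i p * g i q = if p = q then d p else 0 := by
  rw [← Matrix.ext_iff]
  refine forall₂_congr fun p q => ?_
  rw [Matrix.mul_apply, diagonal_apply]
  simp only [mul_diagonal, transpose_apply, mul_comm (g _ p)]

/-- **Witt cancellation** of a one-dimensional form. -/
lemma Subform.of_cons [NeZero (2 : F)] {c : F} {m m' : Multiset F}
    (h : Subform (c ::ₘ m) (c ::ₘ m')) : Subform m m' := by
  obtain ⟨n, d, rfl⟩ := exists_family m
  obtain ⟨n', d', rfl⟩ := exists_family m'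
  obtain ⟨g, hg⟩ := h.exists_matrix (map_univ_optionElim c d) (map_univ_optionElim c d')
  rw [transpose_mul_diagonal_mul_eq_iff] at hg
  have key : ∃ t : F, t ≠ 0 ∧ (t + g none none = 1 ∨ t + g none none = -1) := by
    by_cases h1 : 1 - g none none = 0
    · refine ⟨-1 - g none none, fun h2 => two_ne_zero (α := F) ?_, Or.inr (by ring)⟩
      linear_combination h1 - h2
    · exact ⟨_, h1, Or.inl (by ring)⟩
  obtain ⟨t, ht, ht1⟩ := key
  have ht2 : (t + g none none) ^ 2 = 1 := by rcases ht1 with h | h <;> simp [h]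
  have h00 := hg none none
  have h0 : ∀ j, _ := fun j => hg none (some j)
  have hjl : ∀ j l, _ := fun j l => hg (some j) (some l)
  simp only [Fintype.sum_option, Option.elim_none, Option.elim_some, if_true, reduceCtorEq,
    if_false, Option.some.injEq] at h00 h0 hjl
  refine subform_of_matrix (g := Matrix.of fun i j =>
    g (some i) (some j) + g none (some j) / t * g (some i) none) ?_
  rw [transpose_mul_diagonal_mul_eq_iff]
  intro j l
  have expand : ∑ i, d' i * (g (some i) (some j) + g none (some j) / t * g (some i) none) *
        (g (some i) (some l) + g none (some l) / t * g (some i) none) =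
      ∑ i, d' i * g (some i) (some j) * g (some i) (some l) +
      g none (some l) / t * ∑ i, d' i * g (some i) none * g (some i) (some j) +
      g none (some j) / t * ∑ i, d' i * g (some i) none * g (some i) (some l) +
      g none (some j) / t * (g none (some l) / t) *
        ∑ i, d' i * g (some i) none * g (some i) none := by
    simp only [mul_sum, ← sum_add_distrib]
    exact sum_congr rfl fun i _ => by ring
  simp only [of_apply]
  rw [expand, ← hjl j l, eq_sub_of_add_eq' (h0 j), eq_sub_of_add_eq' (h0 l),
    eq_sub_of_add_eq' h00]
  field_simp
  linear_combination (c * g none (some j) * g none (some l)) * (-ht2)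

lemma Subform.of_add_left [NeZero (2 : F)] {n m m' : Multiset F}
    (h : Subform (n + m) (n + m')) : Subform m m' := by
  induction n using Multiset.induction_on with
  | empty => simpa using h
  | cons c n ih =>
    rw [Multiset.cons_add, Multiset.cons_add] at h
    exact ih h.of_cons

end Cancellation

section Multiplicativity

variable {F : Type*} [Field F]

lemma map_mul_map_mul (m : Multiset F) (a b : F) :
    (m.map (a * ·)).map (b * ·) = m.map (b * a * ·) := by
  simp [Multiset.map_map, mul_assoc]

lemma subform_map_sq_mul (m : Multiset F) (c : F) : Subform (m.map (c ^ 2 * ·)) m := by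
  obtain ⟨n, d, rfl⟩ := exists_family m
  rw [Multiset.map_map]
  refine subform_of_matrix (g := diagonal fun _ => c) ?_
  rw [diagonal_transpose, diagonal_mul_diagonal, diagonal_mul_diagonal]
  congr 1
  ext i
  simp only [Function.comp]
  ring

lemma subform_map_sq_mul' (m : Multiset F) {c : F} (hc : c ≠ 0) :
    Subform m (m.map (c ^ 2 * ·)) := by
  have h := subform_map_sq_mul (m.map (c ^ 2 * ·)) c⁻¹
  rw [map_mul_map_mul, ← mul_pow, inv_mul_cancel₀ hc] at h
  simpa using h

lemma Subform.symm_map_mul {m : Multiset F} {c : F} (hc : c ≠ 0) (h : Subform (m.map (c * ·)) m) :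
    Subform m (m.map (c * ·)) := by
  have h1 := h.map_mul c
  rw [map_mul_map_mul, ← pow_two] at h1
  exact (subform_map_sq_mul' m hc).trans h1

lemma subform_map_add_mul (m : Multiset F) (a b : F) :
    Subform (m.map ((a + b) * ·) + m.map ((a + b) * (a * b) * ·))
      (m.map (a * ·) + m.map (b * ·)) := by
  obtain ⟨n, d, rfl⟩ := exists_family m
  simp only [Multiset.map_map]
  rw [← map_univ_sumElim, ← map_univ_sumElim]
  refine subform_of_matrix (g := fromBlocks (diagonal fun _ => 1) (diagonal fun _ => -b)
    (diagonal fun _ => 1) (diagonal fun _ => a)) ?_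
  rw [← fromBlocks_diagonal, ← fromBlocks_diagonal, fromBlocks_transpose, fromBlocks_multiply,
    fromBlocks_multiply]
  simp only [diagonal_transpose, diagonal_mul_diagonal, Matrix.mul_zero, add_zero,
    zero_add, diagonal_add]
  congr 1
  · congr 1; ext i; simp only [Function.comp]; ring
  · rw [← diagonal_zero]; congr 1; ext i; simp only [Function.comp]; ring
  · rw [← diagonal_zero]; congr 1; ext i; simp only [Function.comp]; ring
  · congr 1; ext i; simp only [Function.comp]; ring

/-- Pfister forms are multiplicative: nonzero represented values are similarity factors. -/
lemma Represents.subform_pfister {s : Multiset F} {v : F} (h : Represents (pfister s) v)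
    (hv : v ≠ 0) : Subform ((pfister s).map (v * ·)) (pfister s) := by
  induction s using Multiset.induction_on generalizing v with
  | empty =>
    obtain ⟨x, rfl⟩ := h.exists_vector (d := fun _ : Unit => (1 : F)) (by simp [pfister_zero])
    simpa using subform_map_sq_mul (pfister 0) (x ())
  | cons a s ih =>
    rw [pfister_cons] at h ⊢
    obtain ⟨α, w, hα, hw, rfl⟩ := represents_add.mp h
    obtain ⟨β, hβ, rfl⟩ := represents_map_mul.mp hw
    rw [Multiset.map_add, map_mul_map_mul]
    by_cases hα0 : α = 0
    · subst hα0
      have hβ0 : β ≠ 0 := by rintro rfl; simp at hv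
      rw [zero_add, add_comm (pfister s)]
      refine Subform.add ?_ ?_
      · rw [← map_mul_map_mul]
        exact (ih hβ hβ0).map_mul _
      · have h1 := subform_map_sq_mul ((pfister s).map (β * ·)) a
        rw [map_mul_map_mul] at h1
        convert h1.trans (ih hβ hβ0) using 3
        ring
    by_cases hβ0 : β = 0
    · subst hβ0
      rw [mul_zero, add_zero]
      refine Subform.add (ih hα hα0) ?_
      rw [mul_comm α, ← map_mul_map_mul]
      exact (ih hα hα0).map_mul _
    have h1 := subform_map_add_mul (pfister s) α (-a * β)
    have h2 : Subform ((pfister s).map (α * β * ·)) (pfister s) := by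
      rw [← map_mul_map_mul]
      exact ((ih hβ hβ0).map_mul α).trans (ih hα hα0)
    have h3 := (h2.symm_map_mul (mul_ne_zero hα0 hβ0)).map_mul ((α + -a * β) * -a)
    rw [map_mul_map_mul] at h3
    have h4 : Subform ((pfister s).map (-a * β * ·)) ((pfister s).map (-a * ·)) := by
      rw [← map_mul_map_mul]
      exact (ih hβ hβ0).map_mul _
    have h5 : (α + -a * β) * -a * (α * β) = (α + -a * β) * (α * (-a * β)) := by ring
    rw [h5] at h3
    exact (((Subform.refl _).add h3).trans h1).trans ((ih hα hα0).add h4)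

end Multiplicativity

section Chain

variable {F : Type*} [Field F]

/-- The elementary move on slots of Pfister forms: multiply one slot by a nonzero value represented
by the Pfister form of the other slots. -/
def Step (m m' : Multiset F) : Prop :=
  ∃ s a v, m = a ::ₘ s ∧ m' = (a * v) ::ₘ s ∧ v ≠ 0 ∧ Represents (pfister s) v

lemma Represents.pfister_cons {s : Multiset F} {v : F} (h : Represents (pfister s) v) (c : F) :
    Represents (pfister (c ::ₘ s)) v := by
  rw [DiagonalForm.pfister_cons]
  exact h.add_right _

lemma Step.cons {m m' : Multiset F} (h : Step m m') (c : F) : Step (c ::ₘ m) (c ::ₘ m') := by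
  obtain ⟨s, a, v, rfl, rfl, hv, h⟩ := h
  exact ⟨c ::ₘ s, a, v, Multiset.cons_swap _ _ _, Multiset.cons_swap _ _ _, hv, h.pfister_cons c⟩

lemma Step.subform {m m' : Multiset F} (h : Step m m') : Subform (pfister m) (pfister m') := by
  obtain ⟨s, a, v, rfl, rfl, hv, h⟩ := h
  rw [pfister_cons, pfister_cons, ← neg_mul, ← map_mul_map_mul]
  exact (Subform.refl _).add (((h.subform_pfister hv).symm_map_mul hv).map_mul _)

lemma Step.card_eq {m m' : Multiset F} (h : Step m m') : m.card = m'.card := by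
  obtain ⟨s, a, v, rfl, rfl, hv, h⟩ := h
  simp

lemma Step.zero_notMem {m m' : Multiset F} (h : Step m m') (hm : (0 : F) ∉ m) : (0 : F) ∉ m' := by
  obtain ⟨s, a, v, rfl, rfl, hv, h⟩ := h
  simp only [Multiset.mem_cons, not_or] at hm ⊢
  exact ⟨(mul_ne_zero (Ne.symm hm.1) hv).symm, hm.2⟩

/-- Chain equivalence of slots of Pfister forms. -/
abbrev Chain : Multiset F → Multiset F → Prop := Relation.ReflTransGen Step

lemma Chain.cons {m m' : Multiset F} (h : Chain m m') (c : F) : Chain (c ::ₘ m) (c ::ₘ m') :=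
  h.lift _ fun _ _ h => h.cons c

lemma Chain.subform {m m' : Multiset F} (h : Chain m m') : Subform (pfister m) (pfister m') := by
  induction h with
  | refl => exact Subform.refl _
  | tail _ h ih => exact ih.trans h.subform

lemma Chain.card_eq {m m' : Multiset F} (h : Chain m m') : m.card = m'.card := by
  induction h with
  | refl => rfl
  | tail _ h ih => exact ih.trans h.card_eq

lemma chain_cons_mul {s : Multiset F} {v : F} (h : Represents (pfister s) v) (hv : v ≠ 0) (a : F) :
    Chain (a ::ₘ s) ((a * v) ::ₘ s) :=
  .single ⟨s, a, v, rfl, rfl, hv, h⟩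

lemma chain_cons_cons_add {s : Multiset F} {e c : F} (he : e ≠ 0) (hb : e + c ≠ 0) :
    Chain (c ::ₘ e ::ₘ s) ((e + c) ::ₘ (c * -e) ::ₘ s) := by
  have h1 : Represents (pfister (e ::ₘ s)) (-e) := by
    rw [pfister_cons]
    simpa using represents_of_mem_mul_sq (m := pfister s + (pfister s).map (-e * ·)) (c := -e)
      (Multiset.mem_add.mpr (.inr (Multiset.mem_map.mpr ⟨1, one_mem_pfister s, by simp⟩))) 1
  have h2 : Represents (pfister ((c * -e) ::ₘ s)) ((e + c) / e) := by
    rw [pfister_cons, represents_add]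
    refine ⟨1, c * e * e⁻¹ ^ 2, ?_, represents_of_mem_mul_sq ?_ _, by field_simp⟩
    · simpa using represents_of_mem_mul_sq (one_mem_pfister s) 1
    · exact Multiset.mem_map.mpr ⟨1, one_mem_pfister s, by simp⟩
  have h3 := chain_cons_mul h2 (div_ne_zero hb he) e
  rw [mul_div_cancel₀ _ he] at h3
  have h4 := chain_cons_mul h1 (neg_ne_zero.mpr he) c
  rw [Multiset.cons_swap (c * -e)] at h4
  exact h4.trans h3

/-- If the complement of `pfister t` in `pfister (t + s)` represents `-b`, then `b` can be made
a slot by elementary moves. -/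
lemma exists_chain_cons (t s : Multiset F) {m : Multiset F} {b : F}
    (hm : pfister (t + s) = pfister t + m) (hb : Represents m (-b)) (hb0 : b ≠ 0) :
    ∃ s', Chain (t + s) (b ::ₘ (t + s')) := by
  induction s using Multiset.induction_on generalizing m b with
  | empty =>
    rw [add_zero, left_eq_add] at hm
    subst hm
    exact absurd (neg_eq_zero.mp (represents_zero hb)) hb0
  | cons c s ih =>
    obtain ⟨m₁, hm₁⟩ := pfister_add_eq t s
    rw [Multiset.add_cons, pfister_cons, hm₁, add_assoc, add_right_inj, ← hm₁] at hm
    subst hm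
    obtain ⟨w, w', hw, hw', h⟩ := represents_add.mp hb
    obtain ⟨v, hv, rfl⟩ := represents_map_mul.mp hw'
    rw [Multiset.add_cons]
    by_cases hv0 : v = 0
    · subst hv0
      rw [mul_zero, add_zero] at h
      subst h
      obtain ⟨s', hs'⟩ := ih hm₁ hw hb0
      refine ⟨c ::ₘ s', ?_⟩
      rw [Multiset.add_cons, Multiset.cons_swap]
      exact hs'.cons c
    have h1 := chain_cons_mul hv hv0 c
    by_cases hw0 : w = 0
    · refine ⟨s, ?_⟩
      have : b = c * v := by linear_combination h - hw0
      rwa [this]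
    obtain ⟨s', hs'⟩ := ih (b := -w) hm₁ (by simpa using hw) (neg_ne_zero.mpr hw0)
    refine ⟨(c * v * - -w) ::ₘ s', ?_⟩
    have hbe : b = -w + c * v := by linear_combination h
    rw [Multiset.add_cons, hbe]
    exact (h1.trans (hs'.cons _)).trans (chain_cons_cons_add (neg_ne_zero.mpr hw0) (hbe ▸ hb0))

/-- Isometric Pfister forms are chain equivalent. -/
lemma chain_of_subform [NeZero (2 : F)] (t s s' : Multiset F) (hs' : (0 : F) ∉ s')
    (hc : s.card = s'.card) (h : Subform (pfister (t + s')) (pfister (t + s))) :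
    Chain (t + s) (t + s') := by
  induction s' using Multiset.induction_on generalizing t s with
  | empty =>
    obtain rfl : s = 0 := by simpa using hc
    exact .refl
  | cons b s' ih =>
    simp only [Multiset.mem_cons, not_or] at hs'
    obtain ⟨m, hm⟩ := pfister_add_eq t s
    obtain ⟨m', hm'⟩ := pfister_add_eq (b ::ₘ t) s'
    rw [pfister_cons, add_assoc] at hm'
    have h' := h
    rw [Multiset.add_cons, ← Multiset.cons_add, hm', hm] at h
    have hb : Represents m (-b) := by
      refine Represents.mono (Represents.add_right ?_ m') h.of_add_left
      simpa using represents_of_mem_mul_sq (m := (pfister t).map (-b * ·)) (c := -b)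
        (Multiset.mem_map.mpr ⟨1, one_mem_pfister t, by simp⟩) 1
    obtain ⟨r, hr⟩ := exists_chain_cons t s hm hb (Ne.symm hs'.1)
    have hcard := hr.card_eq
    simp only [Multiset.card_add, Multiset.card_cons] at hcard hc
    have h2 := ih (b ::ₘ t) r hs'.2 (by omega) (by
      rw [Multiset.cons_add, Multiset.cons_add, ← Multiset.add_cons]
      exact h'.trans hr.subform)
    rw [Multiset.cons_add, Multiset.cons_add] at h2
    rw [Multiset.add_cons]
    exact hr.trans h2

end Chain

section Generation

variable {k K : Type*} [Field k] [Field K] [Algebra k K]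

lemma isAlgebraic_of_adjoin_eq_top {S T : Set K} (hT : IntermediateField.adjoin k T = ⊤)
    (h : ∀ t ∈ T, IsAlgebraic (Algebra.adjoin k S) t) :
    Algebra.IsAlgebraic (Algebra.adjoin k S) K := by
  refine ⟨fun y => ?_⟩
  have hy : y ∈ IntermediateField.adjoin k T := hT ▸ IntermediateField.mem_top
  induction hy using IntermediateField.adjoin_induction with
  | mem t ht => exact h t ht
  | algebraMap c =>
    rw [IsScalarTower.algebraMap_apply k (Algebra.adjoin k S) K]
    exact isAlgebraic_algebraMap _
  | add _ _ _ _ h₁ h₂ => exact h₁.add h₂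
  | inv _ _ h₁ => exact h₁.inv
  | mul _ _ _ _ h₁ h₂ => exact h₁.mul h₂

lemma isAlgebraic_adjoin_of_mem {S : Set K} {y : K} (hy : y ∈ S) :
    IsAlgebraic (Algebra.adjoin k S) y :=
  isAlgebraic_algebraMap (⟨y, Algebra.subset_adjoin hy⟩ : Algebra.adjoin k S)

lemma isAlgebraic_adjoin_of_sum_eq {ι : Type*} [Fintype ι] [DecidableEq ι] {d : ι → k}
    {x : ι → K} {a : k} (h : ∑ i, algebraMap k K (d i) * x i ^ 2 = algebraMap k K a) {i : ι}
    (hi : d i ≠ 0) {S : Set K} (hS : ∀ j ≠ i, x j ∈ S) (j : ι) :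
    IsAlgebraic (Algebra.adjoin k S) (x j) := by
  by_cases hj : j = i
  · subst hj
    refine IsAlgebraic.of_pow two_pos ?_
    rw [← Finset.add_sum_erase _ _ (mem_univ j)] at h
    have hx : x j ^ 2 = algebraMap k K (d j)⁻¹ *
        (algebraMap k K a - ∑ l ∈ univ.erase j, algebraMap k K (d l) * x l ^ 2) := by
      rw [← h, add_sub_cancel_right, ← mul_assoc, ← map_mul, inv_mul_cancel₀ hi, map_one, one_mul]
    have hmem : x j ^ 2 ∈ Algebra.adjoin k S := by
      rw [hx]
      refine mul_mem (algebraMap_mem _ _) (sub_mem (algebraMap_mem _ _) (sum_mem fun l hl => ?_))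
      exact mul_mem (algebraMap_mem _ _)
        (pow_mem (Algebra.subset_adjoin (hS l (Finset.ne_of_mem_erase hl))) 2)
    exact isAlgebraic_algebraMap (⟨_, hmem⟩ : Algebra.adjoin k S)
  · exact isAlgebraic_adjoin_of_mem (hS j hj)

lemma trdeg_le_card_of_adjoin_eq_top {S : Finset K} {T : Set K}
    (hT : IntermediateField.adjoin k T = ⊤)
    (h : ∀ t ∈ T, IsAlgebraic (Algebra.adjoin k (S : Set K)) t) :
    Algebra.trdeg k K ≤ S.card := by
  have := isAlgebraic_of_adjoin_eq_top hT h
  simpa using Algebra.IsAlgebraic.trdeg_le_cardinalMk k (S : Set K)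

lemma mem_of_mulVec_mem {ι : Type*} [Fintype ι] [DecidableEq ι] {c : ι → K} {v : K}
    {g : Matrix ι ι K} (hg : gᵀ * diagonal c * g = diagonal (v • c)) (hc : ∀ i, c i ≠ 0)
    (hv : v ≠ 0) {E : IntermediateField k K} (hgE : ∀ i j, g i j ∈ E) (hcE : ∀ i, c i ∈ E)
    (hvE : v ∈ E) {x : ι → K} (hx : ∀ i, (g *ᵥ x) i ∈ E) (i : ι) : x i ∈ E := by
  have h := congrFun (congrArg (· *ᵥ x) hg) i
  simp only [← mulVec_mulVec, mulVec_diagonal, Matrix.mulVec_diagonal, Pi.smul_apply,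
    smul_eq_mul] at h
  have hmem : (gᵀ *ᵥ diagonal c *ᵥ g *ᵥ x) i ∈ E := by
    rw [Matrix.mulVec, dotProduct]
    refine sum_mem fun j _ => mul_mem (hgE _ _) ?_
    rw [mulVec_diagonal]
    exact mul_mem (hcE _) (hx _)
  rw [h] at hmem
  have h2 := div_mem hmem (mul_mem hvE (hcE i))
  rwa [mul_div_cancel_left₀ _ (mul_ne_zero hv (hc i))] at h2

lemma map_transpose_mul_diagonal {F L : Type*} [Field F] [Field L] (f : F →+* L) {ι : Type*}
    [Fintype ι] [DecidableEq ι] {c c' : ι → F} {g : Matrix ι ι F}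
    (hg : gᵀ * diagonal c * g = diagonal c') :
    (g.map f)ᵀ * diagonal (f ∘ c) * g.map f = diagonal (f ∘ c') := by
  have h := congrArg (fun m => m.map f) hg
  simpa [Matrix.map_mul, Matrix.diagonal_map, Matrix.transpose_map, Function.comp_def] using h

variable (K) in
/-- The field `K` is generated over `k` by the coordinates of a point of the affine quadric
`pfister s = a` together with one further element. -/
def GeneratedByPoint (s : Multiset k) (a : k) : Prop :=
  ∃ (n : ℕ) (d : Fin n → k) (x : Fin n → K) (z : K), univ.val.map d = pfister s ∧
    ∑ i, algebraMap k K (d i) * x i ^ 2 = algebraMap k K a ∧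
    IntermediateField.adjoin k (insert z (Set.range x)) = ⊤

lemma generatedByPoint_of_family {ι : Type*} [Fintype ι] {d : ι → k} {s : Multiset k} {a : k}
    (hd : univ.val.map d = pfister s) (x : ι → K) (z : K)
    (hx : ∑ i, algebraMap k K (d i) * x i ^ 2 = algebraMap k K a)
    (hz : IntermediateField.adjoin k (insert z (Set.range x)) = ⊤) : GeneratedByPoint K s a := by
  obtain ⟨n, d', hd'⟩ := exists_family (pfister s)
  obtain ⟨e, rfl⟩ := exists_equiv_of_map_univ_eq (hd'.trans hd.symm)
  refine ⟨n, _, x ∘ e, z, hd', ?_, by rwa [e.surjective.range_comp]⟩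
  rw [← hx, ← e.sum_comp]
  rfl

lemma GeneratedByPoint.exists_point {s : Multiset k} {a : k} (h : GeneratedByPoint K s a)
    {ι : Type*} [Fintype ι] {d : ι → k} (hd : univ.val.map d = pfister s) :
    ∃ (x : ι → K) (z : K), ∑ i, algebraMap k K (d i) * x i ^ 2 = algebraMap k K a ∧
      IntermediateField.adjoin k (insert z (Set.range x)) = ⊤ := by
  obtain ⟨n, d', x, z, hd', hx, hz⟩ := h
  obtain ⟨e, rfl⟩ := exists_equiv_of_map_univ_eq (hd.trans hd'.symm)
  refine ⟨x ∘ e, z, ?_, by rwa [e.surjective.range_comp]⟩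
  rw [← hx, ← e.sum_comp]
  rfl

lemma ne_zero_of_map_univ_eq_pfister {s : Multiset k} (hs : (0 : k) ∉ s) {ι : Type*} [Fintype ι]
    {d : ι → k} (hd : univ.val.map d = pfister s) (i : ι) : d i ≠ 0 := fun h =>
  zero_notMem_pfister hs (hd ▸ h ▸ Multiset.mem_map_of_mem d (mem_univ i))

lemma GeneratedByPoint.mul {s : Multiset k} {a v : k} (h : GeneratedByPoint K s a)
    (hs : (0 : k) ∉ s) (hv : Represents (pfister s) v) (hv0 : v ≠ 0) :
    GeneratedByPoint K s (a * v) := by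
  obtain ⟨n, d, x, z, hd, hx, hz⟩ := h
  have hvd : univ.val.map (v • d) = (pfister s).map (v * ·) := by
    rw [← hd, Multiset.map_map]
    rfl
  obtain ⟨g, hg⟩ := (hv.subform_pfister hv0).exists_matrix hvd hd
  have hg' := map_transpose_mul_diagonal (algebraMap k K) hg
  refine ⟨n, d, g.map (algebraMap k K) *ᵥ x, z, hd, ?_, ?_⟩
  · refine (sum_mulVec_sq hg' x).trans ?_
    simp only [Function.comp, Pi.smul_apply, smul_eq_mul, map_mul, mul_assoc, ← mul_sum]
    rw [hx, mul_comm]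
  · rw [eq_top_iff, ← hz, IntermediateField.adjoin_le_iff]
    set E := IntermediateField.adjoin k (insert z (Set.range (g.map (algebraMap k K) *ᵥ x)))
    have hg'' : (g.map (algebraMap k K))ᵀ * diagonal (algebraMap k K ∘ d) *
        g.map (algebraMap k K) = diagonal (algebraMap k K v • (algebraMap k K ∘ d)) := by
      rw [hg']
      congr 1
      ext i
      simp
    rintro _ (rfl | ⟨i, rfl⟩)
    · exact IntermediateField.subset_adjoin _ _ (Set.mem_insert _ _)
    · refine mem_of_mulVec_mem hg'' (fun i => ?_) (by simpa using hv0)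
        (fun i j => algebraMap_mem _ _) (fun i => algebraMap_mem _ _) (algebraMap_mem _ _)
        (fun i => IntermediateField.subset_adjoin _ _
          (Set.mem_insert_of_mem _ (Set.mem_range_self i))) i
      simpa using ne_zero_of_map_univ_eq_pfister hs hd i

/-- Over the field generated by a vector, the value of a Pfister form at that vector is a
similarity factor. -/
lemma exists_similarity_mem_adjoin {s : Multiset k} {ι : Type*} [Fintype ι] [DecidableEq ι]
    {d : ι → k} (hd : univ.val.map d = pfister s) (y : ι → K)
    (hy : ∑ i, algebraMap k K (d i) * y i ^ 2 ≠ 0) :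
    ∃ g : Matrix ι ι K, (∀ i j, g i j ∈ IntermediateField.adjoin k (Set.range y)) ∧
      gᵀ * diagonal (algebraMap k K ∘ d) * g =
        diagonal ((∑ i, algebraMap k K (d i) * y i ^ 2) • (algebraMap k K ∘ d)) := by
  set L := IntermediateField.adjoin k (Set.range y)
  have hyL : ∀ i, y i ∈ L := fun i =>
    IntermediateField.subset_adjoin _ _ (Set.mem_range_self i)
  let y' : ι → L := fun i => ⟨y i, hyL i⟩
  have hd' : univ.val.map (algebraMap k L ∘ d) = pfister (s.map (algebraMap k L)) := by
    rw [pfister_map, ← hd, Multiset.map_map]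
  have hv := represents_of_family (algebraMap k L ∘ d) y'
  set v : L := ∑ i, (algebraMap k L ∘ d) i * y' i ^ 2 with hv_def
  have hvy : algebraMap L K v = ∑ i, algebraMap k K (d i) * y i ^ 2 := by
    simp only [hv_def, map_sum, map_mul, map_pow, Function.comp,
      ← IsScalarTower.algebraMap_apply k L K]
    rfl
  have hv0 : v ≠ 0 := by
    intro h
    rw [h, map_zero] at hvy
    exact hy hvy.symm
  rw [hd'] at hv
  have hvd : univ.val.map (v • (algebraMap k L ∘ d)) =
      (pfister (s.map (algebraMap k L))).map (v * ·) := by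
    rw [← hd', Multiset.map_map]
    rfl
  obtain ⟨g, hg⟩ := (hv.subform_pfister hv0).exists_matrix hvd hd'
  refine ⟨g.map (algebraMap L K), fun i j => (g i j).2, ?_⟩
  rw [← hvy]
  convert map_transpose_mul_diagonal (algebraMap L K) hg using 2
  · rfl
  · funext i
    simp only [Function.comp, Pi.smul_apply, smul_eq_mul, map_mul,
      ← IsScalarTower.algebraMap_apply k L K]

lemma GeneratedByPoint.swap {r : Multiset k} {a c : k} (h : GeneratedByPoint K (c ::ₘ r) a)
    (hr : (0 : k) ∉ r) (htr : Algebra.trdeg k K = (2 ^ (r.card + 1) : ℕ)) :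
    GeneratedByPoint K (a ::ₘ r) c := by
  classical
  obtain ⟨n, d, hd⟩ := exists_family (pfister r)
  have hn : n = 2 ^ r.card := by
    rw [← card_pfister, ← hd]
    simp
  have hd0 := ne_zero_of_map_univ_eq_pfister hr hd
  have hfam : ∀ e : k, univ.val.map (Sum.elim d fun i => -e * d i) = pfister (e ::ₘ r) := by
    intro e
    rw [map_univ_sumElim, pfister_cons, ← hd, Multiset.map_map]
    rfl
  obtain ⟨w, z, hw, hz⟩ := h.exists_point (hfam c)
  obtain ⟨x, y, rfl⟩ : ∃ x y, w = Sum.elim x y := ⟨_, _, (Sum.elim_comp_inl_inr w).symm⟩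
  have hsum : ∀ (e : k) (x y : Fin n → K), ∑ i, algebraMap k K (Sum.elim d (fun i => -e * d i) i) *
      Sum.elim x y i ^ 2 = ∑ i, algebraMap k K (d i) * x i ^ 2 -
        algebraMap k K e * ∑ i, algebraMap k K (d i) * y i ^ 2 := by
    intro e x y
    simp [Fintype.sum_sum_type, mul_sum, mul_assoc, sub_eq_add_neg]
  rw [hsum] at hw
  have hy : ∑ i, algebraMap k K (d i) * y i ^ 2 ≠ 0 := by
    intro hy
    rw [hy, mul_zero, sub_zero] at hw
    rw [← map_zero (algebraMap k K)] at hy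
    have hpos : 0 < n := hn ▸ by positivity
    let i : Fin n := ⟨0, hpos⟩
    let S : Finset K := insert z ((univ.erase i).image x ∪ (univ.erase i).image y)
    have hS : S.card < 2 * n := by
      have h1 : S.card ≤ _ := card_insert_le _ _
      have h2 := card_union_le ((univ.erase i).image x) ((univ.erase i).image y)
      have h3 : ((univ.erase i).image x).card ≤ _ := card_image_le
      have h4 : ((univ.erase i).image y).card ≤ _ := card_image_le
      rw [card_erase_of_mem (mem_univ i), card_univ, Fintype.card_fin] at h3 h4
      omega
    have hle : Algebra.trdeg k K ≤ S.card := by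
      refine trdeg_le_card_of_adjoin_eq_top hz ?_
      rintro _ (rfl | ⟨j | j, rfl⟩)
      · exact isAlgebraic_adjoin_of_mem (by simp [S])
      · refine isAlgebraic_adjoin_of_sum_eq hw (hd0 i) (fun l hl => ?_) j
        have : x l ∈ (univ.erase i).image x := mem_image_of_mem _ (by simp [hl])
        simp only [S, coe_insert, coe_union]
        exact Or.inr (Or.inl this)
      · refine isAlgebraic_adjoin_of_sum_eq hy (hd0 i) (fun l hl => ?_) j
        have : y l ∈ (univ.erase i).image y := mem_image_of_mem _ (by simp [hl])
        simp only [S, coe_insert, coe_union]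
        exact Or.inr (Or.inr this)
    rw [htr] at hle
    have hle' : 2 ^ (r.card + 1) ≤ S.card := by exact_mod_cast hle
    rw [pow_succ, ← hn] at hle'
    omega
  obtain ⟨g, hgL, hg⟩ := exists_similarity_mem_adjoin hd y hy
  set v := ∑ i, algebraMap k K (d i) * y i ^ 2 with hv
  have hvy : ∑ i, algebraMap k K (d i) * (y i / v) ^ 2 = v⁻¹ := by
    simp only [div_pow, ← mul_div_assoc, ← Finset.sum_div]
    rw [← hv]
    field_simp
  have hgx := sum_mulVec_sq hg x
  refine generatedByPoint_of_family (hfam a) (Sum.elim (fun i => (g *ᵥ x) i / v) fun i => y i / v)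
    z ?_ ?_
  · rw [hsum, hvy]
    simp only [div_pow, ← mul_div_assoc, ← Finset.sum_div]
    simp only [Function.comp, Pi.smul_apply, smul_eq_mul, mul_assoc, ← mul_sum] at hgx
    rw [hgx]
    field_simp
    linear_combination hw
  · rw [eq_top_iff, ← hz, IntermediateField.adjoin_le_iff]
    set E := IntermediateField.adjoin k (insert z
      (Set.range (Sum.elim (fun i => (g *ᵥ x) i / v) fun i => y i / v)))
    have hxE : ∀ i, (g *ᵥ x) i / v ∈ E := fun i =>
      IntermediateField.subset_adjoin _ _ (Set.mem_insert_of_mem _ ⟨Sum.inl i, rfl⟩)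
    have hyE : ∀ i, y i / v ∈ E := fun i =>
      IntermediateField.subset_adjoin _ _ (Set.mem_insert_of_mem _ ⟨Sum.inr i, rfl⟩)
    have hvE : v ∈ E := by
      rw [← inv_mem_iff, ← hvy]
      exact sum_mem fun i _ => mul_mem (algebraMap_mem _ _) (pow_mem (hyE i) 2)
    have hyE' : ∀ i, y i ∈ E := fun i => by
      simpa [div_mul_cancel₀ _ hy] using mul_mem (hyE i) hvE
    have hLE : IntermediateField.adjoin k (Set.range y) ≤ E := by
      rw [IntermediateField.adjoin_le_iff]
      rintro _ ⟨i, rfl⟩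
      exact hyE' i
    rintro _ (rfl | ⟨i | i, rfl⟩)
    · exact IntermediateField.subset_adjoin _ _ (Set.mem_insert _ _)
    · refine mem_of_mulVec_mem hg (fun i => ?_) hy (fun i j => hLE (hgL i j))
        (fun i => algebraMap_mem _ _) hvE (fun i => ?_) i
      · simpa using hd0 i
      · simpa [div_mul_cancel₀ _ hy] using mul_mem (hxE i) hvE
    · exact hyE' i

lemma GeneratedByPoint.of_cons_eq_cons {s t : Multiset k} {a b : k} (h : GeneratedByPoint K s a)
    (hs : (0 : k) ∉ s) (htr : Algebra.trdeg k K = (2 ^ s.card : ℕ)) (heq : a ::ₘ s = b ::ₘ t) :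
    GeneratedByPoint K t b := by
  obtain ⟨rfl, rfl⟩ | ⟨-, r, rfl, rfl⟩ := Multiset.cons_eq_cons.mp heq
  · exact h
  · rw [Multiset.card_cons] at htr
    exact h.swap (fun h0 => hs (Multiset.mem_cons_of_mem h0)) htr

lemma GeneratedByPoint.of_chain {s s' : Multiset k} {a a' : k} (h : GeneratedByPoint K s a)
    (hchain : Chain (a ::ₘ s) (a' ::ₘ s')) (hs : (0 : k) ∉ a ::ₘ s)
    (htr : Algebra.trdeg k K = (2 ^ s.card : ℕ)) : GeneratedByPoint K s' a' := by
  generalize hm : a' ::ₘ s' = m at hchain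
  have key : (0 : k) ∉ m ∧ m.card = s.card + 1 ∧
      ∀ t b, m = b ::ₘ t → GeneratedByPoint K t b := by
    clear hm
    induction hchain with
    | refl =>
      exact ⟨hs, Multiset.card_cons _ _, fun t b => h.of_cons_eq_cons
        (fun h0 => hs (Multiset.mem_cons_of_mem h0)) htr⟩
    | tail _ hstep ih =>
      obtain ⟨h0, hcard, ih⟩ := ih
      refine ⟨hstep.zero_notMem h0, hstep.card_eq ▸ hcard, ?_⟩
      obtain ⟨t, c, v, rfl, rfl, hv0, hv⟩ := hstep
      have ht : (0 : k) ∉ t := fun h => h0 (Multiset.mem_cons_of_mem h)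
      rw [Multiset.card_cons, Nat.succ_inj] at hcard
      exact fun _ _ => ((ih t c rfl).mul ht hv hv0).of_cons_eq_cons ht (hcard ▸ htr)
  exact key.2.2 _ _ hm.symm

end Generation

section Quadric

open Polynomial (natDegree)

variable {k ι : Type*} [Field k]

variable [Fintype ι] in
/-- The quadratic polynomial of the diagonal form with entries `d` and `-a`. -/
noncomputable def quadric (d : ι → k) (a : k) : MvPolynomial (ι ⊕ Unit) k :=
  (∑ i, C (d i) * X (Sum.inl i) ^ 2) - C a * X (Sum.inr ()) ^ 2

variable (k ι) in
/-- Polynomials in `ι ⊕ Unit` variables as univariate polynomials in the last variable. -/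
noncomputable def lastVariableEquiv :
    MvPolynomial (ι ⊕ Unit) k ≃ₐ[k] Polynomial (MvPolynomial ι k) :=
  (renameEquiv k (Equiv.optionEquivSumPUnit ι).symm).trans (optionEquivLeft k ι)

lemma lastVariableEquiv_X_inl (i : ι) :
    lastVariableEquiv k ι (X (Sum.inl i)) = Polynomial.C (X i) := by
  simp [lastVariableEquiv]

lemma lastVariableEquiv_X_inr (u : Unit) :
    lastVariableEquiv k ι (X (Sum.inr u)) = Polynomial.X := by
  simp [lastVariableEquiv]

lemma lastVariableEquiv_C (c : k) :
    lastVariableEquiv k ι (C c) = Polynomial.C (C c) := by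
  simp [lastVariableEquiv]

lemma lastVariableEquiv_rename_inl (p : MvPolynomial ι k) :
    lastVariableEquiv k ι (rename Sum.inl p) = Polynomial.C p := by
  induction p using MvPolynomial.induction_on with
  | C c => rw [rename_C, lastVariableEquiv_C]
  | add p q hp hq => rw [map_add, map_add, hp, hq, map_add]
  | mul_X p i hp => rw [map_mul, map_mul, hp, rename_X, lastVariableEquiv_X_inl, map_mul]

variable [Fintype ι]

lemma lastVariableEquiv_quadric (d : ι → k) {a : k} (ha : a ≠ 0) :
    lastVariableEquiv k ι (quadric d a) = Polynomial.C (C (-a)) *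
      (Polynomial.X ^ 2 - Polynomial.C (∑ i, C (d i / a) * X i ^ 2)) := by
  have h : ∑ i, Polynomial.C (C (d i)) * Polynomial.C (X i) ^ 2 = Polynomial.C (C a) *
      ∑ i, Polynomial.C (C (d i / a)) * Polynomial.C (X i : MvPolynomial ι k) ^ 2 := by
    rw [mul_sum]
    refine sum_congr rfl fun i _ => ?_
    rw [← mul_assoc, ← map_mul, ← map_mul, mul_div_cancel₀ _ ha]
  simp only [quadric, map_sub, map_sum, map_mul, map_pow, lastVariableEquiv_X_inl,
    lastVariableEquiv_X_inr, lastVariableEquiv_C, map_neg]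
  rw [h]
  ring

lemma natDegree_lastVariableEquiv_quadric (d : ι → k) {a : k} (ha : a ≠ 0) :
    (lastVariableEquiv k ι (quadric d a)).natDegree = 2 := by
  rw [lastVariableEquiv_quadric d ha, Polynomial.natDegree_C_mul (by simpa using ha),
    Polynomial.natDegree_X_pow_sub_C]

lemma eq_zero_of_quadric_dvd {d : ι → k} {a : k} (ha : a ≠ 0) {p : MvPolynomial (ι ⊕ Unit) k}
    (h : quadric d a ∣ p) (hp : (lastVariableEquiv k ι p).natDegree < 2) : p = 0 := by
  have h2 := map_dvd (lastVariableEquiv k ι) h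
  rw [← natDegree_lastVariableEquiv_quadric d ha] at hp
  exact (map_eq_zero_iff _ (lastVariableEquiv k ι).injective).mp
    (Polynomial.eq_zero_of_dvd_of_natDegree_lt h2 hp)

lemma not_isSquare_sum_C_mul_X_sq [NeZero (2 : k)] [Nontrivial ι] {c : ι → k}
    (hc : ∀ i, c i ≠ 0) (h : MvPolynomial ι k) : h ^ 2 ≠ ∑ i, C (c i) * X i ^ 2 := by
  classical
  intro heq
  have hX : ∀ i, h ∣ X i := fun i => by
    have hd := congrArg (pderiv i) heq
    rw [map_sum, Finset.sum_eq_single i (fun j _ hj => by simp [pderiv_X_of_ne hj]) (by simp)] at hd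
    simp only [Derivation.leibniz_pow, Derivation.leibniz, pderiv_X_self, pderiv_C, 
      add_zero, smul_eq_mul, nsmul_eq_mul, mul_one, Nat.add_one_sub_one, pow_one, mul_zero,
      Nat.cast_ofNat] at hd
    refine ⟨C (c i)⁻¹ * pderiv i h, ?_⟩
    have h1 : (C (c i)⁻¹ * C (c i) : MvPolynomial ι k) = 1 := by
      rw [← map_mul, inv_mul_cancel₀ (hc i), map_one]
    have h2 : (2 : MvPolynomial ι k) ≠ 0 := by
      rw [← map_ofNat C 2]
      exact C_ne_zero.mpr (NeZero.ne _)
    apply mul_left_cancel₀ h2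
    linear_combination (-C (c i)⁻¹) * hd - 2 * X i * h1
  obtain ⟨i, j, hij⟩ := exists_pair_ne ι
  have hu : IsUnit h := by
    refine ((X_prime (i := i) (R := k)).irreducible.isRelPrime_iff_not_dvd.mpr ?_) (hX i) (hX j)
    rw [MvPolynomial.X_dvd_X]
    simpa using hij
  have h0 := congrArg (eval (0 : ι → k)) heq
  have := hu.map (eval (0 : ι → k))
  simp at h0 this
  exact this h0

lemma prime_quadric [NeZero (2 : k)] [Nontrivial ι] {d : ι → k} (hd : ∀ i, d i ≠ 0) {a : k}
    (ha : a ≠ 0) : Prime (quadric d a) := by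
  rw [← MulEquiv.prime_iff (lastVariableEquiv k ι)]
  rw [lastVariableEquiv_quadric d ha]
  set c : MvPolynomial ι k := ∑ i, C (d i / a) * X i ^ 2 with hc
  have hu : IsUnit (Polynomial.C (C (-a) : MvPolynomial ι k)) :=
    Polynomial.isUnit_C.mpr ((neg_ne_zero.mpr ha).isUnit.map C)
  rw [((associated_unit_mul_left _ _ hu)).prime_iff]
  refine Irreducible.prime ?_
  have hdeg : (Polynomial.X ^ 2 - Polynomial.C c).natDegree = 2 :=
    Polynomial.natDegree_X_pow_sub_C
  rw [(Polynomial.monic_X_pow_sub_C c two_ne_zero).irreducible_iff_roots_eq_zero_of_degree_le_three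
    hdeg.ge (by rw [hdeg]; norm_num), Multiset.eq_zero_iff_forall_notMem]
  intro h hr
  have h2 := Polynomial.isRoot_of_mem_roots hr
  simp only [Polynomial.IsRoot, Polynomial.eval_sub, Polynomial.eval_pow, Polynomial.eval_X,
    Polynomial.eval_C] at h2
  exact not_isSquare_sum_C_mul_X_sq (fun i => div_ne_zero (hd i) ha) h (sub_eq_zero.mp h2)

end Quadric

section FunctionField

variable {k : Type*} [Field k]

lemma adjoin_mk_X_eq_top {σ : Type*} (I : Ideal (MvPolynomial σ k))
    [IsDomain (MvPolynomial σ k ⧸ I)] :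
    IntermediateField.adjoin k (Set.range fun i => algebraMap (MvPolynomial σ k ⧸ I)
      (FractionRing (MvPolynomial σ k ⧸ I)) (Ideal.Quotient.mk I (X i))) = ⊤ := by
  set E := IntermediateField.adjoin k (Set.range fun i => algebraMap (MvPolynomial σ k ⧸ I)
      (FractionRing (MvPolynomial σ k ⧸ I)) (Ideal.Quotient.mk I (X i)))
  have h : ∀ p : MvPolynomial σ k, algebraMap (MvPolynomial σ k ⧸ I)
      (FractionRing (MvPolynomial σ k ⧸ I)) (Ideal.Quotient.mk I p) ∈ E := fun p => by
    induction p using MvPolynomial.induction_on with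
    | C c => exact algebraMap_mem E c
    | add p q hp hq =>
      rw [map_add, map_add]
      exact add_mem hp hq
    | mul_X p i hp =>
      rw [map_mul, map_mul]
      exact mul_mem hp (IntermediateField.subset_adjoin _ _ (Set.mem_range_self i))
  refine eq_top_iff.mpr fun y _ => ?_
  obtain ⟨p, q, -, rfl⟩ := IsFractionRing.div_surjective (A := MvPolynomial σ k ⧸ I) y
  obtain ⟨p, rfl⟩ := Ideal.Quotient.mk_surjective p
  obtain ⟨q, rfl⟩ := Ideal.Quotient.mk_surjective q
  exact div_mem (h p) (h q)

variable {ι : Type*} [Fintype ι]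

lemma isDomain_quotient_quadric [NeZero (2 : k)] [Nontrivial ι] {d : ι → k}
    (hd : ∀ i, d i ≠ 0) {a : k} (ha : a ≠ 0) :
    IsDomain (MvPolynomial (ι ⊕ Unit) k ⧸ Ideal.span {quadric d a}) := by
  have hp := prime_quadric hd ha
  have := (Ideal.span_singleton_prime hp.ne_zero).mpr hp
  infer_instance

lemma aeval_quadric {K : Type*} [Field K] [Algebra k K] (d : ι → k) (a : k) (w : ι ⊕ Unit → K) :
    aeval w (quadric d a) = ∑ i, algebraMap k K (d i) * w (Sum.inl i) ^ 2 -
      algebraMap k K a * w (Sum.inr ()) ^ 2 := by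
  simp [quadric]

lemma isAlgebraic_adjoin_of_aeval_quadric_eq_zero {K : Type*} [Field K] [Algebra k K] {d : ι → k}
    {a : k} (ha : a ≠ 0) {w : ι ⊕ Unit → K} (hw : aeval w (quadric d a) = 0)
    (htop : IntermediateField.adjoin k (Set.range w) = ⊤) :
    Algebra.IsAlgebraic (Algebra.adjoin k (Set.range (w ∘ Sum.inl))) K := by
  classical
  refine isAlgebraic_of_adjoin_eq_top htop ?_
  rintro _ ⟨i, rfl⟩
  refine isAlgebraic_adjoin_of_sum_eq (d := Sum.elim d fun _ => -a) (a := 0) ?_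
    (i := Sum.inr ()) (by simpa using ha) ?_ i
  · rw [map_zero, ← hw, aeval_quadric]
    simp [sub_eq_add_neg]
  · rintro (j | u) hj
    · exact ⟨j, rfl⟩
    · exact absurd rfl hj

variable {d : ι → k} {a : k}

lemma isIntegral_rename_inl (ha : a ≠ 0) : ((Ideal.Quotient.mk (Ideal.span {quadric d a})).comp
    (rename Sum.inl : MvPolynomial ι k →ₐ[k] _).toRingHom).IsIntegral := by
  set f := (Ideal.Quotient.mk (Ideal.span {quadric d a})).comp
    (rename Sum.inl : MvPolynomial ι k →ₐ[k] _).toRingHom with hf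
  let _ := f.toAlgebra
  set π := Ideal.Quotient.mk (Ideal.span {quadric d a})
  have hC : ∀ c : k, π (C c) = f (C c) := fun c => by simp [hf]
  have hX : ∀ i, π (X (Sum.inl i)) = f (X i) := fun i => by simp [hf]
  have hz : π (X (Sum.inr ())) ^ 2 = f (C a⁻¹ * ∑ i, C (d i) * X i ^ 2) := by
    have h0 : π ((∑ i, C (d i) * X (Sum.inl i) ^ 2) - C a * X (Sum.inr ()) ^ 2) = 0 :=
      (Ideal.Quotient.eq_zero_iff_dvd (quadric d a) (quadric d a)).mpr dvd_rfl
    have h1 : f (C a⁻¹) * f (C a) = 1 := by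
      rw [← map_mul, ← map_mul, inv_mul_cancel₀ ha, map_one, map_one]
    simp only [map_sub, map_sum, map_mul, map_pow, hC, hX] at h0 ⊢
    linear_combination f (C a⁻¹) * (-h0) - π (X (Sum.inr ())) ^ 2 * h1
  intro q
  obtain ⟨p, rfl⟩ := Ideal.Quotient.mk_surjective q
  change IsIntegral (MvPolynomial ι k) _
  induction p using MvPolynomial.induction_on with
  | C c => exact hC c ▸ isIntegral_algebraMap
  | add p q hp hq => exact map_add π p q ▸ hp.add hq
  | mul_X p i hp =>
    rw [map_mul]
    refine hp.mul ?_
    obtain i | u := i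
    · exact hX i ▸ isIntegral_algebraMap
    · exact IsIntegral.of_pow two_pos (hz ▸ isIntegral_algebraMap)

variable (d a) in
/-- The coordinate functions on the quadric, as elements of its function field. -/
noncomputable def coordinate (i : ι ⊕ Unit) :
    FractionRing (MvPolynomial (ι ⊕ Unit) k ⧸ Ideal.span {quadric d a}) :=
  algebraMap (MvPolynomial (ι ⊕ Unit) k ⧸ Ideal.span {quadric d a}) _
    (Ideal.Quotient.mk _ (X i))

lemma aeval_coordinate (p : MvPolynomial (ι ⊕ Unit) k) :
    aeval (coordinate d a) p =
      algebraMap (MvPolynomial (ι ⊕ Unit) k ⧸ Ideal.span {quadric d a}) _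
        (Ideal.Quotient.mk _ p) := by
  induction p using MvPolynomial.induction_on with
  | C c => rw [aeval_C]; rfl
  | add p q hp hq => rw [map_add, hp, hq, map_add, map_add]
  | mul_X p i hp => rw [map_mul, hp, aeval_X, map_mul, map_mul]; rfl

variable [IsDomain (MvPolynomial (ι ⊕ Unit) k ⧸ Ideal.span {quadric d a})]

lemma aeval_coordinate_eq_zero_iff {p : MvPolynomial (ι ⊕ Unit) k} :
    aeval (coordinate d a) p = 0 ↔ quadric d a ∣ p := by
  rw [aeval_coordinate, FaithfulSMul.algebraMap_eq_zero_iff, Ideal.Quotient.eq_zero_iff_dvd]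

lemma coordinate_inr_ne_zero (ha : a ≠ 0) : coordinate d a (Sum.inr ()) ≠ 0 := by
  rw [← aeval_X (R := k) (coordinate d a), Ne, aeval_coordinate_eq_zero_iff]
  refine fun h => X_ne_zero (R := k) (Sum.inr () : ι ⊕ Unit) (eq_zero_of_quadric_dvd ha h ?_)
  rw [lastVariableEquiv_X_inr]
  exact Polynomial.natDegree_X_le.trans_lt one_lt_two

lemma trdeg_functionField (ha : a ≠ 0) :
    Algebra.trdeg k (FractionRing (MvPolynomial (ι ⊕ Unit) k ⧸ Ideal.span {quadric d a})) =
      Fintype.card ι := by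
  have hind : AlgebraicIndependent k (coordinate d a ∘ Sum.inl) := by
    rw [algebraicIndependent_iff]
    intro p hp
    rw [← aeval_rename, aeval_coordinate_eq_zero_iff] at hp
    refine (map_eq_zero_iff _ (rename_injective _ Sum.inl_injective)).mp
      (eq_zero_of_quadric_dvd ha hp ?_)
    rw [lastVariableEquiv_rename_inl, Polynomial.natDegree_C]
    exact two_pos
  have hb : IsTranscendenceBasis k (coordinate d a ∘ Sum.inl) := by
    rw [hind.isTranscendenceBasis_iff_isAlgebraic]
    exact isAlgebraic_adjoin_of_aeval_quadric_eq_zero ha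
      (aeval_coordinate_eq_zero_iff.mpr dvd_rfl) (adjoin_mk_X_eq_top _)
  simpa using hb.lift_cardinalMk_eq_trdeg.symm

lemma generatedByPoint_functionField (ha : a ≠ 0) {s : Multiset k}
    (hd : univ.val.map d = pfister s) :
    GeneratedByPoint (FractionRing (MvPolynomial (ι ⊕ Unit) k ⧸ Ideal.span {quadric d a})) s a := by
  have hz := coordinate_inr_ne_zero (d := d) ha
  have h0 : aeval (coordinate d a) (quadric d a) = 0 := aeval_coordinate_eq_zero_iff.mpr dvd_rfl
  rw [aeval_quadric, sub_eq_zero] at h0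
  refine generatedByPoint_of_family hd
    (fun i => coordinate d a (Sum.inl i) / coordinate d a (Sum.inr ()))
    (coordinate d a (Sum.inr ())) ?_ ?_
  · simp only [div_pow, ← mul_div_assoc, ← Finset.sum_div]
    rw [h0, mul_div_cancel_right₀ _ (pow_ne_zero 2 hz)]
  · rw [eq_top_iff, ← adjoin_mk_X_eq_top, IntermediateField.adjoin_le_iff]
    set E := IntermediateField.adjoin k (insert (coordinate d a (Sum.inr ()))
      (Set.range fun i => coordinate d a (Sum.inl i) / coordinate d a (Sum.inr ())))
    have hzE : coordinate d a (Sum.inr ()) ∈ E :=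
      IntermediateField.subset_adjoin _ _ (Set.mem_insert _ _)
    rintro _ ⟨i | u, rfl⟩
    · have h : coordinate d a (Sum.inl i) / coordinate d a (Sum.inr ()) ∈ E :=
        IntermediateField.subset_adjoin _ _ (Set.mem_insert_of_mem _ (Set.mem_range_self i))
      have h2 := mul_mem h hzE
      rwa [div_mul_cancel₀ _ hz] at h2
    · exact hzE

lemma nonempty_functionField_algEquiv {K : Type*} [Field K] [Algebra k K] (ha : a ≠ 0)
    {w : ι ⊕ Unit → K} (hw : aeval w (quadric d a) = 0)
    (htop : IntermediateField.adjoin k (Set.range w) = ⊤)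
    (htr : Algebra.trdeg k K = Fintype.card ι) :
    Nonempty (FractionRing (MvPolynomial (ι ⊕ Unit) k ⧸ Ideal.span {quadric d a}) ≃ₐ[k] K) := by
  have halg := isAlgebraic_adjoin_of_aeval_quadric_eq_zero ha hw htop
  have hb : IsTranscendenceBasis k (w ∘ Sum.inl) :=
    Algebra.IsAlgebraic.isTranscendenceBasis_of_lift_le_trdeg_of_finite _ _ (by simp [htr])
  let φ : (MvPolynomial (ι ⊕ Unit) k ⧸ Ideal.span {quadric d a}) →ₐ[k] K :=
    Ideal.Quotient.liftₐ _ (aeval w) fun p hp => by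
      obtain ⟨q, rfl⟩ := Ideal.mem_span_singleton.mp hp
      rw [map_mul, hw, zero_mul]
  have hφ : ∀ p, φ (Ideal.Quotient.mk _ p) = aeval w p := fun p => rfl
  have hinj : Function.Injective φ := by
    rw [injective_iff_map_eq_zero]
    intro q hq
    by_contra hq0
    let f := (Ideal.Quotient.mk (Ideal.span {quadric d a})).comp
      (rename Sum.inl : MvPolynomial ι k →ₐ[k] _).toRingHom
    let _ := f.toAlgebra
    have hint : IsIntegral (MvPolynomial ι k) q := isIntegral_rename_inl ha q
    obtain ⟨r, hr0, hr⟩ := hint.isAlgebraic.exists_nonzero_dvd (mem_nonZeroDivisors_of_ne_zero hq0)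
    have h0 := map_dvd φ hr
    rw [hq, zero_dvd_iff] at h0
    have h1 : φ (algebraMap (MvPolynomial ι k) _ r) = aeval (w ∘ Sum.inl) r := by
      rw [← aeval_rename]
      exact hφ _
    rw [h1] at h0
    exact hr0 (algebraicIndependent_iff.mp hb.1 r h0)
  let ψ : FractionRing (MvPolynomial (ι ⊕ Unit) k ⧸ Ideal.span {quadric d a}) →ₐ[k] K :=
    IsFractionRing.liftAlgHom hinj
  refine ⟨AlgEquiv.ofBijective ψ ⟨ψ.toRingHom.injective, ?_⟩⟩
  rw [← AlgHom.fieldRange_eq_top, eq_top_iff, ← htop, IntermediateField.adjoin_le_iff]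
  rintro _ ⟨i, rfl⟩
  refine ⟨coordinate d a i, ?_⟩
  change IsFractionRing.lift (g := φ.toRingHom) hinj _ = _
  rw [coordinate, IsFractionRing.lift_algebraMap]
  exact (hφ _).trans (aeval_X _ _)

lemma GeneratedByPoint.nonempty_functionField_algEquiv [Nonempty ι] {K : Type*} [Field K]
    [Algebra k K] {s : Multiset k} (h : GeneratedByPoint K s a) (ha : a ≠ 0) (hs : (0 : k) ∉ s)
    (hd : univ.val.map d = pfister s) (htr : Algebra.trdeg k K = Fintype.card ι) :
    Nonempty (FractionRing (MvPolynomial (ι ⊕ Unit) k ⧸ Ideal.span {quadric d a}) ≃ₐ[k] K) := by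
  classical
  obtain ⟨x, z, hx, htop⟩ := h.exists_point hd
  have hz : z ≠ 0 := by
    rintro rfl
    obtain ⟨i⟩ := ‹Nonempty ι›
    have hle : Algebra.trdeg k K ≤ ((univ.erase i).image x).card := by
      refine trdeg_le_card_of_adjoin_eq_top htop ?_
      rintro _ (rfl | ⟨j, rfl⟩)
      · exact isAlgebraic_zero
      · exact isAlgebraic_adjoin_of_sum_eq hx (ne_zero_of_map_univ_eq_pfister hs hd i)
          (fun l hl => mem_image_of_mem _ (by simp [hl])) j
    rw [htr, Nat.cast_le] at hle
    have h2 := hle.trans card_image_le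
    rw [card_erase_of_mem (mem_univ i), card_univ] at h2
    have := Fintype.card_pos_iff.mpr ⟨i⟩
    omega
  refine DiagonalForm.nonempty_functionField_algEquiv ha
    (w := Sum.elim (fun i => x i * z) fun _ => z) ?_ ?_ htr
  · simp only [aeval_quadric, Sum.elim_inl, Sum.elim_inr, mul_pow, ← mul_assoc, ← sum_mul]
    rw [hx, sub_self]
  · rw [eq_top_iff, ← htop, IntermediateField.adjoin_le_iff]
    have hzE := IntermediateField.subset_adjoin k _
      (Set.mem_range_self (f := Sum.elim (fun i => x i * z) fun _ => z) (Sum.inr ()))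
    rintro _ (rfl | ⟨i, rfl⟩)
    · exact hzE
    · have h2 := div_mem (IntermediateField.subset_adjoin k _
        (Set.mem_range_self (f := Sum.elim (fun i => x i * z) fun _ => z) (Sum.inl i))) hzE
      rwa [Sum.elim_inl, Sum.elim_inr, mul_div_cancel_right₀ _ hz] at h2

end FunctionField

section Comparison

lemma map_univ_prod_ite {F : Type*} [CommRing F] {n : ℕ} (b : Fin n → F) :
    univ.val.map (fun ε : Fin n → Bool => ∏ i, if ε i then -b i else 1) =
      pfister (univ.val.map b) := by
  induction n with
  | zero => simp [pfister_zero]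
  | succ n ih =>
    let e : (Fin n → Bool) ⊕ (Fin n → Bool) ≃ (Fin (n + 1) → Bool) :=
      (Equiv.boolProdEquivSum _).symm.trans (Fin.consEquiv fun _ => Bool)
    have hb : univ.val.map b = b 0 ::ₘ univ.val.map (b ∘ Fin.succ) := by
      rw [Fin.univ_succ]
      simp [Function.comp_def]
    rw [hb, pfister_cons, ← ih, Multiset.map_map, ← map_univ_sumElim,
      ← Multiset.map_univ_val_equiv e, Multiset.map_map]
    refine Multiset.map_congr rfl fun ε _ => ?_
    obtain ε | ε := ε <;> simp [e, Fin.prod_univ_succ]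

lemma subform_of_linearMap {F : Type*} [Field F] [NeZero (2 : F)] {ι ι' : Type*} [Fintype ι]
    [Fintype ι'] {d : ι → F} {d' : ι' → F} (f : (ι → F) →ₗ[F] (ι' → F))
    (h : ∀ x, ∑ i, d' i * f x i ^ 2 = ∑ i, d i * x i ^ 2) :
    Subform (univ.val.map d) (univ.val.map d') := by
  classical
  refine subform_of_matrix (g := LinearMap.toMatrix' f)
    (transpose_mul_diagonal_mul_eq_iff.mpr fun p q => ?_)
  have hs : ∀ p, ∑ i, d' i * f (Pi.single p 1) i ^ 2 = d p := fun p => by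
    rw [h, Finset.sum_eq_single p (fun j _ hj => by simp [hj]) (by simp)]
    simp
  simp only [LinearMap.toMatrix'_apply]
  split_ifs with hpq
  · subst hpq
    rw [← hs p]
    exact sum_congr rfl fun i _ => by ring
  · have hadd := h (Pi.single p 1 + Pi.single q 1)
    have hd : ∑ i, d i * (Pi.single p 1 + Pi.single q 1 : ι → F) i ^ 2 = d p + d q := by
      rw [← add_sum_erase _ _ (mem_univ p), ← add_sum_erase _ _ (mem_erase.mpr
        ⟨Ne.symm hpq, mem_univ q⟩), sum_eq_zero fun j hj => ?_]
      · simp [hpq, Ne.symm hpq]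
      · simp only [mem_erase] at hj
        simp [hj.1, hj.2.1]
    have hd' : ∑ i, d' i * f (Pi.single p 1 + Pi.single q 1) i ^ 2 = d p + d q +
        2 * ∑ i, d' i * f (Pi.single p 1) i * f (Pi.single q 1) i := by
      rw [← hs p, ← hs q, mul_sum, ← sum_add_distrib, ← sum_add_distrib]
      refine sum_congr rfl fun i _ => ?_
      rw [map_add, Pi.add_apply]
      ring
    rw [hd', hd, add_eq_left] at hadd
    exact (mul_eq_zero.mp hadd).resolve_left two_ne_zero

lemma map_univ_fin_succ {F : Type*} {n : ℕ} (a : Fin (n + 1) → F) :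
    univ.val.map a = a (Fin.last n) ::ₘ univ.val.map fun i : Fin n => a i.castSucc := by
  rw [Fin.univ_castSuccEmb]
  simp [Function.comp_def]

end Comparison

theorem birationallyEquivalent_quadric {k : Type*} [Field k] [NeZero (2 : k)] {ι : Type*}
    [Fintype ι] [Nontrivial ι] {d d' : ι → k} {s s' : Multiset k} {a a' : k}
    (hd : univ.val.map d = pfister s) (hd' : univ.val.map d' = pfister s')
    (hs : (0 : k) ∉ a ::ₘ s) (hs' : (0 : k) ∉ a' ::ₘ s')
    (h : Subform (pfister (a' ::ₘ s')) (pfister (a ::ₘ s))) :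
    BirationallyEquivalent k (quadric d a) (quadric d' a') := by
  have hcard : Fintype.card ι = 2 ^ s.card := by
    rw [← card_pfister, ← hd, Multiset.card_map]
    rfl
  have hcard' : Fintype.card ι = 2 ^ s'.card := by
    rw [← card_pfister, ← hd', Multiset.card_map]
    rfl
  have hs0 : (0 : k) ∉ s := fun h0 => hs (Multiset.mem_cons_of_mem h0)
  have hs0' : (0 : k) ∉ s' := fun h0 => hs' (Multiset.mem_cons_of_mem h0)
  have ha : a ≠ 0 := fun h0 => hs (h0 ▸ Multiset.mem_cons_self _ _)
  have ha' : a' ≠ 0 := fun h0 => hs' (h0 ▸ Multiset.mem_cons_self _ _)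
  have := isDomain_quotient_quadric (ne_zero_of_map_univ_eq_pfister hs0 hd) ha
  have := isDomain_quotient_quadric (ne_zero_of_map_univ_eq_pfister hs0' hd') ha'
  have hchain : Chain (a ::ₘ s) (a' ::ₘ s') := by
    have hc : s.card = s'.card := Nat.pow_right_injective le_rfl (hcard.symm.trans hcard')
    simpa using chain_of_subform 0 (a ::ₘ s) (a' ::ₘ s') hs' (by simp [hc]) (by simpa using h)
  have htr := trdeg_functionField (d := d) ha
  have hgen := (generatedByPoint_functionField ha hd).of_chain hchain hs (hcard ▸ htr)
  obtain ⟨e⟩ := hgen.nonempty_functionField_algEquiv ha' hs0' hd' htr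
  exact ⟨e.symm⟩

end DiagonalForm

/-- Let `k` be a field of characteristic 0, `n ≥ 2`
(written `n = n₀ + 2`), and `a₁,…,aₙ, b₁,…,bₙ ∈ kˣ`.  If the `n`-fold Pfister
forms `φ = ⟪a₁,…,aₙ⟫` and `φ' = ⟪b₁,…,bₙ⟫` are equivalent (isometric over `k`),
then the associated subforms `ψ = ⟪a₁,…,a_{n−1}⟫ ⊥ ⟨−aₙ⟩` and
`ψ' = ⟪b₁,…,b_{n−1}⟫ ⊥ ⟨−bₙ⟩`, quadratic forms in `2^{n−1} + 1` variables,
are birationally equivalent. -/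
theorem equivalent_pfister_birational_subforms
    (k : Type*) [Field k] [CharZero k] (n₀ : ℕ)
    (a b : Fin (n₀ + 2) → k) (ha : ∀ i, a i ≠ 0) (hb : ∀ i, b i ≠ 0)
    -- diagonal entries of the Gram matrices of ⟪a₁,…,aₙ⟫ and ⟪b₁,…,bₙ⟫
    (da db : (Fin (n₀ + 2) → Bool) → k)
    (hda : ∀ ε, da ε = ∏ i : Fin (n₀ + 2), if ε i then -a i else 1)
    (hdb : ∀ ε, db ε = ∏ i : Fin (n₀ + 2), if ε i then -b i else 1)
    -- the Pfister forms φ and φ' are equivalent (isometric)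
    (hequiv : ∃ T : ((Fin (n₀ + 2) → Bool) → k) ≃ₗ[k] ((Fin (n₀ + 2) → Bool) → k),
        ∀ x : (Fin (n₀ + 2) → Bool) → k,
          ∑ ε : Fin (n₀ + 2) → Bool, db ε * (T x) ε ^ 2 =
            ∑ ε : Fin (n₀ + 2) → Bool, da ε * x ε ^ 2)
    -- diagonal entries of the Gram matrices of ⟪a₁,…,a_{n−1}⟫ and ⟪b₁,…,b_{n−1}⟫
    (da' db' : (Fin (n₀ + 1) → Bool) → k)
    (hda' : ∀ ε, da' ε = ∏ i : Fin (n₀ + 1), if ε i then -a i.castSucc else 1)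
    (hdb' : ∀ ε, db' ε = ∏ i : Fin (n₀ + 1), if ε i then -b i.castSucc else 1)
    -- the subforms ψ = ⟪a₁,…,a_{n−1}⟫ ⊥ ⟨−aₙ⟩ and ψ' = ⟪b₁,…,b_{n−1}⟫ ⊥ ⟨−bₙ⟩
    (Ψ Ψ' : MvPolynomial ((Fin (n₀ + 1) → Bool) ⊕ Unit) k)
    (hΨ : Ψ = (∑ ε : Fin (n₀ + 1) → Bool, MvPolynomial.C (da' ε) * X (Sum.inl ε) ^ 2)
        - MvPolynomial.C (a (Fin.last (n₀ + 1))) * X (Sum.inr ()) ^ 2)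
    (hΨ' : Ψ' = (∑ ε : Fin (n₀ + 1) → Bool, MvPolynomial.C (db' ε) * X (Sum.inl ε) ^ 2)
        - MvPolynomial.C (b (Fin.last (n₀ + 1))) * X (Sum.inr ()) ^ 2) :
    BirationallyEquivalent k Ψ Ψ' := by
  obtain ⟨T, hT⟩ := hequiv
  obtain rfl : da' = _ := funext hda'
  obtain rfl : db' = _ := funext hdb'
  rw [hΨ, hΨ']
  have hmem : ∀ c : Fin (n₀ + 2) → k, (∀ i, c i ≠ 0) → (0 : k) ∉ Finset.univ.val.map c :=
    fun c hc h => by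
      obtain ⟨i, -, hi⟩ := Multiset.mem_map.mp h
      exact hc i hi
  refine DiagonalForm.birationallyEquivalent_quadric
    (DiagonalForm.map_univ_prod_ite fun i : Fin (n₀ + 1) => a i.castSucc)
    (DiagonalForm.map_univ_prod_ite fun i : Fin (n₀ + 1) => b i.castSucc)
    (DiagonalForm.map_univ_fin_succ a ▸ hmem a ha)
    (DiagonalForm.map_univ_fin_succ b ▸ hmem b hb) ?_
  rw [← DiagonalForm.map_univ_fin_succ, ← DiagonalForm.map_univ_fin_succ,
    ← DiagonalForm.map_univ_prod_ite, ← DiagonalForm.map_univ_prod_ite, ← funext hda, ← funext hdb]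
  exact DiagonalForm.subform_of_linearMap T.symm.toLinearMap fun x => by
    simpa using (hT (T.symm x)).symm
end

section
/- Let k be a field of characteristic 0 and let φ be a nondegenerate quadratic form on k^m (m ≥ 1) that is strongly multiplicative, meaning: over the rational function field K = k(t₁,…,t_m) in m variables, the extended form φ_K is isometric to the scaled form φ(t₁,…,t_m)·φ_K. Then for all b, c ∈ kˣ, the quadratic forms φ ⊥ ⟨−b⟩φ ⊥ ⟨−c⟩, given by (x, y, z) ↦ φ(x) − b·φ(y) − c·z² on k^m × k^m × k, and φ ⊥ ⟨−c⟩φ ⊥ ⟨−b⟩, given by (x, y, z) ↦ φ(x) − c·φ(y) − b·z², are birationally equivalent. -/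
open MvPolynomial

open scoped nonZeroDivisors

/-- Localizing at elements that are cancellable modulo `f` does not change the total fraction ring
of the quotient by `f`. -/
theorem nonempty_fractionRing_quotient_algEquiv_s8 (k : Type*) {P L : Type*} [CommRing k] [CommRing P]
    [CommRing L] [Algebra k P] [Algebra k L] [Algebra P L] [IsScalarTower k P L]
    (M : Submonoid P) [IsLocalization M L] (f : P)
    (hM : ∀ s ∈ M, ∀ g, f ∣ s * g → f ∣ g) :
    Nonempty (FractionRing (P ⧸ Ideal.span {f}) ≃ₐ[k]
      FractionRing (L ⧸ Ideal.span {algebraMap P L f})) := by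
  set I := Ideal.span {f} with hI
  set J := Ideal.span {algebraMap P L f} with hJ
  have hIJ : J = I.map (algebraMap P L) := by rw [hI, Ideal.map_span, Set.image_singleton]
  let N := M.map (Ideal.Quotient.mk I)
  let : Algebra (P ⧸ I) (L ⧸ J) :=
    (Ideal.quotientMap J (algebraMap P L) (hIJ ▸ Ideal.le_comap_map)).toAlgebra
  have : IsScalarTower k (P ⧸ I) (L ⧸ J) := .of_algebraMap_eq fun x ↦ by
    change Ideal.Quotient.mk J (algebraMap k L x) =
      Ideal.Quotient.mk J (algebraMap P L (algebraMap k P x))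
    rw [← IsScalarTower.algebraMap_apply]
  have : IsLocalization N (L ⧸ J) := by
    refine IsLocalization.of_surjective M L (Ideal.Quotient.mk I) Ideal.Quotient.mk_surjective
      (Ideal.Quotient.mk J) Ideal.Quotient.mk_surjective ?_ ?_
    · rfl
    · simp [Ideal.mk_ker, hIJ]
  have hN : N ≤ (P ⧸ I)⁰ := by
    rintro _ ⟨s, hs, rfl⟩
    rw [mem_nonZeroDivisors_iff_right]
    intro g hg
    obtain ⟨g, rfl⟩ := Ideal.Quotient.mk_surjective g
    rw [← map_mul, Ideal.Quotient.eq_zero_iff_mem, hI, Ideal.mem_span_singleton] at hg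
    rw [Ideal.Quotient.eq_zero_iff_mem, hI, Ideal.mem_span_singleton]
    exact hM s hs g (by rwa [mul_comm])
  let T := FractionRing (P ⧸ I)
  have hu : ∀ y : N, IsUnit (algebraMap (P ⧸ I) T y) := fun y ↦
    IsLocalization.map_units T (⟨y, hN y.2⟩ : (P ⧸ I)⁰)
  let : Algebra (L ⧸ J) T := (IsLocalization.lift hu).toAlgebra
  have : IsScalarTower (P ⧸ I) (L ⧸ J) T := .of_algebraMap_eq fun x ↦
    (IsLocalization.lift_eq hu x).symm
  have : IsScalarTower k (L ⧸ J) T := .of_algebraMap_eq fun x ↦ by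
    rw [IsScalarTower.algebraMap_apply k (P ⧸ I) T,
      IsScalarTower.algebraMap_apply k (P ⧸ I) (L ⧸ J),
      ← IsScalarTower.algebraMap_apply (P ⧸ I) (L ⧸ J) T]
  have : IsFractionRing (L ⧸ J) T := IsFractionRing.isFractionRing_of_isLocalization N _ T hN
  exact ⟨((FractionRing.algEquiv (L ⧸ J) T).restrictScalars k).symm⟩

theorem nonempty_fractionRing_quotient_of_associated {k P P' : Type*} [CommRing k] [CommRing P]
    [CommRing P'] [Algebra k P] [Algebra k P'] (e : P ≃ₐ[k] P') {f : P} {f' : P'}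
    (h : Associated (e f) f') :
    Nonempty (FractionRing (P ⧸ Ideal.span {f}) ≃ₐ[k] FractionRing (P' ⧸ Ideal.span {f'})) := by
  refine ⟨IsFractionRing.algEquivOfAlgEquiv
    (Ideal.quotientEquivAlg (Ideal.span {f}) (Ideal.span {f'}) e ?_)⟩
  change _ = Ideal.map (e : P →+* P') _
  rw [Ideal.map_span, Set.image_singleton]
  exact le_antisymm (Ideal.span_singleton_le_span_singleton.2 h.dvd)
    (Ideal.span_singleton_le_span_singleton.2 h.symm.dvd)

namespace MvPolynomial

/-- The involution `z ↦ q(y) / z` of the rational function field `k(y, z)` over `k(y)`. -/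
theorem exists_algEquiv_X_inr_eq_div {k n E : Type*} [Field k] [Field E]
    [Algebra (MvPolynomial (n ⊕ Unit) k) E] [IsFractionRing (MvPolynomial (n ⊕ Unit) k) E]
    [Algebra k E] [IsScalarTower k (MvPolynomial (n ⊕ Unit) k) E]
    (q : MvPolynomial n k) (hq : q ≠ 0) :
    ∃ τ : E ≃ₐ[k] E,
      (∀ p : MvPolynomial n k, τ (algebraMap (MvPolynomial (n ⊕ Unit) k) E (rename Sum.inl p)) =
        algebraMap (MvPolynomial (n ⊕ Unit) k) E (rename Sum.inl p)) ∧
      τ (algebraMap (MvPolynomial (n ⊕ Unit) k) E (X (Sum.inr ()))) =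
        algebraMap (MvPolynomial (n ⊕ Unit) k) E (rename Sum.inl q) /
          algebraMap (MvPolynomial (n ⊕ Unit) k) E (X (Sum.inr ())) := by
  set R := MvPolynomial (n ⊕ Unit) k
  set z : R := X (Sum.inr ())
  set Q : R := rename Sum.inl q
  have hQ : Q ≠ 0 := fun h ↦ hq (rename_injective _ Sum.inl_injective (by simpa using h))
  have hz : z ≠ 0 := X_ne_zero _
  let h : R := z * Q
  have hh : h ≠ 0 := mul_ne_zero hz hQ
  let L := Localization.Away h
  have hhL : IsUnit (algebraMap R L h) := IsLocalization.Away.algebraMap_isUnit h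
  have hzQ : IsUnit (algebraMap R L z) ∧ IsUnit (algebraMap R L Q) := by
    rwa [← IsUnit.mul_iff, ← map_mul]
  obtain ⟨zu, hzu⟩ := hzQ.1
  let τ₀ : R →ₐ[k] L := aeval (Sum.elim (fun i ↦ algebraMap R L (X (Sum.inl i)))
    (fun _ ↦ algebraMap R L Q * ↑zu⁻¹))
  have hτ₀p (p : MvPolynomial n k) : τ₀ (rename Sum.inl p) = algebraMap R L (rename Sum.inl p) := by
    have : τ₀.comp (rename Sum.inl) =
        (IsScalarTower.toAlgHom k R L).comp (rename Sum.inl) := by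
      ext i
      change τ₀ (rename Sum.inl (X i)) = algebraMap R L (rename Sum.inl (X i))
      rw [rename_X]
      exact aeval_X _ _
    exact DFunLike.congr_fun this p
  have hτ₀z : τ₀ z = algebraMap R L Q * ↑zu⁻¹ := aeval_X _ _
  have hτ₀h : IsUnit (τ₀ h) := by
    rw [map_mul, hτ₀z, hτ₀p]
    exact (hzQ.2.mul zu⁻¹.isUnit).mul hzQ.2
  have hpow : ∀ y : Submonoid.powers h, IsUnit (τ₀ y) := by
    rintro ⟨_, i, rfl⟩
    simpa using hτ₀h.pow i
  let τ₁ : L →ₐ[k] L := IsLocalization.liftAlgHom (M := Submonoid.powers h) (f := τ₀) hpow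
  have hτ₁ (x : R) : τ₁ (algebraMap R L x) = τ₀ x := by
    simp [τ₁]
  have hinv : τ₁.comp τ₁ = AlgHom.id k L := by
    have hz' : τ₁ (↑zu⁻¹ : L) * (algebraMap R L Q * ↑zu⁻¹) = 1 := by
      rw [← hτ₀z, ← hτ₁, ← hzu, ← map_mul, Units.inv_mul, map_one]
    refine IsLocalization.algHom_ext (Submonoid.powers h) ?_
    ext i
    rcases i with i | i
    · have := hτ₀p (X i)
      simp only [rename_X] at this
      change τ₁ (τ₁ (algebraMap R L (X (Sum.inl i)))) = algebraMap R L (X (Sum.inl i))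
      rw [hτ₁, this, hτ₁, this]
    · change τ₁ (τ₁ (algebraMap R L z)) = algebraMap R L z
      rw [hτ₁, hτ₀z, map_mul, hτ₁, hτ₀p]
      change algebraMap R L Q * τ₁ (↑zu⁻¹ : L) = _
      calc _ = (τ₁ (↑zu⁻¹ : L) * (algebraMap R L Q * ↑zu⁻¹)) * zu := by
            rw [mul_assoc, mul_assoc, Units.inv_mul, mul_one, mul_comm]
        _ = _ := by rw [hz', one_mul, hzu]
  let τ₂ : L ≃ₐ[k] L := AlgEquiv.ofAlgHom τ₁ τ₁ hinv hinv
  have hE : ∀ y : Submonoid.powers h, IsUnit (algebraMap R E y) := by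
    rintro ⟨_, i, rfl⟩
    simpa using! (pow_ne_zero i hh)
  let : Algebra L E := (IsLocalization.lift hE).toAlgebra
  have : IsScalarTower R L E := .of_algebraMap_eq fun x ↦ (IsLocalization.lift_eq hE x).symm
  have : IsScalarTower k L E := .of_algebraMap_eq fun x ↦ by
    rw [IsScalarTower.algebraMap_apply k R E, IsScalarTower.algebraMap_apply k R L,
      ← IsScalarTower.algebraMap_apply R L E]
  have : IsFractionRing L E :=
    IsFractionRing.isFractionRing_of_isDomain_of_isLocalization (Submonoid.powers h) L E
  have key (x : R) : IsFractionRing.algEquivOfAlgEquiv (K := E) (L := E) τ₂ (algebraMap R E x) =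
      algebraMap L E (τ₀ x) := by
    rw [IsScalarTower.algebraMap_apply R L E, IsFractionRing.algEquivOfAlgEquiv_algebraMap, ← hτ₁]
    rfl
  refine ⟨IsFractionRing.algEquivOfAlgEquiv τ₂, fun p ↦ ?_, ?_⟩
  · rw [key, hτ₀p, ← IsScalarTower.algebraMap_apply]
  · rw [key, hτ₀z, map_mul, ← IsScalarTower.algebraMap_apply, eq_div_iff (by simpa using hz),
      mul_assoc, IsScalarTower.algebraMap_apply R L E z, ← hzu, ← map_mul, Units.inv_mul, map_one,
      mul_one]

/-- The polynomial `xᵀ A x` in the variables `x`. -/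
noncomputable def quad {n S : Type*} [Fintype n] [CommRing S] (A : Matrix n n S) :
    MvPolynomial n S :=
  X ⬝ᵥ (A.map C).mulVec X

section quad

variable {n S T : Type*} [Fintype n] [CommRing S] [CommRing T]

theorem quad_eq_sum (A : Matrix n n S) : quad A = ∑ i, ∑ j, C (A i j) * X i * X j := by
  simp only [quad, dotProduct, Matrix.mulVec, Finset.mul_sum, Matrix.map_apply]
  exact Finset.sum_congr rfl fun i _ ↦ Finset.sum_congr rfl fun j _ ↦ by ring

theorem eval₂_quad (f : S →+* T) (v : n → T) (A : Matrix n n S) :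
    eval₂ f v (quad A) = v ⬝ᵥ (A.map f).mulVec v := by
  simp [quad_eq_sum, eval₂_sum, dotProduct, Matrix.mulVec, Finset.mul_sum, mul_comm, mul_left_comm]

theorem map_quad (f : S →+* T) (A : Matrix n n S) : map f (quad A) = quad (A.map f) := by
  simp [quad_eq_sum]

theorem quad_smul (a : S) (A : Matrix n n S) : quad (a • A) = C a * quad A := by
  simp [quad_eq_sum, Finset.mul_sum, mul_assoc]

/-- The linear change of variables `x ↦ Gᵀ x`. -/
noncomputable def linSubst (G : Matrix n n S) : MvPolynomial n S →ₐ[S] MvPolynomial n S :=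
  aeval (Matrix.vecMul X (G.map C))

theorem linSubst_quad (G A : Matrix n n S) :
    linSubst G (quad A) = quad (G * A * G.transpose) := by
  rw [linSubst, aeval_def, eval₂_quad, quad, ← Matrix.dotProduct_mulVec, algebraMap_eq]
  simp [Matrix.map_mul, ← Matrix.mulVec_mulVec, Matrix.transpose_map,
    Matrix.mulVec_transpose]

theorem linSubst_comp [DecidableEq n] {G H : Matrix n n S} (h : G * H = 1) :
    (linSubst G).comp (linSubst H) = AlgHom.id S _ := by
  ext1 i
  have hv : (linSubst G) ∘ Matrix.vecMul X (H.map C) = X := by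
    have : (linSubst G) ∘ Matrix.vecMul X (H.map C) =
        Matrix.vecMul (Matrix.vecMul X (G.map C)) (H.map C) := by
      ext1 i
      simp [linSubst, Matrix.vecMul, dotProduct]
    rw [this, Matrix.vecMul_vecMul, ← Matrix.map_mul, h,
      Matrix.map_one _ C_0 C_1, Matrix.vecMul_one]
  simpa [linSubst] using congrFun hv i

end quad

theorem dvd_of_dvd_C_mul {n k R : Type*} [Fintype n] [Field k] [CommRing R] [IsDomain R]
    [UniqueFactorizationMonoid R] [Algebra k R] (A : Matrix n n k) (v : n → k)
    (hv : v ⬝ᵥ A.mulVec v ≠ 0) (d s : R) (hs : s ≠ 0) (g : MvPolynomial n R)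
    (h : quad (A.map (algebraMap k R)) - C d ∣ C s * g) :
    quad (A.map (algebraMap k R)) - C d ∣ g := by
  refine IsRelPrime.dvd_of_dvd_mul_left (fun p hp hps ↦ ?_) h
  obtain ⟨r, -, rfl⟩ := (dvd_C_iff_exists hs).1 hps
  have h0 := map_dvd (eval (0 : n → R)) hp
  have h1 := map_dvd (eval (algebraMap k R ∘ v)) hp
  simp only [eval, coe_eval₂Hom, eval₂_sub, eval₂_quad, eval₂_C] at h0 h1
  have h2 := dvd_sub h1 h0
  have h3 : (algebraMap k R ∘ v) ⬝ᵥ (A.map (algebraMap k R)).mulVec (algebraMap k R ∘ v) =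
      algebraMap k R (v ⬝ᵥ A.mulVec v) := by
    simp [RingHom.map_dotProduct, RingHom.map_mulVec, Function.comp_def]
  have hu : IsUnit (algebraMap k R (v ⬝ᵥ A.mulVec v)) := hv.isUnit.map _
  have h4 : r ∣ algebraMap k R (v ⬝ᵥ A.mulVec v) := by
    simpa [h3] using h2
  exact (isUnit_of_dvd_unit h4 hu).map C

end MvPolynomial

theorem Matrix.exists_dotProduct_mulVec_ne_zero {n k : Type*} [Fintype n] [DecidableEq n] [Field k]
    [CharZero k] {A : Matrix n n k} (hA : A.IsSymm) (h0 : A ≠ 0) : ∃ v, v ⬝ᵥ A.mulVec v ≠ 0 := by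
  by_contra! h
  refine h0 (Matrix.ext fun i j ↦ ?_)
  have h1 := h (Pi.single i 1 + Pi.single j 1)
  have h2 := h (Pi.single i 1)
  have h3 := h (Pi.single j 1)
  have h4 := hA.apply i j
  simp only [Matrix.mulVec_add, Matrix.mulVec_single_one, dotProduct_add, add_dotProduct,
    single_one_dotProduct, Matrix.col_apply] at h1 h2 h3
  rw [h2, h3, h4] at h1
  simpa using h1

theorem nonempty_fractionRing_quotient_quad_sub_C {n k R E : Type*} [Fintype n] [Field k]
    [CommRing R] [IsDomain R] [UniqueFactorizationMonoid R] [Algebra k R] [Field E] [Algebra R E] [IsFractionRing R E]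
    [Algebra k E] [IsScalarTower k R E] (A : Matrix n n k) (hA : ∃ v, v ⬝ᵥ A.mulVec v ≠ 0)
    (d : R) :
    Nonempty (FractionRing (MvPolynomial n R ⧸
        Ideal.span {quad (A.map (algebraMap k R)) - C d}) ≃ₐ[k]
      FractionRing (MvPolynomial n E ⧸
        Ideal.span {quad (A.map (algebraMap k E)) - C (algebraMap R E d)})) := by
  obtain ⟨v, hv⟩ := hA
  let : Algebra (MvPolynomial n R) (MvPolynomial n E) := algebraMvPolynomial
  have : IsScalarTower k (MvPolynomial n R) (MvPolynomial n E) := .of_algebraMap_eq fun x ↦ by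
    rw [algebraMap_def, MvPolynomial.algebraMap_apply, MvPolynomial.algebraMap_apply, map_C,
      IsScalarTower.algebraMap_apply k R E]
  have h := nonempty_fractionRing_quotient_algEquiv_s8 k (L := MvPolynomial n E)
    (R⁰.map (C : R →+* MvPolynomial n R)) (quad (A.map (algebraMap k R)) - C d) (by
      rintro _ ⟨s, hs, rfl⟩ g hg
      exact dvd_of_dvd_C_mul A v hv d s (nonZeroDivisors.ne_zero hs) g hg)
  have e : algebraMap (MvPolynomial n R) (MvPolynomial n E) (quad (A.map (algebraMap k R)) - C d) =
      quad (A.map (algebraMap k E)) - C (algebraMap R E d) := by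
    rw [algebraMap_def, map_sub, map_quad, map_C, Matrix.map_map, ← RingHom.coe_comp,
      ← IsScalarTower.algebraMap_eq]
  rwa [e] at h

/-- For `A` strongly multiplicative with `A`-form `φ`, the quadrics `φ(x) = b φ(y) + c z²` and
`φ(x) = c φ(y) + b z²` have isomorphic function fields. -/
theorem nonempty_fractionRing_quotient_swap {n k K E : Type*} [Fintype n] [DecidableEq n]
    [Field k] [Field K] [Algebra (MvPolynomial n k) K] [IsFractionRing (MvPolynomial n k) K]
    [Algebra k K] [IsScalarTower k (MvPolynomial n k) K]
    [Field E] [Algebra (MvPolynomial (n ⊕ Unit) k) E] [IsFractionRing (MvPolynomial (n ⊕ Unit) k) E]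
    [Algebra k E] [IsScalarTower k (MvPolynomial (n ⊕ Unit) k) E]
    (A : Matrix n n k) (hA : ∃ v, v ⬝ᵥ A.mulVec v ≠ 0)
    (hmult : ∃ D : Matrix n n K, IsUnit D.det ∧
      D * A.map (algebraMap k _) * D.transpose =
        algebraMap (MvPolynomial n k) K (quad A) • A.map (algebraMap k _))
    (b c : k) :
    Nonempty (FractionRing (MvPolynomial n (MvPolynomial (n ⊕ Unit) k) ⧸
        Ideal.span {quad (A.map (algebraMap k (MvPolynomial (n ⊕ Unit) k))) -
          C (C b * rename Sum.inl (quad A) + C c * X (Sum.inr ()) ^ 2)}) ≃ₐ[k]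
      FractionRing (MvPolynomial n (MvPolynomial (n ⊕ Unit) k) ⧸
        Ideal.span {quad (A.map (algebraMap k (MvPolynomial (n ⊕ Unit) k))) -
          C (C c * rename Sum.inl (quad A) + C b * X (Sum.inr ()) ^ 2)})) := by
  have hq : quad A ≠ 0 := by
    obtain ⟨v, hv⟩ := hA
    intro h
    exact hv (by simpa [h] using (eval₂_quad (RingHom.id k) v A).symm)
  obtain ⟨τ, hτ, hτz⟩ := exists_algEquiv_X_inr_eq_div (E := E) (quad A) hq
  obtain ⟨D, hD, hDA⟩ := hmult
  have hinj : Function.Injective ((IsScalarTower.toAlgHom k (MvPolynomial (n ⊕ Unit) k) E).comp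
      (rename (Sum.inl : n → n ⊕ Unit))) :=
    (IsFractionRing.injective (MvPolynomial (n ⊕ Unit) k) E).comp
      (rename_injective _ Sum.inl_injective)
  let ι : K →ₐ[k] E := IsFractionRing.liftAlgHom hinj
  have hι (p : MvPolynomial n k) : ι (algebraMap _ _ p) =
      algebraMap (MvPolynomial (n ⊕ Unit) k) E (rename Sum.inl p) :=
    IsFractionRing.lift_algebraMap hinj p
  set q : E := algebraMap (MvPolynomial (n ⊕ Unit) k) E (rename Sum.inl (quad A)) with hqdef
  have hτq : τ q = q := hτ _
  set z : E := algebraMap (MvPolynomial (n ⊕ Unit) k) E (X (Sum.inr ())) with hzdef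
  have hq0 : q ≠ 0 := by
    rw [hqdef, ← hι, map_ne_zero]
    simpa using hq
  have hz0 : z ≠ 0 := by simp [hzdef]
  have hAι : (A.map (algebraMap k K)).map ι =
      A.map (algebraMap k E) := by
    ext i j
    simp
  have hιDA : D.map ι * A.map (algebraMap k E) * (D.map ι).transpose =
      q • A.map (algebraMap k E) := by
    have h := congrArg (fun M ↦ M.map ι) hDA
    simp only [Matrix.map_mul, hAι, Matrix.transpose_map] at h
    rw [h]
    ext i j
    rw [Matrix.map_apply, Matrix.smul_apply, smul_eq_mul, map_mul, hι, Matrix.map_apply,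
      AlgHom.commutes, Matrix.smul_apply, smul_eq_mul, Matrix.map_apply]
  have hιD : D.map ι * D⁻¹.map ι = 1 := by
    rw [← Matrix.map_mul, Matrix.mul_nonsing_inv _ hD]
    simp
  let G := z⁻¹ • D.map ι
  let H := z • D⁻¹.map ι
  have hGH : G * H = 1 := by simp [G, H, hιD, smul_smul, hz0]
  let g : MvPolynomial n E ≃ₐ[E] MvPolynomial n E :=
    AlgEquiv.ofAlgHom (linSubst G) (linSubst H) (linSubst_comp hGH)
      (linSubst_comp (mul_eq_one_comm.1 hGH))
  let σ : MvPolynomial n E ≃ₐ[k] MvPolynomial n E := (mapAlgEquiv n τ).trans (g.restrictScalars k)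
  have hGA : G * A.map (algebraMap k E) * G.transpose = (q / z ^ 2) • A.map (algebraMap k E) := by
    simp only [G, Matrix.transpose_smul, Matrix.smul_mul, Matrix.mul_smul, hιDA, smul_smul]
    congr 1
    field_simp
  have hAτ : (A.map (algebraMap k E)).map τ = A.map (algebraMap k E) := by
    ext i j
    simp
  have hC (a : k) : algebraMap (MvPolynomial (n ⊕ Unit) k) E (C a) = algebraMap k E a := by
    rw [IsScalarTower.algebraMap_apply k (MvPolynomial (n ⊕ Unit) k) E]
    rfl
  have hσ : σ (quad (A.map (algebraMap k E)) -
        C (algebraMap _ E (C b * rename Sum.inl (quad A) + C c * X (Sum.inr ()) ^ 2))) =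
      (quad (A.map (algebraMap k E)) -
        C (algebraMap _ E (C c * rename Sum.inl (quad A) + C b * X (Sum.inr ()) ^ 2))) *
          C (q / z ^ 2) := by
    change linSubst G (map (τ : E →+* E) _) = _
    rw [map_sub, map_quad, map_C, map_sub, linSubst_quad]
    have : (A.map (algebraMap k E)).map (τ : E →+* E) = A.map (algebraMap k E) := hAτ
    rw [this, hGA, quad_smul, sub_mul, mul_comm (C _)]
    congr 1
    rw [← C_mul, ← algebraMap_eq, AlgHom.commutes]
    congr 1
    simp only [map_add, map_mul, map_pow, hC, RingHom.coe_coe, AlgEquiv.commutes, ← hqdef,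
      ← hzdef, hτz, hτq]
    field_simp
    ring
  obtain ⟨e₁⟩ := nonempty_fractionRing_quotient_quad_sub_C (E := E) A hA
    (C b * rename Sum.inl (quad A) + C c * X (Sum.inr ()) ^ 2)
  obtain ⟨e₂⟩ := nonempty_fractionRing_quotient_quad_sub_C (E := E) A hA
    (C c * rename Sum.inl (quad A) + C b * X (Sum.inr ()) ^ 2)
  have hu : IsUnit (C (q / z ^ 2) : MvPolynomial n E) :=
    (div_ne_zero hq0 (pow_ne_zero 2 hz0)).isUnit.map C
  obtain ⟨e⟩ := nonempty_fractionRing_quotient_of_associated σ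
    (hσ ▸ associated_mul_unit_left _ _ hu)
  exact ⟨(e₁.trans e).trans e₂.symm⟩

/-- Let `k` be a field of characteristic 0 and `φ` a
nondegenerate quadratic form on `k^m` (`m ≥ 1`), given by a symmetric Gram
matrix `A` with `det A ≠ 0`, which is strongly multiplicative: over
`K = k(t₁,…,t_m)` the form `φ_K` is isometric to `φ(t₁,…,t_m)·φ_K`.  Then for
all `b, c ∈ kˣ` the forms `φ ⊥ ⟨−b⟩φ ⊥ ⟨−c⟩ : (x,y,z) ↦ φ(x) − b·φ(y) − c·z²`
and `φ ⊥ ⟨−c⟩φ ⊥ ⟨−b⟩ : (x,y,z) ↦ φ(x) − c·φ(y) − b·z²` are birationally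
equivalent. -/
theorem strongly_multiplicative_interchange_birational
    (k : Type*) [Field k] [CharZero k] (m : ℕ) (hm : 1 ≤ m)
    -- φ is given by a symmetric nondegenerate Gram matrix A, φ(x) = xᵀ A x
    (A : Matrix (Fin m) (Fin m) k) (hsymm : A.IsSymm) (hnondeg : A.det ≠ 0)
    -- φ is strongly multiplicative: over K = k(t₁,…,t_m), φ_K ≅ φ(t)·φ_K
    (t : Fin m → FractionRing (MvPolynomial (Fin m) k))
    (ht : ∀ i, t i = algebraMap (MvPolynomial (Fin m) k)
        (FractionRing (MvPolynomial (Fin m) k)) (MvPolynomial.X i))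
    (hmult : ∃ Cm : Matrix (Fin m) (Fin m) (FractionRing (MvPolynomial (Fin m) k)),
        IsUnit Cm.det ∧
        Cm * A.map (algebraMap k (FractionRing (MvPolynomial (Fin m) k))) * Cm.transpose =
          (∑ i : Fin m, ∑ j : Fin m,
            algebraMap k (FractionRing (MvPolynomial (Fin m) k)) (A i j) * t i * t j) •
            A.map (algebraMap k (FractionRing (MvPolynomial (Fin m) k))))
    (b c : k) (hb : b ≠ 0) (hc : c ≠ 0)
    (Ψ₁ Ψ₂ : MvPolynomial (Fin m ⊕ Fin m ⊕ Unit) k)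
    (hΨ₁ : Ψ₁ = (∑ i : Fin m, ∑ j : Fin m,
          MvPolynomial.C (A i j) * X (Sum.inl i) * X (Sum.inl j))
        - MvPolynomial.C b * (∑ i : Fin m, ∑ j : Fin m,
          MvPolynomial.C (A i j) * X (Sum.inr (Sum.inl i)) * X (Sum.inr (Sum.inl j)))
        - MvPolynomial.C c * X (Sum.inr (Sum.inr ())) ^ 2)
    (hΨ₂ : Ψ₂ = (∑ i : Fin m, ∑ j : Fin m,
          MvPolynomial.C (A i j) * X (Sum.inl i) * X (Sum.inl j))
        - MvPolynomial.C c * (∑ i : Fin m, ∑ j : Fin m,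
          MvPolynomial.C (A i j) * X (Sum.inr (Sum.inl i)) * X (Sum.inr (Sum.inl j)))
        - MvPolynomial.C b * X (Sum.inr (Sum.inr ())) ^ 2) :
    BirationallyEquivalent k Ψ₁ Ψ₂ := by
  have hA0 : A ≠ 0 := by
    rintro rfl
    have : Nonempty (Fin m) := ⟨⟨0, hm⟩⟩
    exact hnondeg Matrix.det_zero
  have hA := Matrix.exists_dotProduct_mulVec_ne_zero hsymm hA0
  have hm' : ∃ D : Matrix (Fin m) (Fin m) (FractionRing (MvPolynomial (Fin m) k)), IsUnit D.det ∧
      D * A.map (algebraMap k _) * D.transpose =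
        algebraMap _ (FractionRing (MvPolynomial (Fin m) k)) (quad A) •
          A.map (algebraMap k _) := by
    obtain ⟨D, hD, h⟩ := hmult
    refine ⟨D, hD, h.trans ?_⟩
    congr 1
    simp only [quad_eq_sum, map_sum, map_mul, ht]
    rfl
  obtain ⟨e⟩ := nonempty_fractionRing_quotient_swap
    (E := FractionRing (MvPolynomial (Fin m ⊕ Unit) k)) A hA hm' b c
  have key (b c : k) : sumAlgEquiv k (Fin m) (Fin m ⊕ Unit)
      ((∑ i : Fin m, ∑ j : Fin m, MvPolynomial.C (A i j) * X (Sum.inl i) * X (Sum.inl j))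
        - MvPolynomial.C b * (∑ i : Fin m, ∑ j : Fin m,
          MvPolynomial.C (A i j) * X (Sum.inr (Sum.inl i)) * X (Sum.inr (Sum.inl j)))
        - MvPolynomial.C c * X (Sum.inr (Sum.inr ())) ^ 2) =
      quad (A.map (algebraMap k (MvPolynomial (Fin m ⊕ Unit) k))) -
          C (C b * rename Sum.inl (quad A) + C c * X (Sum.inr ()) ^ 2) := by
    simp only [quad_eq_sum, map_sub, map_sum, map_mul, map_pow, map_add, rename_X, rename_C,
      sumAlgEquiv_C_inl, sumAlgEquiv_X_inl, sumAlgEquiv_X_inr, Matrix.map_apply, algebraMap_eq]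
    ring
  obtain ⟨e₁⟩ := nonempty_fractionRing_quotient_of_associated
    (sumAlgEquiv k (Fin m) (Fin m ⊕ Unit)) (Associated.of_eq (hΨ₁ ▸ key b c))
  obtain ⟨e₂⟩ := nonempty_fractionRing_quotient_of_associated
    (sumAlgEquiv k (Fin m) (Fin m ⊕ Unit)) (Associated.of_eq (hΨ₂ ▸ key c b))
  exact ⟨(e₁.trans e).trans e₂.symm⟩
end

section
/- Let k be a field of characteristic 0 and let φ be a nondegenerate quadratic form on k^m (m ≥ 1) that is strongly multiplicative, meaning: over the rational function field K = k(t₁,…,t_m) in m variables, the extended form φ_K is isometric to the scaled form φ(t₁,…,t_m)·φ_K. Let b ∈ kˣ and let x₀ ∈ k^m with φ(x₀) ≠ 0. Then the quadratic forms φ ⊥ ⟨−b⟩, given by (x, z) ↦ φ(x) − b·z² on k^m × k, and φ ⊥ ⟨−b·φ(x₀)⟩, given by (x, z) ↦ φ(x) − b·φ(x₀)·z², are birationally equivalent. -/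
open MvPolynomial

namespace Matrix

variable {n R S : Type*} [Fintype n] [CommRing R] [CommRing S]

lemma sum_sum_mul_eq_dotProduct_mulVec (A : Matrix n n R) (x : n → R) :
    ∑ i, ∑ j, A i j * x i * x j = x ⬝ᵥ A *ᵥ x := by
  simp only [dotProduct, mulVec, Finset.mul_sum]
  exact Finset.sum_congr rfl fun i _ => Finset.sum_congr rfl fun j _ => by ring

lemma IsSymm.dotProduct_mulVec_comm {A : Matrix n n R} (hA : A.IsSymm) (x y : n → R) :
    x ⬝ᵥ A *ᵥ y = y ⬝ᵥ A *ᵥ x := by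
  rw [dotProduct_mulVec, dotProduct_comm, ← mulVec_transpose, hA.eq]

lemma dotProduct_mulVec_vecMul (A M : Matrix n n R) (x : n → R) :
    (x ᵥ* M) ⬝ᵥ A *ᵥ (x ᵥ* M) = x ⬝ᵥ (M * A * Mᵀ) *ᵥ x := by
  rw [← mulVec_transpose M x, mulVec_mulVec, dotProduct_mulVec, mulVec_transpose,
    vecMul_vecMul, ← dotProduct_mulVec, Matrix.mul_assoc]

/-- The reflection of `x` along `v` with respect to the Gram matrix `A`, multiplied by the value
of the form at `v` so that no denominators occur. -/
def scaledReflection (A : Matrix n n R) (v x : n → R) : n → R :=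
  (v ⬝ᵥ A *ᵥ v) • x - (2 * (x ⬝ᵥ A *ᵥ v)) • v

lemma map_scaledReflection (f : R →+* S) (A : Matrix n n R) (v x : n → R) (i : n) :
    f (scaledReflection A v x i) = scaledReflection (A.map f) (f ∘ v) (f ∘ x) i := by
  have h : ∀ y : n → R, f ∘ (A *ᵥ y) = A.map f *ᵥ (f ∘ y) := fun y =>
    funext fun j => RingHom.map_mulVec f A y j
  simp [scaledReflection, RingHom.map_dotProduct, h, map_ofNat]

lemma IsSymm.scaledReflection_dotProduct_mulVec {A : Matrix n n R} (hA : A.IsSymm)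
    (v x : n → R) :
    scaledReflection A v x ⬝ᵥ A *ᵥ scaledReflection A v x =
      (v ⬝ᵥ A *ᵥ v) ^ 2 * (x ⬝ᵥ A *ᵥ x) := by
  simp only [scaledReflection, mulVec_sub, mulVec_smul, dotProduct_sub, sub_dotProduct,
    dotProduct_smul, smul_dotProduct, smul_eq_mul, hA.dotProduct_mulVec_comm v x]
  ring

lemma scaledReflection_smul (A : Matrix n n R) (r : R) (v x : n → R) :
    scaledReflection A (r • v) x = r ^ 2 • scaledReflection A v x := by
  ext i
  simp only [scaledReflection, mulVec_smul, dotProduct_smul, smul_dotProduct, smul_eq_mul,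
    Pi.sub_apply, Pi.smul_apply]
  ring

/-- Over an algebraically closed field every anisotropic vector is a scaled reflection of a given
anisotropic vector. -/
lemma IsSymm.exists_scaledReflection_eq {F : Type*} [Field F] [IsAlgClosed F] [CharZero F]
    {A : Matrix n n F} (hA : A.IsSymm) {x y : n → F} (hx : x ⬝ᵥ A *ᵥ x ≠ 0)
    (hy : y ⬝ᵥ A *ᵥ y ≠ 0) : ∃ v, scaledReflection A v x = y := by
  obtain ⟨μ, hμ, hα⟩ : ∃ μ : F, μ ^ 2 * (x ⬝ᵥ A *ᵥ x) = y ⬝ᵥ A *ᵥ y ∧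
      μ * (x ⬝ᵥ A *ᵥ x) - x ⬝ᵥ A *ᵥ y ≠ 0 := by
    obtain ⟨μ, hμ⟩ := IsAlgClosed.exists_pow_nat_eq
      ((y ⬝ᵥ A *ᵥ y) / (x ⬝ᵥ A *ᵥ x)) (n := 2) two_pos
    have hμ' : μ ^ 2 * (x ⬝ᵥ A *ᵥ x) = y ⬝ᵥ A *ᵥ y := by rw [hμ]; field_simp
    by_cases h : μ * (x ⬝ᵥ A *ᵥ x) - x ⬝ᵥ A *ᵥ y = 0
    · refine ⟨-μ, by rw [neg_sq, hμ'], fun h' => hy ?_⟩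
      have h2 : 2 * (μ * (x ⬝ᵥ A *ᵥ x)) = 0 := by linear_combination h - h'
      have h0 : μ * (x ⬝ᵥ A *ᵥ x) = 0 := by simpa using h2
      rw [← hμ']
      linear_combination μ * h0
    · exact ⟨μ, hμ', h⟩
  set α := 2 * (μ * (x ⬝ᵥ A *ᵥ x) - x ⬝ᵥ A *ᵥ y)
  have hα0 : α ≠ 0 := mul_ne_zero two_ne_zero hα
  obtain ⟨β, hβ⟩ := IsAlgClosed.exists_pow_nat_eq α (n := 2) two_pos
  have key : scaledReflection A (μ • x - y) x = α • y := by
    ext i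
    simp only [scaledReflection, mulVec_sub, mulVec_smul, dotProduct_sub, sub_dotProduct,
      dotProduct_smul, smul_dotProduct, smul_eq_mul, hA.dotProduct_mulVec_comm y x,
      Pi.sub_apply, Pi.smul_apply, α]
    linear_combination (-x i) * hμ
  refine ⟨β⁻¹ • (μ • x - y), ?_⟩
  rw [scaledReflection_smul, key, smul_smul, inv_pow, hβ, inv_mul_cancel₀ hα0, one_smul]

/-- The scaled reflections of an anisotropic vector are Zariski dense. -/
lemma IsSymm.exists_eval_scaledReflection_ne_zero {k : Type*} [Field k] [CharZero k]
    {A : Matrix n n k} (hA : A.IsSymm) {x : n → k} (hx : x ⬝ᵥ A *ᵥ x ≠ 0)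
    {D : MvPolynomial n k} (hD : D ≠ 0) :
    ∃ v, eval (scaledReflection A v x) D ≠ 0 ∧ v ⬝ᵥ A *ᵥ v ≠ 0 := by
  let φ : MvPolynomial n k := X ⬝ᵥ A.map C *ᵥ X
  have hφ {F : Type _} [Field F] (g : k →+* F) (y : n → F) :
      eval₂ g y φ = y ⬝ᵥ A.map g *ᵥ y := by
    simp [φ, dotProduct, mulVec, eval₂_sum, eval₂_mul]
  have hφ0 : φ ≠ 0 := fun h => hx (by simpa [h] using (hφ (RingHom.id k) x).symm)
  let P : n → MvPolynomial n k := scaledReflection (A.map C) X (C ∘ x)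
  have hP {F : Type _} [Field F] (g : k →+* F) (v : n → F) :
      (fun i => eval₂ g v (P i)) = scaledReflection (A.map g) v (g ∘ x) := by
    ext i
    have := map_scaledReflection (eval₂Hom g v) (A.map C) X (C ∘ x) i
    simp only [coe_eval₂Hom] at this
    rw [this]
    congr 1 <;> ext <;> simp
  have hcomp {F : Type _} [Field F] (g : k →+* F) (v : n → F) :
      eval₂ g v (bind₁ P (D * φ)) =
        eval₂ g (scaledReflection (A.map g) v (g ∘ x)) (D * φ) := by
    rw [← hP]
    exact eval₂Hom_bind₁ g v P (D * φ)
  have hne : bind₁ P (D * φ) ≠ 0 := by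
    intro h0
    let g := algebraMap k (AlgebraicClosure k)
    have hmap : MvPolynomial.map g (D * φ) ≠ 0 := by
      rw [Ne, map_eq_zero_iff _ (MvPolynomial.map_injective g g.injective)]
      exact mul_ne_zero hD hφ0
    obtain ⟨y, hy⟩ : ∃ y, eval y (MvPolynomial.map g (D * φ)) ≠ 0 := by
      by_contra! h
      exact hmap (MvPolynomial.funext fun y => by rw [h y, map_zero])
    rw [eval_map] at hy
    have hyφ : y ⬝ᵥ A.map g *ᵥ y ≠ 0 := by
      rw [← hφ]
      rw [eval₂_mul] at hy
      exact right_ne_zero_of_mul hy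
    have hxg : (g ∘ x) ⬝ᵥ A.map g *ᵥ (g ∘ x) ≠ 0 := by
      have : g (x ⬝ᵥ A *ᵥ x) = (g ∘ x) ⬝ᵥ A.map g *ᵥ (g ∘ x) := by
        simp [dotProduct, mulVec]
      rw [← this]
      exact (map_ne_zero g).2 hx
    obtain ⟨v, hv⟩ := (hA.map g).exists_scaledReflection_eq hxg hyφ
    apply hy
    rw [← hv, ← hcomp, h0, eval₂_zero]
  obtain ⟨v, hv⟩ : ∃ v, eval v (bind₁ P (D * φ)) ≠ 0 := by
    by_contra! h
    exact hne (MvPolynomial.funext fun y => by rw [h y, map_zero])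
  have hv' := hcomp (RingHom.id k) v
  have hmapid : A.map (RingHom.id k) = A := by ext; simp
  rw [eval₂_mul, hφ, hmapid] at hv'
  change eval v (bind₁ P (D * φ)) = eval (scaledReflection A v x) D * _ at hv'
  change _ = _ * (scaledReflection A v x ⬝ᵥ A *ᵥ scaledReflection A v x) at hv'
  rw [hv', hA.scaledReflection_dotProduct_mulVec] at hv
  exact ⟨v, left_ne_zero_of_mul hv,
    (pow_ne_zero_iff two_ne_zero).1 (left_ne_zero_of_mul (right_ne_zero_of_mul hv))⟩

/-- Substitution principle: if the Gram matrix `A` is generically similar to itself with factor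
its own generic value, then every nonzero value of the form over `k` is a similarity factor. -/
lemma IsSymm.exists_similitude_of_generic {k : Type*} [Field k] [CharZero k]
    {A : Matrix n n k} (hA : A.IsSymm) {x : n → k} (hx : x ⬝ᵥ A *ᵥ x ≠ 0)
    {K : Type*} [Field K] [Algebra (MvPolynomial n k) K] [IsFractionRing (MvPolynomial n k) K]
    (N : Matrix n n K)
    (hN : N * (A.map C).map (algebraMap (MvPolynomial n k) K) * Nᵀ =
      algebraMap (MvPolynomial n k) K (X ⬝ᵥ A.map C *ᵥ X) •
        (A.map C).map (algebraMap (MvPolynomial n k) K)) :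
    ∃ M : Matrix n n k, M * A * Mᵀ = (x ⬝ᵥ A *ᵥ x) • A := by
  let ι := algebraMap (MvPolynomial n k) K
  have hι : Function.Injective ι := IsFractionRing.injective _ _
  obtain ⟨d, hd⟩ := IsLocalization.exist_integer_multiples_of_finite
    (nonZeroDivisors (MvPolynomial n k)) (fun p : n × n => N p.1 p.2)
  choose Q hQ using hd
  let N' : Matrix n n (MvPolynomial n k) := fun i j => Q (i, j)
  have hN' : N'.map ι = ι d • N := by
    ext i j
    simpa [Algebra.smul_def] using hQ (i, j)
  have hpoly : N' * A.map C * N'ᵀ =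
      ((d : MvPolynomial n k) ^ 2 * (X ⬝ᵥ A.map C *ᵥ X)) • A.map C := by
    apply Matrix.map_injective hι
    beta_reduce
    rw [Matrix.map_mul, Matrix.map_mul, transpose_map, hN']
    simp only [transpose_smul, smul_mul, Matrix.mul_smul]
    rw [hN, smul_smul, smul_smul]
    ext i j
    simp [ι, pow_two, mul_assoc]
  obtain ⟨v, hdv, hv⟩ := hA.exists_eval_scaledReflection_ne_zero hx
    (nonZeroDivisors.ne_zero d.2)
  set y := scaledReflection A v x with hy
  have hAC : (A.map C).map (eval y) = A := by ext; simp
  have hev := congrArg (fun B => B.map (eval y)) hpoly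
  have hX : eval y (X ⬝ᵥ A.map C *ᵥ X) = y ⬝ᵥ A *ᵥ y := by
    simp [dotProduct, mulVec]
  have hev' : N'.map (eval y) * A * (N'.map (eval y))ᵀ =
      (eval y d ^ 2 * (y ⬝ᵥ A *ᵥ y)) • A := by
    simp only [Matrix.map_mul, transpose_map, hAC] at hev
    rw [hev]
    ext i j
    simp [hX]
  rw [hy, hA.scaledReflection_dotProduct_mulVec, ← hy] at hev'
  refine ⟨(eval y d * (v ⬝ᵥ A *ᵥ v))⁻¹ • N'.map (eval y), ?_⟩
  simp only [transpose_smul, smul_mul, Matrix.mul_smul]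
  rw [hev', smul_smul, smul_smul]
  congr 1
  field_simp

end Matrix

namespace MvPolynomial

open Matrix

variable {k n : Type*} (τ : Type*) [CommRing k] [Fintype n]

/-- Linear substitution of the variables in the left summand. -/
noncomputable def linearSubstInl (M : Matrix n n k) :
    MvPolynomial (n ⊕ τ) k →ₐ[k] MvPolynomial (n ⊕ τ) k :=
  aeval (Sum.elim ((X ∘ Sum.inl) ᵥ* M.map C) (X ∘ Sum.inr))

lemma linearSubstInl_comp_X_inl (M : Matrix n n k) :
    (linearSubstInl τ M : MvPolynomial (n ⊕ τ) k → MvPolynomial (n ⊕ τ) k) ∘ X ∘ Sum.inl =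
      (X ∘ Sum.inl) ᵥ* M.map C := by
  ext1 i
  simp [linearSubstInl]

lemma linearSubstInl_X_inr (M : Matrix n n k) (u : τ) :
    linearSubstInl τ M (X (Sum.inr u)) = X (Sum.inr u) := by
  simp [linearSubstInl]

lemma linearSubstInl_comp [DecidableEq n] {M N : Matrix n n k} (h : M * N = 1) :
    (linearSubstInl τ M).comp (linearSubstInl τ N) = AlgHom.id k _ := by
  refine algHom_ext fun i => ?_
  rcases i with i | u
  · have hN := congrFun (linearSubstInl_comp_X_inl τ N) i
    have hM := linearSubstInl_comp_X_inl τ M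
    simp only [Function.comp_apply] at hN
    have hMN : M.map C * N.map C = (1 : Matrix n n (MvPolynomial (n ⊕ τ) k)) := by
      rw [← Matrix.map_mul, h, Matrix.map_one _ C_0 C_1]
    calc linearSubstInl τ M (linearSubstInl τ N (X (Sum.inl i)))
        = ((linearSubstInl τ M ∘ X ∘ Sum.inl) ᵥ* N.map C) i := by
          rw [hN]
          simp [Matrix.vecMul, dotProduct, algHom_C, algebraMap_eq]
      _ = X (Sum.inl i) := by
          rw [hM, Matrix.vecMul_vecMul, hMN, Matrix.vecMul_one, Function.comp_apply]
  · simp [linearSubstInl_X_inr]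

end MvPolynomial

lemma BirationallyEquivalent.symm {k : Type*} [Field k] {ι ι' : Type*}
    {Ψ : MvPolynomial ι k} {Ψ' : MvPolynomial ι' k} (h : BirationallyEquivalent k Ψ Ψ') :
    BirationallyEquivalent k Ψ' Ψ :=
  h.map AlgEquiv.symm

lemma BirationallyEquivalent.of_algEquiv {k : Type*} [Field k] {ι ι' : Type*}
    {Ψ : MvPolynomial ι k} {Ψ' : MvPolynomial ι' k}
    (e : MvPolynomial ι k ≃ₐ[k] MvPolynomial ι' k) (h : Associated (e Ψ) Ψ') :
    BirationallyEquivalent k Ψ Ψ' := by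
  have hI : Ideal.span {Ψ'} =
      (Ideal.span {Ψ}).map (e : MvPolynomial ι k →+* MvPolynomial ι' k) := by
    rw [Ideal.map_span, Set.image_singleton]
    exact (Ideal.span_singleton_eq_span_singleton.2 h).symm
  exact ⟨IsFractionRing.algEquivOfAlgEquiv (Ideal.quotientEquivAlg _ _ e hI)⟩

/-- Let `k` be a field of characteristic 0 and `φ` a
nondegenerate quadratic form on `k^m` (`m ≥ 1`), given by a symmetric Gram
matrix `A` with `det A ≠ 0`, which is strongly multiplicative: over
`K = k(t₁,…,t_m)` the form `φ_K` is isometric to `φ(t₁,…,t_m)·φ_K`.  Let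
`b ∈ kˣ` and `x₀ ∈ k^m` with `φ(x₀) ≠ 0`.  Then the forms
`φ ⊥ ⟨−b⟩ : (x,z) ↦ φ(x) − b·z²` and
`φ ⊥ ⟨−b·φ(x₀)⟩ : (x,z) ↦ φ(x) − b·φ(x₀)·z²` are birationally equivalent. -/
theorem strongly_multiplicative_scaling_birational
    (k : Type*) [Field k] [CharZero k] (m : ℕ) (hm : 1 ≤ m)
    -- φ is given by a symmetric nondegenerate Gram matrix A, φ(x) = xᵀ A x
    (A : Matrix (Fin m) (Fin m) k) (hsymm : A.IsSymm) (hnondeg : A.det ≠ 0)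
    -- φ is strongly multiplicative: over K = k(t₁,…,t_m), φ_K ≅ φ(t)·φ_K
    (t : Fin m → FractionRing (MvPolynomial (Fin m) k))
    (ht : ∀ i, t i = algebraMap (MvPolynomial (Fin m) k)
        (FractionRing (MvPolynomial (Fin m) k)) (MvPolynomial.X i))
    (hmult : ∃ Cm : Matrix (Fin m) (Fin m) (FractionRing (MvPolynomial (Fin m) k)),
        IsUnit Cm.det ∧
        Cm * A.map (algebraMap k (FractionRing (MvPolynomial (Fin m) k))) * Cm.transpose =
          (∑ i : Fin m, ∑ j : Fin m,
            algebraMap k (FractionRing (MvPolynomial (Fin m) k)) (A i j) * t i * t j) •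
            A.map (algebraMap k (FractionRing (MvPolynomial (Fin m) k))))
    (b : k) (hb : b ≠ 0)
    (x₀ : Fin m → k) (hx₀ : ∑ i : Fin m, ∑ j : Fin m, A i j * x₀ i * x₀ j ≠ 0)
    (Ψ₁ Ψ₂ : MvPolynomial (Fin m ⊕ Unit) k)
    (hΨ₁ : Ψ₁ = (∑ i : Fin m, ∑ j : Fin m,
          MvPolynomial.C (A i j) * X (Sum.inl i) * X (Sum.inl j))
        - MvPolynomial.C b * X (Sum.inr ()) ^ 2)
    (hΨ₂ : Ψ₂ = (∑ i : Fin m, ∑ j : Fin m,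
          MvPolynomial.C (A i j) * X (Sum.inl i) * X (Sum.inl j))
        - MvPolynomial.C (b * ∑ i : Fin m, ∑ j : Fin m, A i j * x₀ i * x₀ j)
            * X (Sum.inr ()) ^ 2) :
    BirationallyEquivalent k Ψ₁ Ψ₂ := by
  obtain ⟨N, -, hN⟩ := hmult
  have hmapA : (A.map C).map (algebraMap (MvPolynomial (Fin m) k)
      (FractionRing (MvPolynomial (Fin m) k))) =
      A.map (algebraMap k (FractionRing (MvPolynomial (Fin m) k))) := by
    ext i j
    simp [IsScalarTower.algebraMap_apply k (MvPolynomial (Fin m) k)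
      (FractionRing (MvPolynomial (Fin m) k)), algebraMap_eq]
  set c := ∑ i : Fin m, ∑ j : Fin m, A i j * x₀ i * x₀ j with hc
  have hcx : c = x₀ ⬝ᵥ A.mulVec x₀ := Matrix.sum_sum_mul_eq_dotProduct_mulVec A x₀
  obtain ⟨M, hM⟩ := hsymm.exists_similitude_of_generic (hcx ▸ hx₀) N (by
    rw [hmapA, hN, ← Matrix.sum_sum_mul_eq_dotProduct_mulVec]
    congr 1
    simp [ht, IsScalarTower.algebraMap_apply k (MvPolynomial (Fin m) k)
      (FractionRing (MvPolynomial (Fin m) k)), algebraMap_eq])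
  rw [← hcx] at hM
  have hMdet : IsUnit M.det := by
    have h := congrArg Matrix.det hM
    rw [Matrix.det_mul, Matrix.det_mul, Matrix.det_smul] at h
    refine isUnit_iff_ne_zero.2 fun h0 => ?_
    rw [h0, zero_mul, zero_mul] at h
    exact mul_ne_zero (pow_ne_zero _ hx₀) hnondeg h.symm
  let e : MvPolynomial (Fin m ⊕ Unit) k ≃ₐ[k] MvPolynomial (Fin m ⊕ Unit) k :=
    AlgEquiv.ofAlgHom (linearSubstInl Unit M) (linearSubstInl Unit M⁻¹)
      (linearSubstInl_comp Unit (M.mul_nonsing_inv hMdet))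
      (linearSubstInl_comp Unit (M.nonsing_inv_mul hMdet))
  let x : Fin m → MvPolynomial (Fin m ⊕ Unit) k := X ∘ Sum.inl
  have hsum : (∑ i : Fin m, ∑ j : Fin m,
      (C (A i j) * X (Sum.inl i) * X (Sum.inl j) : MvPolynomial (Fin m ⊕ Unit) k)) =
      x ⬝ᵥ (A.map C).mulVec x :=
    Matrix.sum_sum_mul_eq_dotProduct_mulVec (A.map C) x
  have hMC : (M.map C * A.map C * (M.map C).transpose :
      Matrix (Fin m) (Fin m) (MvPolynomial (Fin m ⊕ Unit) k)) =
      (C c : MvPolynomial (Fin m ⊕ Unit) k) •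
        (A.map C : Matrix (Fin m) (Fin m) (MvPolynomial (Fin m ⊕ Unit) k)) := by
    rw [← Matrix.transpose_map, ← Matrix.map_mul, ← Matrix.map_mul, hM]
    ext i j
    simp
  have hform : linearSubstInl Unit M (x ⬝ᵥ (A.map C).mulVec x) =
      C c * (x ⬝ᵥ (A.map C).mulVec x) := by
    have h : linearSubstInl Unit M (x ⬝ᵥ (A.map C).mulVec x) =
        (linearSubstInl Unit M ∘ x) ⬝ᵥ (A.map C).mulVec (linearSubstInl Unit M ∘ x) := by
      simp [dotProduct, Matrix.mulVec, algHom_C, algebraMap_eq]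
    rw [h, linearSubstInl_comp_X_inl, Matrix.dotProduct_mulVec_vecMul, hMC,
      Matrix.smul_mulVec, dotProduct_smul, smul_eq_mul]
  have he : e Ψ₂ = C c * Ψ₁ := by
    change linearSubstInl Unit M Ψ₂ = _
    rw [hΨ₂, hΨ₁, hsum, map_sub, hform, map_mul, map_pow, linearSubstInl_X_inr,
      ← algebraMap_eq, AlgHom.commutes, map_mul]
    ring
  refine (BirationallyEquivalent.of_algEquiv e ?_).symm
  rw [he]
  exact associated_unit_mul_left _ _ ((isUnit_iff_ne_zero.2 hx₀).map C)
end

section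
/- Let p be a prime, k a field of characteristic 0, L/k a Galois field extension of degree p whose Galois group is cyclic generated by σ, and b ∈ kˣ. Let F be the fraction field of the integral domain L[x₀, x₁,…, x_{p−1}]/(x₀ x₁ ⋯ x_{p−1} − b), and let F' = L(s₁,…,s_{p−1}) be the rational function field over L in p−1 variables. Then: (1) there exists a ring automorphism τ of F that restricts to σ on L and satisfies τ(xᵢ) = x_{i+1 mod p} for 0 ≤ i ≤ p−1; (2) there exists a ring automorphism τ' of F' that restricts to σ on L and satisfies τ'(sᵢ) = s_{i+1}·s₁^{−1} for 1 ≤ i ≤ p−2 and τ'(s_{p−1}) = b·s₁^{−1}; (3) there exists a ring isomorphism g : F' → F fixing L pointwise with g(sᵢ) = x₀ x₁ ⋯ x_{i−1} for 1 ≤ i ≤ p−1, and g intertwines the two automorphisms: g ∘ τ' = τ ∘ g. -/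
open MvPolynomial

section PrefixProducts

variable {M N : Type*} [CommMonoid M] [CommMonoid N]

/-- The product of the first `j` entries of a finite family. -/
def prefixProd {n : ℕ} (y : Fin n → M) (j : ℕ) : M :=
  ∏ i with i.val < j, y i

@[simp]
lemma prefixProd_zero {n : ℕ} (y : Fin n → M) : prefixProd y 0 = 1 := by
  simp [prefixProd]

lemma prefixProd_succ {n : ℕ} (y : Fin n → M) (i : Fin n) :
    prefixProd y (i + 1) = prefixProd y i * y i := by
  have h : Finset.univ.filter (fun a : Fin n => a.val < i + 1) =
      insert i (Finset.univ.filter fun a : Fin n => a.val < i) := by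
    ext a
    simp only [Finset.mem_filter, Finset.mem_univ, true_and, Finset.mem_insert, Fin.ext_iff]
    omega
  rw [prefixProd, h, Finset.prod_insert (by simp), mul_comm, prefixProd]

lemma prefixProd_card {n : ℕ} (y : Fin n → M) : prefixProd y n = ∏ i, y i := by
  simp [prefixProd]

lemma map_prefixProd {F : Type*} [FunLike F M N] [MonoidHomClass F M N] (f : F) {n : ℕ}
    (y : Fin n → M) (j : ℕ) : f (prefixProd y j) = prefixProd (fun i => f (y i)) j :=
  map_prod f _ _

lemma prefixProd_rotate {n : ℕ} (y : Fin (n + 1) → M) {j : ℕ} (hj : j ≤ n) :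
    prefixProd (fun i => y (i + 1)) j * y 0 = prefixProd y (j + 1) := by
  induction j with
  | zero => simpa using (prefixProd_succ y 0).symm
  | succ j ih =>
    have h₁ := prefixProd_succ (fun i => y (i + 1)) (⟨j, by omega⟩ : Fin (n + 1))
    have h₂ := prefixProd_succ y (⟨j + 1, by omega⟩ : Fin (n + 1))
    have h₃ : (⟨j, by omega⟩ + 1 : Fin (n + 1)) = ⟨j + 1, by omega⟩ := by
      rw [Fin.ext_iff, Fin.val_add_one_of_lt (by simp [Fin.lt_def]; omega)]
    simp only [h₃] at h₁ h₂
    rw [h₁, h₂, ← ih (by omega), mul_right_comm]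

lemma prefixProd_div {G : Type*} [CommGroupWithZero G] {n : ℕ} (S : ℕ → G)
    (h₀ : S 0 = 1) (hS : ∀ j, S j ≠ 0) {j : ℕ} (hj : j ≤ n) :
    prefixProd (fun i : Fin n => S (i + 1) / S i) j = S j := by
  induction j with
  | zero => simp [h₀]
  | succ j ih =>
    have h := prefixProd_succ (fun i : Fin n => S (i + 1) / S i) ⟨j, by omega⟩
    simp only at h
    rw [h, ih (by omega), mul_div_cancel₀ _ (hS j)]

end PrefixProducts

section NormHypersurface

variable {L : Type*} [Field L]

/-- The coordinate ring `L[x₀, …, xₙ₋₁] / (x₀ ⋯ xₙ₋₁ - c)`. -/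
abbrev NormHypersurface (n : ℕ) (c : L) : Type _ :=
  MvPolynomial (Fin n) L ⧸ Ideal.span {(∏ i : Fin n, X i) - C c}

namespace NormHypersurface

/-- The coordinate functions on the hypersurface. -/
noncomputable def coord {n : ℕ} (c : L) (i : Fin n) : NormHypersurface n c :=
  Ideal.Quotient.mk _ (X i)

lemma prod_coord (n : ℕ) (c : L) :
    ∏ i : Fin n, coord c i = algebraMap L (NormHypersurface n c) c := by
  rw [← sub_eq_zero]
  have h := Ideal.Quotient.eq_zero_iff_mem.mpr
    (Ideal.mem_span_singleton_self ((∏ i : Fin n, (X i : MvPolynomial (Fin n) L)) - C c))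
  rwa [map_sub, map_prod] at h

lemma isUnit_prefixProd_coord {n : ℕ} {c : L} (hc : c ≠ 0) (j : ℕ) :
    IsUnit (prefixProd (coord (n := n) c) j) := by
  have h : IsUnit (∏ i : Fin n, coord c i) := by
    rw [prod_coord]
    exact (IsUnit.mk0 c hc).map _
  exact isUnit_of_dvd_unit (Finset.prod_dvd_prod_of_subset _ _ _ (Finset.filter_subset _ _)) h

/-- The semilinear cyclic shift of the coordinates. -/
noncomputable def shift {n : ℕ} [NeZero n] (c : L) (σ : L ≃+* L) (hc : σ c = c) :
    NormHypersurface n c ≃+* NormHypersurface n c :=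
  Ideal.quotientEquiv _ _
    ((mapEquiv (Fin n) σ).trans (renameEquiv L (Equiv.addRight (1 : Fin n))).toRingEquiv) (by
      rw [Ideal.map_span, Set.image_singleton]
      congr 2
      simp [hc, Fintype.prod_equiv (Equiv.addRight (1 : Fin n))
        (fun i => (X (i + 1) : MvPolynomial (Fin n) L)) X (fun _ => rfl)])

lemma shift_coord {n : ℕ} [NeZero n] (c : L) (σ : L ≃+* L) (hc : σ c = c) (i : Fin n) :
    shift c σ hc (coord c i) = coord c (i + 1) := by
  simp [shift, coord]

lemma shift_algebraMap {n : ℕ} [NeZero n] (c : L) (σ : L ≃+* L) (hc : σ c = c) (l : L) :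
    shift (n := n) c σ hc (algebraMap L _ l) = algebraMap L _ (σ l) := by
  have h (l : L) : algebraMap L (NormHypersurface n c) l = Ideal.Quotient.mk _ (C l) := rfl
  simp [shift, h]

variable {m : ℕ}

/-- The monomials `1, s₁, …, sₘ, c` interpolating between `1` and the prescribed norm `c`. -/
noncomputable def interpolant (m : ℕ) (c : L) (j : ℕ) : FractionRing (MvPolynomial (Fin m) L) :=
  if j = 0 then 1
  else if h : j - 1 < m then algebraMap (MvPolynomial (Fin m) L) _ (X ⟨j - 1, h⟩)
  else algebraMap L _ c

lemma interpolant_ne_zero {c : L} (hc : c ≠ 0) (j : ℕ) : interpolant m c j ≠ 0 := by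
  unfold interpolant
  split_ifs with h₀ h
  · exact one_ne_zero
  · simp
  · simpa using hc

lemma interpolant_succ (c : L) (j : Fin m) :
    interpolant m c (j + 1) = algebraMap (MvPolynomial (Fin m) L) _ (X j) := by
  simp [interpolant]

/-- The rational parametrization of the hypersurface by `x₀ = s₁`, `xᵢ = sᵢ₊₁ / sᵢ`,
`xₘ = c / sₘ`. -/
noncomputable def toRational {c : L} (hc : c ≠ 0) :
    NormHypersurface (m + 1) c →ₐ[L] FractionRing (MvPolynomial (Fin m) L) :=
  Ideal.Quotient.liftₐ _
    (aeval fun i : Fin (m + 1) => interpolant m c (i + 1) / interpolant m c i) (by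
      intro a ha
      refine (Ideal.span_le (I := RingHom.ker (aeval (R := L) fun i : Fin (m + 1) =>
        interpolant m c (i + 1) / interpolant m c i))).mpr ?_ ha
      rw [Set.singleton_subset_iff, SetLike.mem_coe, RingHom.mem_ker, map_sub, map_prod]
      simp only [aeval_X]
      rw [← prefixProd_card, prefixProd_div _ (by simp [interpolant]) (interpolant_ne_zero hc)
        le_rfl, algHom_C, sub_eq_zero]
      simp [interpolant])

lemma toRational_prefixProd {c : L} (hc : c ≠ 0) {j : ℕ} (hj : j ≤ m + 1) :
    toRational hc (prefixProd (coord (n := m + 1) c) j) = interpolant m c j := by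
  have h (i : Fin (m + 1)) : toRational hc (coord c i) =
      interpolant m c (i + 1) / interpolant m c i := by
    exact (Ideal.Quotient.liftₐ_apply _ _ _ _).trans (aeval_X _ i)
  simp only [map_prefixProd, h]
  exact prefixProd_div _ (by simp [interpolant]) (interpolant_ne_zero hc) hj

/-- The map `sⱼ ↦ x₀ ⋯ xⱼ₋₁` from the polynomial ring. -/
noncomputable def ofPoly (m : ℕ) (c : L) :
    MvPolynomial (Fin m) L →ₐ[L] NormHypersurface (m + 1) c :=
  aeval fun j => prefixProd (coord c) (j + 1)

lemma toRational_ofPoly {c : L} (hc : c ≠ 0) (r : MvPolynomial (Fin m) L) :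
    toRational hc (ofPoly m c r) = algebraMap _ _ r := by
  have h : (toRational hc).comp (ofPoly m c) = IsScalarTower.toAlgHom L _ _ := by
    ext j
    simp only [ofPoly, AlgHom.comp_apply, aeval_X]
    rw [toRational_prefixProd hc (by omega), interpolant_succ]
    rfl
  exact DFunLike.congr_fun h r

lemma exists_mul_ofPoly_eq {c : L} (hc : c ≠ 0) (a : NormHypersurface (m + 1) c) :
    ∃ d r, IsUnit (ofPoly m c d) ∧ a * ofPoly m c d = ofPoly m c r := by
  have hT (j : ℕ) (hj : j ≤ m + 1) : ∃ r, ofPoly m c r = prefixProd (coord c) j := by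
    rcases j with _ | j
    · exact ⟨1, by simp⟩
    · by_cases h : j < m
      · exact ⟨X ⟨j, h⟩, by simp [ofPoly]⟩
      · obtain rfl : j = m := by omega
        exact ⟨C c, by rw [prefixProd_card, prod_coord, algHom_C]⟩
  obtain ⟨q, rfl⟩ := Ideal.Quotient.mk_surjective a
  induction q using MvPolynomial.induction_on with
  | C l => exact ⟨1, C l, by simp, by simp only [map_one, mul_one, algHom_C]; rfl⟩
  | add p q hp hq =>
    obtain ⟨d, r, hd, h⟩ := hp
    obtain ⟨e, t, he, h'⟩ := hq
    refine ⟨d * e, r * e + t * d, by rw [map_mul]; exact hd.mul he, ?_⟩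
    simp only [map_add, map_mul, ← h, ← h']
    ring
  | mul_X p i hp =>
    obtain ⟨d, r, hd, h⟩ := hp
    obtain ⟨e, he⟩ := hT i (by omega)
    obtain ⟨t, ht⟩ := hT (i + 1) (by omega)
    refine ⟨d * e, r * t, ?_, ?_⟩
    · rw [map_mul, he]
      exact hd.mul (isUnit_prefixProd_coord hc _)
    · rw [map_mul, map_mul, map_mul, ← h, ht, he, prefixProd_succ, coord]
      ring

lemma toRational_injective {c : L} (hc : c ≠ 0) :
    Function.Injective (toRational (m := m) hc) := by
  rw [injective_iff_map_eq_zero]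
  intro a ha
  obtain ⟨d, r, hd, h⟩ := exists_mul_ofPoly_eq hc a
  have hr : algebraMap _ (FractionRing (MvPolynomial (Fin m) L)) r = 0 := by
    rw [← toRational_ofPoly hc, ← h, map_mul, ha, zero_mul]
  rw [IsFractionRing.to_map_eq_zero_iff] at hr
  rwa [hr, map_zero, hd.mul_left_eq_zero] at h

/-- The function field of the hypersurface is rational. -/
theorem exists_functionField_equiv {c : L} (hc : c ≠ 0) :
    ∃ e : FractionRing (NormHypersurface (m + 1) c) ≃+* FractionRing (MvPolynomial (Fin m) L),
      ∀ a, e (algebraMap _ _ a) = toRational hc a := by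
  let := (toRational (m := m) hc).toRingHom.toAlgebra
  have : FaithfulSMul (NormHypersurface (m + 1) c) (FractionRing (MvPolynomial (Fin m) L)) :=
    (faithfulSMul_iff_algebraMap_injective _ _).mpr (toRational_injective hc)
  have : IsFractionRing (NormHypersurface (m + 1) c) (FractionRing (MvPolynomial (Fin m) L)) := by
    refine IsFractionRing.of_field _ _ fun z => ?_
    obtain ⟨r, d, -, rfl⟩ := IsFractionRing.div_surjective (A := MvPolynomial (Fin m) L) z
    exact ⟨ofPoly m c r, ofPoly m c d,
      congrArg₂ _ (toRational_ofPoly hc r).symm (toRational_ofPoly hc d).symm⟩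
  exact ⟨IsFractionRing.ringEquivOfRingEquiv (.refl _),
    fun a => IsFractionRing.ringEquivOfRingEquiv_algebraMap (.refl _) a⟩

end NormHypersurface

end NormHypersurface


set_option synthInstance.maxHeartbeats 1000000
set_option maxHeartbeats 2000000

/-- Let `p` be a prime (written `p = p₀ + 2`), `k` a field of
characteristic 0, `L/k` Galois of degree `p` with cyclic Galois group generated
by `σ`, and `b ∈ kˣ`.  Let `F` be the fraction field of
`L[x₀,…,x_{p−1}]/(x₀x₁⋯x_{p−1} − b)` and `F' = L(s₁,…,s_{p−1})` the rational
function field in `p − 1` variables.  Then: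
(1) there is a ring automorphism `τ` of `F` restricting to `σ` on `L` with
`τ(xᵢ) = x_{i+1 mod p}`;
(2) there is a ring automorphism `τ'` of `F'` restricting to `σ` on `L` with
`τ'(sᵢ) = s_{i+1}·s₁⁻¹` for `1 ≤ i ≤ p−2` and `τ'(s_{p−1}) = b·s₁⁻¹`;
(3) there is a ring isomorphism `g : F' → F` fixing `L` pointwise with
`g(sᵢ) = x₀x₁⋯x_{i−1}` for `1 ≤ i ≤ p−1`, and `g ∘ τ' = τ ∘ g`.
(Here `s_j` for `1 ≤ j ≤ p−1` is encoded as `s ⟨j−1⟩ : Fin (p₀+1)`.) -/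
theorem cyclic_norm_hypersurface_function_field
    (p₀ : ℕ) (hp : Nat.Prime (p₀ + 2))
    (k L : Type*) [Field k] [CharZero k] [Field L] [Algebra k L] [IsGalois k L]
    (hdeg : Module.finrank k L = p₀ + 2)
    (σ : L ≃ₐ[k] L) (hσ : ∀ τ : L ≃ₐ[k] L, τ ∈ Subgroup.zpowers σ)
    (b : k) (hb : b ≠ 0)
    -- the polynomial x₀x₁⋯x_{p−1} − b and the coordinates xᵢ in F
    (P : MvPolynomial (Fin (p₀ + 2)) L)
    (hP : P = (∏ i : Fin (p₀ + 2), MvPolynomial.X i) - MvPolynomial.C (algebraMap k L b))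
    (x : Fin (p₀ + 2) → FractionRing (MvPolynomial (Fin (p₀ + 2)) L ⧸ Ideal.span {P}))
    (hx : ∀ i, x i = algebraMap (MvPolynomial (Fin (p₀ + 2)) L ⧸ Ideal.span {P})
        (FractionRing (MvPolynomial (Fin (p₀ + 2)) L ⧸ Ideal.span {P}))
        (Ideal.Quotient.mk (Ideal.span {P}) (MvPolynomial.X i)))
    -- the variables s₁,…,s_{p−1} of the rational function field F'
    (s : Fin (p₀ + 1) → FractionRing (MvPolynomial (Fin (p₀ + 1)) L))
    (hs : ∀ j, s j = algebraMap (MvPolynomial (Fin (p₀ + 1)) L)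
        (FractionRing (MvPolynomial (Fin (p₀ + 1)) L)) (MvPolynomial.X j)) :
    ∃ (τ : FractionRing (MvPolynomial (Fin (p₀ + 2)) L ⧸ Ideal.span {P}) ≃+*
        FractionRing (MvPolynomial (Fin (p₀ + 2)) L ⧸ Ideal.span {P}))
      (τ' : FractionRing (MvPolynomial (Fin (p₀ + 1)) L) ≃+*
        FractionRing (MvPolynomial (Fin (p₀ + 1)) L))
      (g : FractionRing (MvPolynomial (Fin (p₀ + 1)) L) ≃+*
        FractionRing (MvPolynomial (Fin (p₀ + 2)) L ⧸ Ideal.span {P})),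
      -- (1) τ restricts to σ on L and cyclically permutes the xᵢ
      (∀ l : L, τ (algebraMap L (FractionRing (MvPolynomial (Fin (p₀ + 2)) L ⧸
          Ideal.span {P})) l) =
        algebraMap L (FractionRing (MvPolynomial (Fin (p₀ + 2)) L ⧸ Ideal.span {P})) (σ l)) ∧
      (∀ i : Fin (p₀ + 2), τ (x i) = x (i + 1)) ∧
      -- (2) τ' restricts to σ on L, τ'(sᵢ) = s_{i+1}/s₁ for i ≤ p−2, τ'(s_{p−1}) = b/s₁
      (∀ l : L, τ' (algebraMap L (FractionRing (MvPolynomial (Fin (p₀ + 1)) L)) l) =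
        algebraMap L (FractionRing (MvPolynomial (Fin (p₀ + 1)) L)) (σ l)) ∧
      (∀ j : Fin (p₀ + 1), ∀ h : (j : ℕ) < p₀,
        τ' (s j) = s ⟨(j : ℕ) + 1, by omega⟩ * (s 0)⁻¹) ∧
      (τ' (s ⟨p₀, by omega⟩) =
        algebraMap L (FractionRing (MvPolynomial (Fin (p₀ + 1)) L)) (algebraMap k L b) *
          (s 0)⁻¹) ∧
      -- (3) g fixes L pointwise, g(s_j) = x₀x₁⋯x_{j−1}, and g ∘ τ' = τ ∘ g
      (∀ l : L, g (algebraMap L (FractionRing (MvPolynomial (Fin (p₀ + 1)) L)) l) =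
        algebraMap L (FractionRing (MvPolynomial (Fin (p₀ + 2)) L ⧸ Ideal.span {P})) l) ∧
      (∀ j : Fin (p₀ + 1),
        g (s j) = ∏ i ∈ Finset.univ.filter (fun i : Fin (p₀ + 2) => (i : ℕ) ≤ (j : ℕ)), x i) ∧
      (∀ w, g (τ' w) = τ (g w)) := by
  obtain ⟨c, hcb⟩ : ∃ c, algebraMap k L b = c := ⟨_, rfl⟩
  have hc : c ≠ 0 := by simpa [← hcb] using hb
  have hσc : (σ : L ≃+* L) c = c := hcb ▸ σ.commutes b
  rw [hcb] at hP ⊢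
  subst hP
  obtain ⟨e, he⟩ := NormHypersurface.exists_functionField_equiv (m := p₀ + 1) hc
  let A := NormHypersurface (p₀ + 2) c
  let τ : FractionRing A ≃+* FractionRing A :=
    IsFractionRing.ringEquivOfRingEquiv
      (NormHypersurface.shift (n := p₀ + 2) c (σ : L ≃+* L) hσc)
  have hτ (a : A) : τ (algebraMap A _ a) =
      algebraMap A _ (NormHypersurface.shift (n := p₀ + 2) c (σ : L ≃+* L) hσc a) :=
    IsFractionRing.ringEquivOfRingEquiv_algebraMap _ a
  have hτL (l : L) : τ (algebraMap L _ l) = algebraMap L _ (σ l) := by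
    rw [IsScalarTower.algebraMap_apply L A, hτ, NormHypersurface.shift_algebraMap,
      ← IsScalarTower.algebraMap_apply]
    rfl
  have hx' : x = fun i => algebraMap A (FractionRing A) (NormHypersurface.coord c i) := funext hx
  have hτx (i : Fin (p₀ + 2)) : τ (x i) = x (i + 1) := by
    simp only [hx', hτ, NormHypersurface.shift_coord]
  have hgL (l : L) : e.symm (algebraMap L _ l) = algebraMap L _ l := by
    rw [RingEquiv.symm_apply_eq, IsScalarTower.algebraMap_apply L A (FractionRing A), he,
      AlgHom.commutes]
  have hgs (j : Fin (p₀ + 1)) : e.symm (s j) = prefixProd x (j + 1) := by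
    rw [RingEquiv.symm_apply_eq, hx', ← map_prefixProd, he,
      NormHypersurface.toRational_prefixProd hc (by omega), NormHypersurface.interpolant_succ, hs]
  have hs0 : s 0 ≠ 0 := by simp [hs]
  have hx0 : e.symm (s 0) = x 0 := by
    rw [hgs]
    simpa using prefixProd_succ x 0
  have hxc : prefixProd x (p₀ + 2) = algebraMap L _ c := by
    rw [hx', ← map_prefixProd, prefixProd_card, NormHypersurface.prod_coord,
      ← IsScalarTower.algebraMap_apply]
  have hτs (j : Fin (p₀ + 1)) : τ (e.symm (s j)) * e.symm (s 0) = prefixProd x (j + 2) := by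
    rw [hgs, hx0, map_prefixProd]
    simp only [hτx]
    exact prefixProd_rotate (n := p₀ + 1) x (by omega)
  refine ⟨τ, (e.symm.trans τ).trans e, e.symm, hτL, hτx, fun l => ?_, fun j h => ?_, ?_, hgL,
    fun j => ?_, fun w => ?_⟩
  · rw [RingEquiv.trans_apply, RingEquiv.trans_apply, hgL, hτL, ← RingEquiv.eq_symm_apply, hgL]
  · rw [eq_mul_inv_iff_mul_eq₀ hs0]
    apply e.symm.injective
    rw [map_mul, RingEquiv.trans_apply, RingEquiv.trans_apply, RingEquiv.symm_apply_apply, hτs,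
      hgs]
  · rw [eq_mul_inv_iff_mul_eq₀ hs0]
    apply e.symm.injective
    rw [map_mul, RingEquiv.trans_apply, RingEquiv.trans_apply, RingEquiv.symm_apply_apply, hτs,
      hgL]
    exact hxc
  · rw [hgs, prefixProd]
    simp only [Nat.lt_succ_iff]
  · simp
end
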